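/- Let k ∈ ℤ and let f = x² − kx + k ∈ ℤ[x]. Then for every a₀ ∈ ℤ, the natural density of the set P(f, a₀) of prime divisors of the orbit of a₀ under f exists and equals 0. -/

import Mathlib

open Polynomial Filter

/-- The `n`-th iterate of a polynomial, with `f^0 = X`. -/
noncomputable def polyIter (f : Polynomial ℤ) : ℕ → Polynomial ℤ
  | 0 => X
  | n + 1 => f.comp (polyIter f n)

open scoped Classical in
/-- The number of elements of `S` that are at most `x`. -/
noncomputable def primeCount (S : Set ℕ) (x : ℕ) : ℕ :=
  ((Finset.range (x + 1)).filter (fun p => p ∈ S)).card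

/-- A set `S` of primes has natural density zero:
`lim_{x → ∞} #{p ∈ S : p ≤ x} / #{p prime : p ≤ x}` exists and equals `0`. -/
def HasPrimeDensityZero (S : Set ℕ) : Prop :=
  Tendsto (fun x : ℕ => (primeCount S x : ℝ) / (primeCount {p | p.Prime} x : ℝ))
    atTop (nhds 0)

/-- `P(f, a₀)`: the set of primes dividing some nonzero term of the orbit of `a₀` under `f`. -/
def orbitPrimes (f : Polynomial ℤ) (a₀ : ℤ) : Set ℕ :=
  {p | p.Prime ∧ ∃ n : ℕ, (fun x => Polynomial.eval x f)^[n] a₀ ≠ 0 ∧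
    (p : ℤ) ∣ (fun x => Polynomial.eval x f)^[n] a₀}


namespace DZ
open ArithmeticFunction in
/-- log-derivation -/
noncomputable def Dl (f : ArithmeticFunction ℝ) : ArithmeticFunction ℝ :=
  ⟨fun n => f n * Real.log n, by simp⟩

lemma Dl_apply (f : ArithmeticFunction ℝ) (n : ℕ) : Dl f n = f n * Real.log n := rfl

lemma Dl_mul (f g : ArithmeticFunction ℝ) : Dl (f * g) = Dl f * g + f * Dl g := by
  ext n
  rw [Dl_apply, ArithmeticFunction.add_apply, ArithmeticFunction.mul_apply, ArithmeticFunction.mul_apply,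
    ArithmeticFunction.mul_apply, Finset.sum_mul, ← Finset.sum_add_distrib]
  refine Finset.sum_congr rfl fun p hp => ?_
  obtain ⟨h1, h2⟩ := Nat.mem_divisorsAntidiagonal.1 hp
  rw [Dl_apply, Dl_apply, ← h1]
  have ha : (p.1 : ℝ) ≠ 0 := by
    intro h; apply h2; rw [← h1]; simp at h; simp [h]
  have hb : (p.2 : ℝ) ≠ 0 := by
    intro h; apply h2; rw [← h1]; simp at h; simp [h]
  push_cast
  rw [Real.log_mul ha hb]; ring

lemma Dl_one : Dl 1 = 0 := by
  ext n
  rw [Dl_apply]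
  by_cases h : n = 1
  · simp [h]
  · simp [h]

structure SelbergData (r L M : ArithmeticFunction ℝ) : Prop where
  r0 : ∀ n, 0 ≤ r n
  r1 : r 1 = 1
  L0 : ∀ n, 0 ≤ L n
  hD : Dl r = L * r
  hM : M * r = 1

variable {r L M : ArithmeticFunction ℝ}

lemma SelbergData.DM (h : SelbergData r L M) : Dl M = - (L * M) := by
  have h1 : Dl M * r + M * (L * r) = 0 := by rw [← h.hD, ← Dl_mul, h.hM, Dl_one]
  have h2 : (Dl M + L * M) * r = 0 := by rw [← h1]; ring
  have h3 : (Dl M + L * M) * r * M = 0 := by rw [h2, zero_mul]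
  rw [mul_assoc, mul_comm r M, h.hM, mul_one] at h3
  exact eq_neg_of_add_eq_zero_left h3

lemma SelbergData.L1 (h : SelbergData r L M) : L 1 = 0 := by
  have := congrArg (fun f => f 1) h.hD
  simp [Dl_apply, h.r1] at this
  exact this.symm

lemma SelbergData.M1 (h : SelbergData r L M) : M 1 = 1 := by
  have := congrArg (fun f => f 1) h.hM
  simpa [h.r1] using this

lemma SelbergData.M_le (h : SelbergData r L M) (n : ℕ) : |M n| ≤ r n := by
  induction n using Nat.strong_induction_on with
  | _ n ih =>
    rcases Nat.lt_or_ge n 2 with hn | hn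
    · interval_cases n
      · simp
      · simp [h.M1, h.r1]
    have hl : 0 < Real.log n := Real.log_pos (by exact_mod_cast hn)
    have e1 : M n * Real.log n = - (L * M) n := by
      rw [← Dl_apply, h.DM]; rfl
    have e2 : r n * Real.log n = (L * r) n := by
      rw [← Dl_apply, h.hD]
    have e3 : |(L * M) n| ≤ (L * r) n := by
      rw [ArithmeticFunction.mul_apply, ArithmeticFunction.mul_apply]
      refine (Finset.abs_sum_le_sum_abs _ _).trans (Finset.sum_le_sum fun p hp => ?_)
      obtain ⟨h1, h2⟩ := Nat.mem_divisorsAntidiagonal.1 hp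
      by_cases hp1 : p.1 = 1
      · simp [hp1, h.L1]
      · rw [abs_mul, abs_of_nonneg (h.L0 _)]
        refine mul_le_mul_of_nonneg_left (ih _ ?_) (h.L0 _)
        have : p.1 ≠ 0 := by rintro h0; simp [h0] at h1; omega
        have : p.2 ≠ 0 := by rintro h0; simp [h0] at h1; omega
        have : 2 * p.2 ≤ p.1 * p.2 := Nat.mul_le_mul_right _ (by omega)
        omega
    have e4 : |M n| * Real.log n ≤ r n * Real.log n := by
      rw [e2, ← abs_of_pos hl, ← abs_mul, e1, abs_neg]; exact e3
    exact le_of_mul_le_mul_right e4 hl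

lemma SelbergData.sel (h : SelbergData r L M) (ℓ : ℝ) :
    r * (ℓ ^ 2 • M - (2 * ℓ) • Dl M + Dl (Dl M)) =
      ℓ ^ 2 • (1 : ArithmeticFunction ℝ) + (2 * ℓ) • L - Dl L + L * L := by
  have h0 : r * M = 1 := by rw [mul_comm, h.hM]
  have h1 : r * Dl M = - L := by
    rw [h.DM]; calc r * -(L*M) = - (L * (r * M)) := by ring
      _ = _ := by rw [h0, mul_one]
  have h2 : r * Dl (Dl M) = - Dl L + L * L := by
    have : Dl (Dl M) = - (Dl L * M) + L * (L * M) := by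
      have : Dl (Dl M) = - Dl (L * M) := by
        rw [h.DM]; ext n; simp [Dl_apply]
      rw [this, Dl_mul, h.DM]; ring
    rw [this]
    calc r * (-(Dl L * M) + L * (L * M)) = (-Dl L + L * L) * (r * M) := by ring
      _ = _ := by rw [h0, mul_one]
  rw [mul_add, mul_sub, h2, mul_smul_comm, mul_smul_comm, h0, h1, smul_neg]
  abel
end DZ


namespace DZ
noncomputable def TT (r : ArithmeticFunction ℝ) (q : ℝ → ℝ) (u : ℝ) : ℝ :=
  ∑ m ∈ Finset.Icc 1 ⌈Real.exp u⌉₊, r m / m * q (u - Real.log m)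

lemma TT_eq (r : ArithmeticFunction ℝ) {q : ℝ → ℝ} (hq : ∀ v ≤ 0, q v = 0) {u : ℝ} {N : ℕ}
    (hN : Real.exp u ≤ N) : TT r q u = ∑ m ∈ Finset.Icc 1 N, r m / m * q (u - Real.log m) := by
  unfold TT
  refine Finset.sum_subset (Finset.Icc_subset_Icc_right (Nat.ceil_le.2 hN)) ?_
  intro m hm hm'
  simp only [Finset.mem_Icc, not_and, not_le] at hm hm'
  have h1 := Nat.lt_of_ceil_lt (hm' hm.1)
  rw [hq, mul_zero]
  have := (Real.le_log_iff_exp_le (by exact_mod_cast hm.1)).2 h1.le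
  linarith

lemma sum_conv (f g : ArithmeticFunction ℝ) (w : ℕ → ℝ) (N : ℕ) (hw : ∀ n, N < n → w n = 0) :
    ∑ d ∈ Finset.Icc 1 N, ∑ m ∈ Finset.Icc 1 N, f d * g m * w (d * m) =
      ∑ n ∈ Finset.Icc 1 N, (f * g) n * w n := by
  have h1 : ∀ n ∈ Finset.Icc 1 N, (f * g) n * w n =
      ∑ p ∈ (Finset.Icc 1 N ×ˢ Finset.Icc 1 N).filter (fun p => p.1 * p.2 = n),
        f p.1 * g p.2 * w (p.1 * p.2) := by
    intro n hn
    rw [Finset.mem_Icc] at hn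
    rw [ArithmeticFunction.mul_apply, Finset.sum_mul]
    have hs : (Finset.Icc 1 N ×ˢ Finset.Icc 1 N).filter (fun p => p.1 * p.2 = n)
        = n.divisorsAntidiagonal := by
      ext ⟨a, b⟩
      simp only [Finset.mem_filter, Finset.mem_product, Finset.mem_Icc, Nat.mem_divisorsAntidiagonal]
      constructor
      · rintro ⟨_, h⟩; exact ⟨h, by omega⟩
      · rintro ⟨h, h0⟩
        have ha : a ≠ 0 := by rintro rfl; simp at h; omega
        have hb : b ≠ 0 := by rintro rfl; simp at h; omega
        have : a ≤ n := Nat.le_of_dvd (by omega) ⟨b, h.symm⟩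
        have : b ≤ n := Nat.le_of_dvd (by omega) ⟨a, by rw [mul_comm]; exact h.symm⟩
        refine ⟨⟨⟨?_, ?_⟩, ?_, ?_⟩, h⟩ <;> omega
    rw [hs]
    refine Finset.sum_congr rfl fun p hp => ?_
    rw [(Nat.mem_divisorsAntidiagonal.1 hp).1]
  rw [Finset.sum_congr rfl h1, ← Finset.sum_product']
  rw [← Finset.sum_filter_add_sum_filter_not _ (fun p : ℕ × ℕ => p.1 * p.2 ∈ Finset.Icc 1 N)]
  rw [Finset.sum_eq_zero (s := Finset.filter (fun p : ℕ × ℕ => ¬ (p.1 * p.2 ∈ Finset.Icc 1 N)) _), add_zero]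
  · rw [← Finset.sum_fiberwise_of_maps_to (s := Finset.filter (fun p : ℕ × ℕ => (p.1 * p.2 ∈ Finset.Icc 1 N)) _)
      (t := Finset.Icc 1 N) (g := fun p => p.1 * p.2)]
    · refine Finset.sum_congr rfl fun n hn => ?_
      rw [Finset.filter_filter]
      refine Finset.sum_congr ?_ fun _ _ => rfl
      ext p; simp only [Finset.mem_filter]
      constructor
      · rintro ⟨a, b, c⟩; exact ⟨a, c⟩
      · rintro ⟨a, b⟩; exact ⟨a, b ▸ hn, b⟩
    · intro p hp; exact (Finset.mem_filter.1 hp).2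
  · intro p hp
    simp only [Finset.mem_filter, Finset.mem_product, Finset.mem_Icc, not_and, not_le] at hp
    rw [hw, mul_zero]
    exact hp.2 (Nat.mul_pos hp.1.1.1 hp.1.2.1)

/-- inversion -/
lemma TT_inv (f g : ArithmeticFunction ℝ) {q : ℝ → ℝ} (hq : ∀ v ≤ 0, q v = 0)
    {u : ℝ} {N : ℕ} (hN : Real.exp u ≤ N) :
    ∑ d ∈ Finset.Icc 1 N, f d / d * TT g q (u - Real.log d) =
      ∑ n ∈ Finset.Icc 1 N, (f * g) n * (q (u - Real.log n) / n) := by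
  rw [← sum_conv f g (fun n => q (u - Real.log n) / n) N]
  · refine Finset.sum_congr rfl fun d hd => ?_
    rw [Finset.mem_Icc] at hd
    have hd0 : (0:ℝ) < d := by exact_mod_cast hd.1
    have : Real.exp (u - Real.log d) ≤ N := by
      rw [Real.exp_sub, Real.exp_log hd0]
      exact (div_le_self (Real.exp_pos _).le (by exact_mod_cast hd.1)).trans hN
    rw [TT_eq g hq this, Finset.mul_sum]
    refine Finset.sum_congr rfl fun m hm => ?_
    rw [Finset.mem_Icc] at hm
    have hm0 : (0:ℝ) < m := by exact_mod_cast hm.1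
    push_cast
    rw [Real.log_mul hd0.ne' hm0.ne', sub_sub]
    field_simp
  · intro n hn
    have : u ≤ Real.log n := by
      rw [Real.le_log_iff_exp_le (by exact_mod_cast (Nat.zero_le N).trans_lt hn)]
      exact hN.trans (by exact_mod_cast hn.le)
    simp [hq _ (sub_nonpos.2 this)]

lemma tail_int {E : ℝ → ℝ} (hE : Measurable E) {C δ : ℝ} (hδ : 0 < δ)
    (hb : ∀ u, 0 ≤ u → |E u| ≤ C * Real.exp (-δ * u)) :
    ∃ c, ∀ u, 0 ≤ u → |(∫ v in (0:ℝ)..u, E v) - c| ≤ C / δ * Real.exp (-δ * u) := by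
  have hi : ∀ a, 0 ≤ a → MeasureTheory.IntegrableOn E (Set.Ioi a) := by
    intro a ha
    refine MeasureTheory.Integrable.mono' (g := fun u => C * Real.exp (-δ * u)) ?_ hE.aestronglyMeasurable ?_
    · exact (exp_neg_integrableOn_Ioi a hδ).const_mul C
    · refine (MeasureTheory.ae_restrict_iff' measurableSet_Ioi).2 (Eventually.of_forall fun u hu => ?_)
      exact hb u (ha.trans (le_of_lt hu))
  refine ⟨∫ v in Set.Ioi 0, E v, fun u hu => ?_⟩
  have h1 : (∫ v in (0:ℝ)..u, E v) - (∫ v in Set.Ioi 0, E v) = - ∫ v in Set.Ioi u, E v := by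
    rw [← intervalIntegral.integral_interval_add_Ioi (hi 0 le_rfl) (hi u hu)]; ring
  rw [h1, abs_neg]
  calc |∫ v in Set.Ioi u, E v| ≤ ∫ v in Set.Ioi u, C * Real.exp (-δ * v) := by
        refine MeasureTheory.norm_integral_le_of_norm_le (f := E) (g := fun v => C * Real.exp (-δ * v)) (μ := MeasureTheory.volume.restrict (Set.Ioi u)) ((exp_neg_integrableOn_Ioi u hδ).const_mul C) ?_
        refine (MeasureTheory.ae_restrict_iff' measurableSet_Ioi).2 (Eventually.of_forall fun v hv => ?_)
        exact hb v (hu.trans (le_of_lt hv))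
    _ = _ := by
        rw [MeasureTheory.integral_const_mul, integral_exp_mul_Ioi (by linarith)]
        field_simp
end DZ


namespace DZ

lemma TT_zero (r : ArithmeticFunction ℝ) {q : ℝ → ℝ} (hq : ∀ v ≤ 0, q v = 0) {u : ℝ} (hu : u ≤ 0) :
    TT r q u = 0 := by
  refine Finset.sum_eq_zero fun m hm => ?_
  rw [Finset.mem_Icc] at hm
  have : 0 ≤ Real.log m := Real.log_natCast_nonneg m
  rw [hq _ (by linarith), mul_zero]

lemma TT_cont (r : ArithmeticFunction ℝ) {q : ℝ → ℝ} (hq : ∀ v ≤ 0, q v = 0) (hc : Continuous q) :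
    Continuous (TT r q) := by
  rw [continuous_iff_continuousAt]
  intro u
  obtain ⟨N, hN⟩ := exists_nat_gt (Real.exp u)
  have : TT r q =ᶠ[nhds u] fun u => ∑ m ∈ Finset.Icc 1 N, r m / m * q (u - Real.log m) := by
    have h1 : ∀ᶠ v in nhds u, Real.exp v < N := Real.continuous_exp.continuousAt.eventually_lt continuousAt_const hN
    filter_upwards [h1] with v hv
    exact TT_eq r hq hv.le
  refine ContinuousAt.congr ?_ this.symm
  apply Continuous.continuousAt
  fun_prop

lemma prim_zero {q : ℝ → ℝ} (hq : ∀ v ≤ 0, q v = 0) (u : ℝ) (hu : u ≤ 0) :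
    ∫ v in (0:ℝ)..u, q v = 0 := by
  rw [intervalIntegral.integral_symm, intervalIntegral.integral_zero_ae, neg_zero]
  refine Eventually.of_forall fun v hv => hq v ?_
  rw [Set.uIoc_of_le hu] at hv
  exact hv.2

lemma TT_int (r : ArithmeticFunction ℝ) {q : ℝ → ℝ} (hq : ∀ v ≤ 0, q v = 0) (hc : Continuous q)
    {u : ℝ} (hu : 0 ≤ u) :
    ∫ v in (0:ℝ)..u, TT r q v = TT r (fun w => ∫ v in (0:ℝ)..w, q v) u := by
  rw [TT_eq r (prim_zero hq) (Nat.le_ceil (Real.exp u))]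
  have : ∫ v in (0:ℝ)..u, TT r q v = ∫ v in (0:ℝ)..u,
      ∑ m ∈ Finset.Icc 1 ⌈Real.exp u⌉₊, r m / m * q (v - Real.log m) := by
    refine intervalIntegral.integral_congr fun v hv => ?_
    rw [Set.uIcc_of_le hu] at hv
    exact TT_eq r hq ((Real.exp_le_exp.2 hv.2).trans (Nat.le_ceil _))
  rw [this, intervalIntegral.integral_finsetSum]
  · refine Finset.sum_congr rfl fun m hm => ?_
    rw [intervalIntegral.integral_const_mul, intervalIntegral.integral_comp_sub_right]
    congr 1
    have h1 := intervalIntegral.integral_add_adjacent_intervals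
      (hc.intervalIntegrable (μ := MeasureTheory.volume) 0 (0 - Real.log m)) (hc.intervalIntegrable (0 - Real.log m) (u - Real.log m))
    rw [prim_zero hq (0 - Real.log m) (by have := Real.log_natCast_nonneg m; linarith), zero_add] at h1
    exact h1
  · intro m hm
    apply Continuous.intervalIntegrable
    fun_prop

lemma asym (r : ArithmeticFunction ℝ) {q Q1 Q2 : ℝ → ℝ} (hq : ∀ v ≤ 0, q v = 0) (hc : Continuous q)
    (hQ1 : Q1 = fun w => ∫ v in (0:ℝ)..w, q v) (hQ2 : Q2 = fun w => ∫ v in (0:ℝ)..w, Q1 v)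
    {κ C δ : ℝ} (hκ : 0 < κ) (hδ : 0 < δ)
    (hG : ∀ u, 0 ≤ u → |TT r q u - κ| ≤ C * Real.exp (-δ * u)) :
    ∃ a b C' : ℝ, 0 ≤ C' ∧ ∀ u, |u ^ 2 * TT r q u - (2 * TT r Q2 u + a * TT r Q1 u + b * TT r q u)|
      ≤ C' * Real.exp (-(δ / 2) * u) := by
  have hQ1z : ∀ v ≤ 0, Q1 v = 0 := by rw [hQ1]; exact prim_zero hq
  have hQ1c : Continuous Q1 := by
    rw [hQ1]; exact intervalIntegral.continuous_primitive (fun a b => hc.intervalIntegrable a b) 0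
  have hQ2z : ∀ v ≤ 0, Q2 v = 0 := by rw [hQ2]; exact prim_zero hQ1z
  have hC : 0 ≤ C := by
    have := (abs_nonneg _).trans (hG 0 le_rfl)
    simpa using this
  obtain ⟨c, h1⟩ := tail_int (E := fun u => TT r q u - κ) ((TT_cont r hq hc).measurable.sub_const _) hδ hG
  have h1' : ∀ u, 0 ≤ u → |TT r Q1 u - κ * u - c| ≤ C / δ * Real.exp (-δ * u) := by
    intro u hu
    have := h1 u hu
    rw [intervalIntegral.integral_sub ((TT_cont r hq hc).intervalIntegrable _ _) (by simp), TT_int r hq hc hu,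
      ← hQ1] at this
    simpa [mul_comm] using this
  obtain ⟨c2, h2⟩ := tail_int (E := fun u => TT r Q1 u - κ * u - c)
    (by have := (TT_cont r hQ1z hQ1c).measurable; fun_prop) hδ h1'
  have h2' : ∀ u, 0 ≤ u → |TT r Q2 u - κ / 2 * u ^ 2 - c * u - c2| ≤ C / δ / δ * Real.exp (-δ * u) := by
    intro u hu
    have := h2 u hu
    rw [intervalIntegral.integral_sub, intervalIntegral.integral_sub, TT_int r hQ1z hQ1c hu,
      ← hQ2] at this
    · convert this using 3
      rw [intervalIntegral.integral_const_mul, integral_id, intervalIntegral.integral_const, smul_eq_mul]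
      ring
    · exact (TT_cont r hQ1z hQ1c).intervalIntegrable _ _
    · apply Continuous.intervalIntegrable; fun_prop
    · apply Continuous.intervalIntegrable
      have := TT_cont r hQ1z hQ1c
      fun_prop
    · simp
  set e := (2 * c ^ 2 / κ - 2 * c2) / κ with he
  set C' := C * (8 / δ ^ 2) + 2 * (C / δ / δ) + |2 * c / κ| * (C / δ) + |e| * C with hC'
  have hC'0 : 0 ≤ C' := by positivity
  refine ⟨- (2 * c / κ), e, C', hC'0, fun u => ?_⟩
  rcases le_or_gt u 0 with hu | hu
  · rw [TT_zero r hq hu, TT_zero r hQ1z hu, TT_zero r hQ2z hu]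
    simp
    positivity
  have hu := hu.le
  set E0 := TT r q u - κ with hE0
  set E1 := TT r Q1 u - κ * u - c with hE1
  set E2 := TT r Q2 u - κ / 2 * u ^ 2 - c * u - c2 with hE2
  have key : u ^ 2 * TT r q u - (2 * TT r Q2 u + -(2 * c / κ) * TT r Q1 u + e * TT r q u)
      = u ^ 2 * E0 - 2 * E2 + (2 * c / κ) * E1 - e * E0 := by
    rw [hE0, hE1, hE2, he]; field_simp; ring
  rw [key]
  have hx : u ^ 2 * Real.exp (-δ * u) ≤ 8 / δ ^ 2 * Real.exp (-(δ / 2) * u) := by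
    have h3 : (δ / 2 * u) ^ 2 / 2 ≤ Real.exp (δ / 2 * u) := by
      have := Real.quadratic_le_exp_of_nonneg (x := δ / 2 * u) (by positivity)
      have h4 : 0 ≤ δ / 2 * u := by positivity
      linarith
    have h5 : u ^ 2 ≤ 8 / δ ^ 2 * Real.exp (δ / 2 * u) := by
      have : u ^ 2 = 8 / δ ^ 2 * ((δ / 2 * u) ^ 2 / 2) := by field_simp; norm_num
      rw [this]; gcongr
    calc u ^ 2 * Real.exp (-δ * u) ≤ 8 / δ ^ 2 * Real.exp (δ / 2 * u) * Real.exp (-δ * u) := by gcongr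
      _ = _ := by rw [mul_assoc, ← Real.exp_add]; ring_nf
  have hx2 : Real.exp (-δ * u) ≤ Real.exp (-(δ / 2) * u) := by
    apply Real.exp_le_exp.2; nlinarith
  have hb0 := hG u hu
  have hb1 := h1' u hu
  have hb2 := h2' u hu
  rw [← hE0] at hb0
  rw [← hE1] at hb1
  rw [← hE2] at hb2
  calc |u ^ 2 * E0 - 2 * E2 + (2 * c / κ) * E1 - e * E0|
      ≤ |u ^ 2 * E0| + |2 * E2| + |(2 * c / κ) * E1| + |e * E0| := by
        refine (abs_sub _ _).trans (add_le_add_left ((abs_add_le _ _).trans (add_le_add_left ((abs_sub _ _)) _)) _)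
    _ = u ^ 2 * |E0| + 2 * |E2| + |2 * c / κ| * |E1| + |e| * |E0| := by
        rw [abs_mul, abs_mul, abs_mul (2 * c / κ), abs_mul e, abs_of_nonneg (sq_nonneg u), abs_two]
    _ ≤ u ^ 2 * (C * Real.exp (-δ * u)) + 2 * (C / δ / δ * Real.exp (-δ * u)) +
          |2 * c / κ| * (C / δ * Real.exp (-δ * u)) + |e| * (C * Real.exp (-δ * u)) := by gcongr
    _ = C * (u ^ 2 * Real.exp (-δ * u)) + 2 * (C / δ / δ) * Real.exp (-δ * u) +
          |2 * c / κ| * (C / δ) * Real.exp (-δ * u) + |e| * C * Real.exp (-δ * u) := by ring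
    _ ≤ C * (8 / δ ^ 2 * Real.exp (-(δ / 2) * u)) + 2 * (C / δ / δ) * Real.exp (-(δ / 2) * u) +
          |2 * c / κ| * (C / δ) * Real.exp (-(δ / 2) * u) + |e| * C * Real.exp (-(δ / 2) * u) := by gcongr
    _ = _ := by rw [hC']; ring
end DZ


namespace DZ

lemma err_sum {r : ArithmeticFunction ℝ} (hr : ∀ n, 0 ≤ r n) {q : ℝ → ℝ} (hq : ∀ v ≤ 0, q v = 0)
    (hq0 : ∀ v, 0 ≤ q v) (hq1 : ∀ v, 1 ≤ v → v ≤ 2 → Real.exp (-2) ≤ q v) {B ε : ℝ} (hε : 0 < ε)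
    (hG : ∀ u, TT r q u ≤ B) (u : ℝ) (N : ℕ) :
    ∑ m ∈ (Finset.Icc 1 N).filter (fun m : ℕ => Real.log m ≤ u), r m / m * Real.exp (-ε * (u - Real.log m))
      ≤ Real.exp 2 * B / (1 - Real.exp (-ε)) := by
  have hB : 0 ≤ B := by
    have := hG 0; rwa [TT_zero r hq le_rfl] at this
  have hx1 : Real.exp (-ε) < 1 := by rw [Real.exp_lt_one_iff]; linarith
  set s := (Finset.Icc 1 N).filter (fun m : ℕ => Real.log m ≤ u) with hs
  set J := ⌊u⌋₊ + 1 with hJ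
  have hTTs : ∀ j : ℕ, ∑ m ∈ s, r m / m * q (u + 1 - j - Real.log m) ≤ TT r q (u + 1 - j) := by
    intro j
    rw [TT_eq r hq (N := max N ⌈Real.exp (u + 1 - j)⌉₊) ((Nat.le_ceil _).trans (by exact_mod_cast le_max_right _ _))]
    refine Finset.sum_le_sum_of_subset_of_nonneg ?_ ?_
    · intro m hm
      simp only [hs, Finset.mem_filter, Finset.mem_Icc] at hm ⊢
      exact ⟨hm.1.1, hm.1.2.trans (le_max_left _ _)⟩
    · intro m _ _
      exact mul_nonneg (div_nonneg (hr m) (Nat.cast_nonneg _)) (hq0 _)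
  have h1 : ∑ j ∈ Finset.range J, Real.exp (-ε) ^ j * TT r q (u + 1 - j) ≤ B / (1 - Real.exp (-ε)) := by
    calc _ ≤ ∑ j ∈ Finset.range J, Real.exp (-ε) ^ j * B := by
          refine Finset.sum_le_sum fun j _ => mul_le_mul_of_nonneg_left (hG _) (by positivity)
      _ = (∑ j ∈ Finset.range J, Real.exp (-ε) ^ j) * B := by rw [Finset.sum_mul]
      _ ≤ (1 - Real.exp (-ε))⁻¹ * B := by
          refine mul_le_mul_of_nonneg_right ?_ hB
          rw [← tsum_geometric_of_lt_one (Real.exp_pos _).le hx1]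
          exact (summable_geometric_of_lt_one (Real.exp_pos _).le hx1).sum_le_tsum _ (fun i _ => by positivity)
      _ = _ := by rw [div_eq_inv_mul]
  have h2 : Real.exp (-2) * ∑ m ∈ s, r m / m * Real.exp (-ε * (u - Real.log m)) ≤
      ∑ j ∈ Finset.range J, Real.exp (-ε) ^ j * TT r q (u + 1 - j) := by
    calc _ ≤ ∑ m ∈ s, ∑ j ∈ Finset.range J, Real.exp (-ε) ^ j * (r m / m * q (u + 1 - j - Real.log m)) := by
          rw [Finset.mul_sum]
          refine Finset.sum_le_sum fun m hm => ?_
          simp only [hs, Finset.mem_filter, Finset.mem_Icc] at hm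
          have hlm := Real.log_natCast_nonneg m
          have hrm : 0 ≤ r m / m := div_nonneg (hr m) (Nat.cast_nonneg _)
          set j := ⌊u - Real.log m⌋₊ with hj
          have hj1 : (j:ℝ) ≤ u - Real.log m := Nat.floor_le (by linarith [hm.2])
          have hj2 : u - Real.log m < j + 1 := Nat.lt_floor_add_one _
          have hjJ : j ∈ Finset.range J := by
            rw [Finset.mem_range, hJ, Nat.lt_succ_iff]
            exact Nat.floor_le_floor (by linarith)
          refine le_trans ?_ (Finset.single_le_sum (f := fun j : ℕ => Real.exp (-ε) ^ j * (r m / m * q (u + 1 - j - Real.log m)))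
            (fun i _ => ?_) hjJ)
          · have a1 := hq1 (u + 1 - j - Real.log m) (by linarith) (by linarith)
            have a2 : Real.exp (-ε * (u - Real.log m)) ≤ Real.exp (-ε) ^ j := by
              rw [← Real.exp_nat_mul]; apply Real.exp_le_exp.2; nlinarith
            calc Real.exp (-2) * (r m / m * Real.exp (-ε * (u - Real.log m)))
                = Real.exp (-ε * (u - Real.log m)) * (r m / m * Real.exp (-2)) := by ring
              _ ≤ Real.exp (-ε) ^ j * (r m / m * q (u + 1 - j - Real.log m)) := by gcongr
          · have := hq0 (u + 1 - i - Real.log m)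
            positivity
      _ = ∑ j ∈ Finset.range J, Real.exp (-ε) ^ j * ∑ m ∈ s, (r m / m * q (u + 1 - j - Real.log m)) := by
          rw [Finset.sum_comm]
          simp_rw [Finset.mul_sum]
      _ ≤ _ := Finset.sum_le_sum fun j _ => mul_le_mul_of_nonneg_left (hTTs j) (by positivity)
  have h3 := h2.trans h1
  have e2 : Real.exp 2 * Real.exp (-2) = 1 := by rw [← Real.exp_add]; simp
  calc _ = Real.exp 2 * (Real.exp (-2) * ∑ m ∈ s, r m / m * Real.exp (-ε * (u - Real.log m))) := by
        rw [← mul_assoc, e2, one_mul]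
    _ ≤ Real.exp 2 * (B / (1 - Real.exp (-ε))) := by gcongr
    _ = _ := by rw [mul_div_assoc]

/-- Selberg upper bound in the abstract setting -/
theorem selberg_psi {r L M : ArithmeticFunction ℝ} (h : SelbergData r L M) {Γ : ℝ → ℝ}
    (hΓc : Continuous Γ) (hΓz : ∀ v ≤ 0, Γ v = 0) (hΓ0 : ∀ v, 0 ≤ Γ v) (hΓ1 : ∀ v, Γ v ≤ 1)
    (hΓ2 : ∀ v, 1 ≤ v → Γ v = 1) {κ C δ : ℝ} (hκ : 0 < κ) (hδ : 0 < δ)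
    (hG : ∀ u, 0 ≤ u → |TT r (fun v => Γ v * Real.exp (-v)) u - κ| ≤ C * Real.exp (-δ * u)) :
    ∃ C', ∀ u, 0 ≤ u → ∀ N : ℕ, (N : ℝ) ≤ Real.exp (u - 1) →
      u * ∑ n ∈ Finset.Icc 1 N, L n ≤ Real.exp u * (2 * u + C') := by
  set q : ℝ → ℝ := fun v => Γ v * Real.exp (-v) with hqdef
  have hq : ∀ v ≤ 0, q v = 0 := fun v hv => by simp [hqdef, hΓz v hv]
  have hqc : Continuous q := by fun_prop
  have hq0 : ∀ v, 0 ≤ q v := fun v => mul_nonneg (hΓ0 v) (Real.exp_pos _).le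
  have hqle : ∀ v, q v ≤ Real.exp (-v) := fun v => by
    have := mul_le_mul_of_nonneg_right (hΓ1 v) (Real.exp_pos (-v)).le
    simpa [hqdef] using this
  have hq1 : ∀ v, 1 ≤ v → v ≤ 2 → Real.exp (-2) ≤ q v := by
    intro v h1 h2
    simp only [hqdef, hΓ2 v h1, one_mul]
    apply Real.exp_le_exp.2; linarith
  set Q1 : ℝ → ℝ := fun w => ∫ v in (0:ℝ)..w, q v with hQ1
  set Q2 : ℝ → ℝ := fun w => ∫ v in (0:ℝ)..w, Q1 v with hQ2
  have hQ1z : ∀ v ≤ 0, Q1 v = 0 := prim_zero hq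
  have hQ1c : Continuous Q1 := intervalIntegral.continuous_primitive (fun a b => hqc.intervalIntegrable a b) 0
  have hQ2z : ∀ v ≤ 0, Q2 v = 0 := prim_zero hQ1z
  have hQ1b : ∀ u, 0 ≤ u → 0 ≤ Q1 u ∧ Q1 u ≤ 1 := by
    intro u hu
    refine ⟨intervalIntegral.integral_nonneg hu fun v _ => hq0 v, ?_⟩
    calc Q1 u ≤ ∫ v in (0:ℝ)..u, Real.exp (-v) := by
          refine intervalIntegral.integral_mono_on hu (hqc.intervalIntegrable _ _) ?_ fun v _ => hqle v
          apply Continuous.intervalIntegrable; fun_prop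
      _ = 1 - Real.exp (-u) := by simp [intervalIntegral.integral_comp_neg (fun x => Real.exp x)]
      _ ≤ 1 := by have := Real.exp_pos (-u); linarith
  have hQ2b : ∀ u, 0 ≤ u → Q2 u ≤ u := by
    intro u hu
    calc Q2 u ≤ ∫ v in (0:ℝ)..u, (1:ℝ) := by
          refine intervalIntegral.integral_mono_on hu (hQ1c.intervalIntegrable _ _) (by simp) fun v hv => (hQ1b v hv.1).2
      _ = u := by simp
  have hC0 : 0 ≤ C := by
    have := (abs_nonneg _).trans (hG 0 le_rfl)
    simpa using this
  have hGB : ∀ u, TT r q u ≤ κ + C := by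
    intro u
    rcases le_total u 0 with hu | hu
    · rw [TT_zero r hq hu]; linarith
    · have h1 := (abs_le.1 (hG u hu)).2
      have : C * Real.exp (-δ * u) ≤ C * 1 := by
        gcongr; rw [Real.exp_le_one_iff]; nlinarith
      linarith
  obtain ⟨a, b, C1, hC1, hE⟩ := asym r hq hqc hQ1 hQ2 hκ hδ hG
  set C2 := Real.exp 2 * (κ + C) / (1 - Real.exp (-(δ / 2))) with hC2
  refine ⟨|a| + |b| + C1 * C2, fun u hu N hN => ?_⟩
  set N' := ⌈Real.exp u⌉₊ with hN'
  have hN'e : Real.exp u ≤ N' := Nat.le_ceil _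
  have hNN' : N ≤ N' := by
    have : (N:ℝ) ≤ N' := hN.trans (le_trans (Real.exp_le_exp.2 (by linarith)) hN'e)
    exact_mod_cast this
  set f : ArithmeticFunction ℝ := u ^ 2 • M - (2 * u) • Dl M + Dl (Dl M) with hf
  have hfa : ∀ d, f d = M d * (u - Real.log d) ^ 2 := by
    intro d
    have : f d = u ^ 2 * M d - (2 * u) * (M d * Real.log d) + M d * Real.log d * Real.log d := rfl
    rw [this]; ring
  have hMr : M * r = 1 := h.hM
  have inv : ∀ {p : ℝ → ℝ}, (∀ v ≤ 0, p v = 0) →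
      ∑ d ∈ Finset.Icc 1 N', M d / d * TT r p (u - Real.log d) = p u := by
    intro p hp
    rw [TT_inv M r hp hN'e, hMr]
    have h1N : 1 ∈ Finset.Icc 1 N' := by
      rw [Finset.mem_Icc]
      refine ⟨le_rfl, ?_⟩
      have := Real.exp_pos u
      exact Nat.one_le_iff_ne_zero.2 (Nat.ceil_pos.2 this).ne'
    rw [Finset.sum_eq_single_of_mem 1 h1N]
    · simp
    · intro n _ hn; simp [hn]
  -- upper bound
  have upper : ∑ d ∈ Finset.Icc 1 N', f d / d * TT r q (u - Real.log d) ≤ 2 * u + (|a| + |b| + C1 * C2) := by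
    set E : ℝ → ℝ := fun u => u ^ 2 * TT r q u - (2 * TT r Q2 u + a * TT r Q1 u + b * TT r q u) with hEdef
    have h1 : ∑ d ∈ Finset.Icc 1 N', f d / d * TT r q (u - Real.log d) =
        2 * Q2 u + a * Q1 u + b * q u + ∑ d ∈ Finset.Icc 1 N', M d / d * E (u - Real.log d) := by
      rw [← inv hQ2z, ← inv hQ1z, ← inv hq, Finset.mul_sum, Finset.mul_sum, Finset.mul_sum,
        ← Finset.sum_add_distrib, ← Finset.sum_add_distrib, ← Finset.sum_add_distrib]
      refine Finset.sum_congr rfl fun d _ => ?_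
      rw [hfa, hEdef]; ring
    have h2 : ∑ d ∈ Finset.Icc 1 N', M d / d * E (u - Real.log d) ≤ C1 * C2 := by
      have hz : ∀ v ≤ 0, E v = 0 := fun v hv => by
        simp [hEdef, TT_zero r hq hv, TT_zero r hQ1z hv, TT_zero r hQ2z hv]
      calc _ = ∑ d ∈ (Finset.Icc 1 N').filter (fun m : ℕ => Real.log m ≤ u), M d / d * E (u - Real.log d) := by
            rw [Finset.sum_filter]
            refine Finset.sum_congr rfl fun d _ => ?_
            split_ifs with hd
            · rfl
            · rw [hz _ (by linarith), mul_zero]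
        _ ≤ ∑ d ∈ (Finset.Icc 1 N').filter (fun m : ℕ => Real.log m ≤ u),
              C1 * (r d / d * Real.exp (-(δ/2) * (u - Real.log d))) := by
            refine Finset.sum_le_sum fun d _ => ?_
            refine (le_abs_self _).trans ?_
            rw [abs_mul, abs_div, Nat.abs_cast]
            have := hE (u - Real.log d)
            have h3 := h.M_le d
            calc |M d| / d * |E (u - Real.log d)| ≤ r d / d * (C1 * Real.exp (-(δ/2) * (u - Real.log d))) := by
                  have h4 := h.r0 d
                  gcongr
              _ = _ := by ring
        _ ≤ _ := by
            rw [← Finset.mul_sum]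
            exact mul_le_mul_of_nonneg_left (err_sum h.r0 hq hq0 hq1 (half_pos hδ) hGB u N') hC1
    have h3 : a * Q1 u ≤ |a| := by
      have := hQ1b u hu
      calc a * Q1 u ≤ |a| * Q1 u := mul_le_mul_of_nonneg_right (le_abs_self a) this.1
        _ ≤ |a| * 1 := mul_le_mul_of_nonneg_left this.2 (abs_nonneg a)
        _ = _ := mul_one _
    have h4 : b * q u ≤ |b| := by
      have h5 : q u ≤ 1 := (hqle u).trans (by rw [Real.exp_le_one_iff]; linarith)
      calc b * q u ≤ |b| * q u := mul_le_mul_of_nonneg_right (le_abs_self b) (hq0 u)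
        _ ≤ |b| * 1 := mul_le_mul_of_nonneg_left h5 (abs_nonneg b)
        _ = _ := mul_one _
    have h5 := hQ2b u hu
    rw [h1]; linarith
  rw [TT_inv f r hq hN'e] at upper
  rw [mul_comm f r, hf, h.sel u] at upper
  have lower : u * (∑ n ∈ Finset.Icc 1 N, L n) * Real.exp (-u) ≤ ∑ n ∈ Finset.Icc 1 N',
      (u ^ 2 • (1 : ArithmeticFunction ℝ) + (2 * u) • L - Dl L + L * L) n * (q (u - Real.log n) / n) := by
    have e : ∀ n : ℕ, (u ^ 2 • (1 : ArithmeticFunction ℝ) + (2 * u) • L - Dl L + L * L) n =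
        u ^ 2 * (1 : ArithmeticFunction ℝ) n + (2 * u) * L n - L n * Real.log n + (L * L) n := fun n => rfl
    have hlb : ∀ n : ℕ, Real.log n ≤ u → u * L n ≤ (u ^ 2 • (1 : ArithmeticFunction ℝ) + (2 * u) • L - Dl L + L * L) n := by
      intro n hn
      rw [e]
      have h1 : 0 ≤ (L * L) n := by
        rw [ArithmeticFunction.mul_apply]
        exact Finset.sum_nonneg fun p _ => mul_nonneg (h.L0 _) (h.L0 _)
      have h2 : 0 ≤ (1 : ArithmeticFunction ℝ) n := by
        rw [ArithmeticFunction.one_apply]; split_ifs <;> norm_num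
      have h3 := mul_le_mul_of_nonneg_left hn (h.L0 n)
      have h4 : 0 ≤ u ^ 2 * (1 : ArithmeticFunction ℝ) n := by positivity
      linarith
    calc _ = ∑ n ∈ Finset.Icc 1 N, u * L n * (q (u - Real.log n) / n) := by
          rw [Finset.mul_sum, Finset.sum_mul]
          refine Finset.sum_congr rfl fun n hn => ?_
          rw [Finset.mem_Icc] at hn
          have hn0 : (0:ℝ) < n := by exact_mod_cast hn.1
          have : Real.log n ≤ u - 1 := by
            rw [Real.log_le_iff_le_exp hn0]
            exact le_trans (by exact_mod_cast hn.2) hN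
          simp only [hqdef]
          rw [hΓ2 _ (by linarith), one_mul, neg_sub, Real.exp_sub, Real.exp_log hn0, Real.exp_neg]
          field_simp
      _ ≤ ∑ n ∈ Finset.Icc 1 N', u * L n * (q (u - Real.log n) / n) := by
          refine Finset.sum_le_sum_of_subset_of_nonneg (Finset.Icc_subset_Icc_right hNN') fun n _ _ => ?_
          exact mul_nonneg (mul_nonneg hu (h.L0 n)) (div_nonneg (hq0 _) (Nat.cast_nonneg _))
      _ ≤ _ := by
          refine Finset.sum_le_sum fun n _ => ?_
          rcases le_total (Real.log n) u with hl | hl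
          · exact mul_le_mul_of_nonneg_right (hlb n hl) (div_nonneg (hq0 _) (Nat.cast_nonneg _))
          · rw [hq _ (by linarith)]; simp
  have := lower.trans upper
  rw [Real.exp_neg, ← div_eq_mul_inv, div_le_iff₀ (Real.exp_pos u)] at this
  linarith
end DZ


namespace DZ

theorem selberg_primes {r L M : ArithmeticFunction ℝ} (h : SelbergData r L M) {Γ : ℝ → ℝ}
    (hΓc : Continuous Γ) (hΓz : ∀ v ≤ 0, Γ v = 0) (hΓ0 : ∀ v, 0 ≤ Γ v) (hΓ1 : ∀ v, Γ v ≤ 1)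
    (hΓ2 : ∀ v, 1 ≤ v → Γ v = 1) {κ C δ : ℝ} (hκ : 0 < κ) (hδ : 0 < δ)
    (hG : ∀ u, 0 ≤ u → |TT r (fun v => Γ v * Real.exp (-v)) u - κ| ≤ C * Real.exp (-δ * u)) :
    ∀ᶠ N : ℕ in atTop, ∑ p ∈ (Finset.Icc 1 N).filter Nat.Prime, r p ≤ 13 * (N / Real.log N) := by
  obtain ⟨C', hC'⟩ := selberg_psi h hΓc hΓz hΓ0 hΓ1 hΓ2 hκ hδ hG
  have hlog : Tendsto (fun N : ℕ => Real.log N) atTop atTop :=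
    Real.tendsto_log_atTop.comp tendsto_natCast_atTop_atTop
  have psi : ∀ᶠ N : ℕ in atTop, ∑ n ∈ Finset.Icc 1 N, L n ≤ 6 * N := by
    filter_upwards [hlog.eventually_ge_atTop (10 * |C'|), eventually_ge_atTop 1] with N hN hN1
    have hN0 : (0:ℝ) < N := by exact_mod_cast hN1
    have hl0 : 0 ≤ Real.log N := Real.log_natCast_nonneg N
    have h1 := hC' (Real.log N + 1) (by linarith) N (by rw [add_sub_cancel_right, Real.exp_log hN0])
    rw [Real.exp_add, Real.exp_log hN0] at h1
    have he := Real.exp_one_lt_d9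
    have h2 : N * Real.exp 1 * (2 * (Real.log N + 1) + C') ≤ (Real.log N + 1) * (6 * N) := by
      have h3 : 2 * (Real.log N + 1) + C' ≤ 2.1 * (Real.log N + 1) := by
        have := le_abs_self C'; linarith
      calc N * Real.exp 1 * (2 * (Real.log N + 1) + C') ≤ N * Real.exp 1 * (2.1 * (Real.log N + 1)) := by gcongr
        _ ≤ N * 2.7182818286 * (2.1 * (Real.log N + 1)) := by gcongr
        _ = (2.7182818286 * 2.1) * ((Real.log N + 1) * N) := by ring
        _ ≤ 6 * ((Real.log N + 1) * N) := by gcongr; norm_num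
        _ = _ := by ring
    exact le_of_mul_le_mul_left (h1.trans h2) (by linarith)
  have hLp : ∀ p : ℕ, p.Prime → r p * Real.log p = L p := by
    intro p hp
    have h1 : r p * Real.log p = (L * r) p := by rw [← h.hD]; rfl
    rw [h1, ArithmeticFunction.mul_apply, Nat.sum_divisorsAntidiagonal fun i j => L i * r j,
      Nat.Prime.sum_divisors hp]
    simp [h.L1, h.r1, hp.pos, Nat.div_self]
  have hsq : Tendsto Nat.sqrt atTop atTop := by
    refine tendsto_atTop.2 fun b => ?_
    filter_upwards [eventually_ge_atTop (b * b)] with n hn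
    exact Nat.le_sqrt.2 hn
  have hlo : ∀ᶠ N : ℕ in atTop, 6 * Real.sqrt N / Real.log 2 ≤ N / Real.log N := by
    have h1 := (isLittleO_log_rpow_atTop (show (0:ℝ) < 1/2 by norm_num)).bound
      (show 0 < Real.log 2 / 6 by have := Real.log_pos one_lt_two; positivity)
    filter_upwards [tendsto_natCast_atTop_atTop.eventually h1, eventually_ge_atTop 2] with N hN hN2
    have hN0 : (0:ℝ) < N := by positivity
    have hl : 0 < Real.log N := Real.log_pos (by exact_mod_cast hN2)
    rw [← Real.sqrt_eq_rpow, Real.norm_of_nonneg hl.le, Real.norm_of_nonneg (Real.sqrt_nonneg _)] at hN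
    have l2 := Real.log_pos one_lt_two
    rw [div_le_div_iff₀ l2 hl]
    calc 6 * Real.sqrt N * Real.log N ≤ 6 * Real.sqrt N * (Real.log 2 / 6 * Real.sqrt N) := by gcongr
      _ = (Real.sqrt N * Real.sqrt N) * Real.log 2 := by ring
      _ = _ := by rw [Real.mul_self_sqrt hN0.le]
  filter_upwards [psi, hsq.eventually psi, hlo, eventually_ge_atTop 2] with N h1 h2 h3 hN2
  have hN0 : (0:ℝ) < N := by positivity
  have hl : 0 < Real.log N := Real.log_pos (by exact_mod_cast hN2)
  have l2 := Real.log_pos one_lt_two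
  have hp2 : ∀ p : ℕ, p.Prime → r p ≤ L p / Real.log 2 := by
    intro p hp
    rw [le_div_iff₀ l2, ← hLp p hp]
    have := h.r0 p
    gcongr
    exact_mod_cast hp.two_le
  calc ∑ p ∈ (Finset.Icc 1 N).filter Nat.Prime, r p
      ≤ ∑ p ∈ (Finset.Icc 1 N).filter Nat.Prime, ((if p ≤ Nat.sqrt N then L p / Real.log 2 else 0) + 2 * L p / Real.log N) := by
        refine Finset.sum_le_sum fun p hp => ?_
        have hpp := (Finset.mem_filter.1 hp).2
        have hp0 : (0:ℝ) < p := by exact_mod_cast hpp.pos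
        have hL0 := h.L0 p
        split_ifs with hps
        · have := hp2 p hpp
          have : 0 ≤ 2 * L p / Real.log N := by positivity
          linarith [hp2 p hpp]
        · rw [zero_add, le_div_iff₀ hl, ← hLp p hpp]
          have : N ≤ p * p := by
            have := Nat.sqrt_lt.1 (not_le.1 hps); omega
          have h4 : Real.log N ≤ 2 * Real.log p := by
            have : Real.log N ≤ Real.log (p * p) := Real.log_le_log hN0 (by exact_mod_cast this)
            rw [Real.log_mul hp0.ne' hp0.ne'] at this; linarith
          have := h.r0 p
          nlinarith
    _ ≤ ∑ p ∈ Finset.Icc 1 N, ((if p ≤ Nat.sqrt N then L p / Real.log 2 else 0) + 2 * L p / Real.log N) := by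
        refine Finset.sum_le_sum_of_subset_of_nonneg (Finset.filter_subset _ _) fun p _ _ => ?_
        have := h.L0 p
        split_ifs <;> positivity
    _ = (∑ p ∈ Finset.Icc 1 (Nat.sqrt N), L p) / Real.log 2 + 2 * (∑ p ∈ Finset.Icc 1 N, L p) / Real.log N := by
        rw [Finset.sum_add_distrib, ← Finset.sum_filter, Finset.sum_div, Finset.mul_sum, Finset.sum_div]
        congr 1
        refine Finset.sum_congr ?_ fun _ _ => rfl
        ext p; simp only [Finset.mem_filter, Finset.mem_Icc]
        have := Nat.sqrt_le_self N
        constructor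
        · rintro ⟨⟨a, b⟩, c⟩; exact ⟨a, c⟩
        · rintro ⟨a, b⟩; exact ⟨⟨a, b.trans this⟩, b⟩
    _ ≤ (6 * Nat.sqrt N) / Real.log 2 + 2 * (6 * N) / Real.log N := by gcongr
    _ ≤ (6 * Real.sqrt N) / Real.log 2 + 2 * (6 * N) / Real.log N := by
        gcongr; exact Real.nat_sqrt_le_real_sqrt
    _ ≤ N / Real.log N + 2 * (6 * N) / Real.log N := by gcongr
    _ = _ := by ring
end DZ


namespace DZ
open NumberField UniqueFactorizationMonoid

section
variable (K : Type*) [Field K] [NumberField K]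

noncomputable def idN (n : ℕ) : Finset (Ideal (𝓞 K)) :=
  (Ideal.finite_setOfPred_absNorm_eq n).toFinset

variable {K}
lemma mem_idN {n : ℕ} {I : Ideal (𝓞 K)} : I ∈ idN K n ↔ Ideal.absNorm I = n := by
  simp [idN]

open scoped Classical in
noncomputable def vM (Q : Ideal (𝓞 K)) : ℝ :=
  if IsPrimePow Q then Real.log (Ideal.absNorm Q.radical) else 0

variable (K)
noncomputable def rK : ArithmeticFunction ℝ := ⟨fun n => if n = 0 then 0 else (idN K n).card, by simp⟩
noncomputable def LK : ArithmeticFunction ℝ := ⟨fun n => if n = 0 then 0 else ∑ Q ∈ idN K n, vM Q, by simp⟩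
variable {K}

lemma vM_nonneg (Q : Ideal (𝓞 K)) : 0 ≤ vM Q := by
  unfold vM; split_ifs
  · exact Real.log_natCast_nonneg _
  · exact le_rfl

lemma vM_pow {P : Ideal (𝓞 K)} (hP : Prime P) {k : ℕ} (hk : 0 < k) : vM (P ^ k) = Real.log (Ideal.absNorm P) := by
  unfold vM
  rw [if_pos ⟨P, k, hP, hk, rfl⟩, Ideal.radical_pow P hk.ne', (Ideal.isPrime_of_prime hP).radical]

lemma pow_dvd_iff_count {I P : Ideal (𝓞 K)} (hI : I ≠ 0) (hP : Prime P) (k : ℕ) :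
    P ^ k ∣ I ↔ k ≤ (normalizedFactors I).count P := by
  have h := emultiplicity_eq_count_normalizedFactors hP.irreducible hI
  rw [normalize_eq] at h
  rw [pow_dvd_iff_le_emultiplicity, h]
  exact_mod_cast Iff.rfl

open scoped Classical in
lemma sum_vM {I : Ideal (𝓞 K)} (hI : I ≠ 0) (s : Finset (Ideal (𝓞 K)))
    (hs : ∀ Q, Q ∈ s ↔ Q ∣ I) : ∑ Q ∈ s, vM Q = Real.log (Ideal.absNorm I) := by
  have h1 : Real.log (Ideal.absNorm I) =
      ∑ P ∈ (normalizedFactors I).toFinset, (normalizedFactors I).count P * Real.log (Ideal.absNorm P) := by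
    conv_lhs => rw [← associated_iff_eq.1 (prod_normalizedFactors hI)]
    rw [map_multiset_prod, Finset.prod_multiset_map_count]
    push_cast
    rw [Real.log_prod]
    · refine Finset.sum_congr rfl fun P _ => ?_
      rw [Real.log_pow]
    · intro P hP
      have : Prime P := prime_of_normalized_factor P (Multiset.mem_toFinset.1 hP)
      have := this.ne_zero
      refine pow_ne_zero _ ?_
      rw [Nat.cast_ne_zero]
      rwa [Ne, Ideal.absNorm_eq_zero_iff]
  rw [h1]
  have h2 : ∀ P ∈ (normalizedFactors I).toFinset, (normalizedFactors I).count P * Real.log (Ideal.absNorm P)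
      = ∑ k ∈ Finset.Icc 1 ((normalizedFactors I).count P), vM (P ^ k) := by
    intro P hP
    have hPp : Prime P := prime_of_normalized_factor P (Multiset.mem_toFinset.1 hP)
    rw [Finset.sum_congr rfl (g := fun _ => Real.log (Ideal.absNorm P))]
    · simp
    · intro k hk; exact vM_pow hPp (Finset.mem_Icc.1 hk).1
  rw [Finset.sum_congr rfl h2, Finset.sum_sigma']
  symm
  refine Finset.sum_bij_ne_zero (fun x _ _ => x.1 ^ x.2) ?_ ?_ ?_ ?_
  · rintro ⟨P, k⟩ hx _
    simp only [Finset.mem_sigma, Multiset.mem_toFinset, Finset.mem_Icc] at hx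
    rw [hs, pow_dvd_iff_count hI (prime_of_normalized_factor P hx.1)]
    exact hx.2.2
  · rintro ⟨P, k⟩ hx _ ⟨P', k'⟩ hx' _ h
    simp only [Finset.mem_sigma, Multiset.mem_toFinset, Finset.mem_Icc] at hx hx' h
    have hP := prime_of_normalized_factor P hx.1
    have hP' := prime_of_normalized_factor P' hx'.1
    have e : P = P' := by
      rw [← (Ideal.isPrime_of_prime hP).radical, ← (Ideal.isPrime_of_prime hP').radical,
        ← Ideal.radical_pow P (n := k) (by omega), h, Ideal.radical_pow P' (by omega)]
    subst e
    have : k = k' := by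
      have hu : ¬ IsUnit P := hP.not_unit
      exact pow_injective_of_not_isUnit hu hP.ne_zero h
    rw [this]
  · intro Q hQ hQ0
    have : IsPrimePow Q := by
      by_contra h; exact hQ0 (by simp [vM, h])
    obtain ⟨P, k, hP, hk, rfl⟩ := this
    rw [hs, pow_dvd_iff_count hI hP] at hQ
    refine ⟨⟨P, k⟩, ?_, hQ0, rfl⟩
    simp only [Finset.mem_sigma, Multiset.mem_toFinset, Finset.mem_Icc]
    exact ⟨Multiset.count_pos.1 (by omega), hk, hQ⟩
  · intro _ _ _; rfl

lemma rK_apply {n : ℕ} (hn : n ≠ 0) : rK K n = (idN K n).card := if_neg hn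
lemma LK_apply {n : ℕ} (hn : n ≠ 0) : LK K n = ∑ Q ∈ idN K n, vM Q := if_neg hn

lemma Dl_rK : Dl (rK K) = LK K * rK K := by
  classical
  ext n
  rcases eq_or_ne n 0 with rfl | hn
  · simp
  rw [Dl_apply, ArithmeticFunction.mul_apply, rK_apply hn]
  have hI : ∀ I ∈ idN K n, I ≠ 0 := by
    intro I hI h
    rw [mem_idN, h] at hI
    simp at hI; exact hn hI.symm
  -- sum over pairs
  have e1 : ∀ p ∈ n.divisorsAntidiagonal, LK K p.1 * rK K p.2 =
      ∑ x ∈ (idN K p.1 ×ˢ idN K p.2), vM x.1 := by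
    intro p hp
    obtain ⟨h1, h2⟩ := Nat.mem_divisorsAntidiagonal.1 hp
    have ha : p.1 ≠ 0 := by rintro h; simp [h] at h1; omega
    have hb : p.2 ≠ 0 := by rintro h; simp [h] at h1; omega
    rw [LK_apply ha, rK_apply hb, Finset.sum_product, Finset.sum_mul]
    refine Finset.sum_congr rfl fun Q _ => ?_
    simp [mul_comm]
  rw [Finset.sum_congr rfl e1]
  have e2 : (idN K n).card * Real.log n = ∑ I ∈ idN K n, Real.log (Ideal.absNorm I) := by
    rw [Finset.sum_congr rfl (g := fun _ => Real.log n)]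
    · simp
    · intro I hI; rw [mem_idN.1 hI]
  rw [e2]
  set B := (Finset.range (n+1)).biUnion (idN K) with hB
  have e3 : ∀ I ∈ idN K n, Real.log (Ideal.absNorm I) = ∑ Q ∈ B.filter (· ∣ I), vM Q := by
    intro I hIn
    refine (sum_vM (hI I hIn) _ fun Q => ?_).symm
    simp only [Finset.mem_filter, hB, Finset.mem_biUnion, mem_idN, Finset.mem_range]
    refine ⟨fun h => h.2, fun h => ⟨⟨_, ?_, rfl⟩, h⟩⟩
    have := map_dvd Ideal.absNorm h
    rw [mem_idN.1 hIn] at this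
    have := Nat.le_of_dvd (by omega) this
    omega
  rw [Finset.sum_congr rfl e3, Finset.sum_sigma', Finset.sum_sigma']
  symm
  refine Finset.sum_nbij (fun x => ⟨x.2.1 * x.2.2, x.2.1⟩) ?_ ?_ ?_ ?_
  · rintro ⟨⟨a, b⟩, ⟨Q, J⟩⟩ hx
    simp only [Finset.mem_sigma, Nat.mem_divisorsAntidiagonal, Finset.mem_product, mem_idN] at hx
    obtain ⟨⟨h1, h2⟩, h3, h4⟩ := hx
    simp only [Finset.mem_sigma, mem_idN, Finset.mem_filter, hB, Finset.mem_biUnion, Finset.mem_range, map_mul, h3, h4, h1, true_and]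
    refine ⟨⟨a, ?_, rfl⟩, dvd_mul_right _ _⟩
    have := Nat.le_of_dvd (by omega) (Dvd.intro _ h1)
    omega
  · rintro ⟨⟨a, b⟩, ⟨Q, J⟩⟩ hx ⟨⟨a', b'⟩, ⟨Q', J'⟩⟩ hx' h
    simp only [Finset.coe_sigma, Set.mem_sigma_iff, Finset.mem_coe, Nat.mem_divisorsAntidiagonal, Finset.mem_product, mem_idN] at hx hx'
    obtain ⟨⟨h1, h2⟩, h3, h4⟩ := hx
    obtain ⟨⟨h1', h2'⟩, h3', h4'⟩ := hx'
    simp only [Sigma.mk.injEq, heq_eq_eq] at h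
    obtain ⟨hm, rfl⟩ := h
    have hQ : Q ≠ 0 := by
      rintro rfl; simp at h3; subst h3; simp at h1; omega
    obtain rfl := mul_left_cancel₀ hQ hm
    subst h3 h4 h3' h4'
    rfl
  · rintro ⟨I, Q⟩ hx
    simp only [Finset.coe_sigma, Set.mem_sigma_iff, Finset.mem_coe, mem_idN, Finset.mem_filter] at hx
    obtain ⟨h1, h2, J, rfl⟩ := hx
    refine ⟨⟨⟨Ideal.absNorm Q, Ideal.absNorm J⟩, ⟨Q, J⟩⟩, ?_, rfl⟩
    simp only [Finset.coe_sigma, Set.mem_sigma_iff, Finset.mem_coe, Nat.mem_divisorsAntidiagonal, Finset.mem_product, mem_idN, and_true]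
    rw [map_mul] at h1
    exact ⟨h1, hn⟩
  · intro _ _; rfl

variable (K) in
lemma rK_one : rK K 1 = 1 := by
  rw [rK_apply one_ne_zero]
  have : idN K 1 = {⊤} := by
    ext I; rw [mem_idN, Ideal.absNorm_eq_one_iff, Finset.mem_singleton]
  simp [this]

variable (K) in
lemma selbergData_K : ∃ M, SelbergData (rK K) (LK K) M := by
  have h1 : IsUnit (rK K) := by
    rw [ArithmeticFunction.isUnit_iff_isUnit_apply_one, rK_one]; exact isUnit_one
  obtain ⟨M, hM⟩ := h1.exists_left_inv
  refine ⟨M, ⟨fun n => ?_, rK_one K, fun n => ?_, Dl_rK, hM⟩⟩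
  · rcases eq_or_ne n 0 with rfl | hn
    · simp
    · rw [rK_apply hn]; positivity
  · rcases eq_or_ne n 0 with rfl | hn
    · simp
    · rw [LK_apply hn]; exact Finset.sum_nonneg fun Q _ => vM_nonneg Q
end
end DZ


namespace DZ
open MeasureTheory Submodule Module
section
open scoped Pointwise
variable {E ι : Type*} [NormedAddCommGroup E] [NormedSpace ℝ E] [FiniteDimensional ℝ E]
  [MeasurableSpace E] [BorelSpace E] [Finite ι]

lemma lattice_fin (b : Basis ι ℝ E) (r : ℝ) : {g : span ℤ (Set.range b) | ‖(g : E)‖ ≤ r}.Finite := by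
  have : ProperSpace E := FiniteDimensional.proper ℝ E
  have h := ZSpan.setFinite_inter b (s := Metric.closedBall (0:E) r) Metric.isBounded_closedBall
  refine Set.Finite.of_finite_image (f := Subtype.val) (h.subset ?_) Subtype.val_injective.injOn
  rintro _ ⟨g, hg, rfl⟩
  exact ⟨by simpa using hg, g.2⟩

lemma lattice_count (μ : Measure E) [μ.IsAddHaarMeasure] (b : Basis ι ℝ E) {d r : ℝ}
    (hd : ∀ x ∈ ZSpan.fundamentalDomain b, ‖x‖ ≤ d) (hr : 0 ≤ r + d) :
    ((lattice_fin b r).toFinset.card : ℝ) * μ.real (ZSpan.fundamentalDomain b) ≤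
      (r + d) ^ finrank ℝ E * μ.real (Metric.ball 0 1) := by
  have : VAddInvariantMeasure (span ℤ (Set.range b)) E μ :=
    inferInstanceAs (VAddInvariantMeasure (span ℤ (Set.range b)).toAddSubgroup E μ)
  have hD := ZSpan.isAddFundamentalDomain b μ
  have hb : μ.real (Metric.closedBall 0 (r + d)) = (r + d) ^ finrank ℝ E * μ.real (Metric.ball 0 1) := by
    simp only [Measure.real]
    rw [Measure.addHaar_closedBall μ _ hr, ENNReal.toReal_mul, ENNReal.toReal_ofReal (by positivity)]
  rw [← hb]
  have h2 : μ (Metric.closedBall 0 (r + d)) =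
      ∑' g : span ℤ (Set.range b), μ ((g +ᵥ Metric.closedBall (0:E) (r + d) : Set E) ∩ ZSpan.fundamentalDomain b) :=
    hD.measure_eq_tsum _
  have h2 : μ (Metric.closedBall 0 (r + d)) =
      ∑' g : span ℤ (Set.range b), μ ((-g +ᵥ Metric.closedBall (0:E) (r + d) : Set E) ∩ ZSpan.fundamentalDomain b) := by
    rw [h2]; exact ((Equiv.neg _).tsum_eq _).symm
  have h3 : ∑ g ∈ (lattice_fin b r).toFinset, μ (ZSpan.fundamentalDomain b) ≤ μ (Metric.closedBall 0 (r + d)) := by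
    rw [h2]
    refine le_trans (Finset.sum_le_sum fun g hg => ?_) (ENNReal.sum_le_tsum _)
    refine measure_mono fun x hx => ⟨?_, hx⟩
    rw [Set.mem_vadd_set_iff_neg_vadd_mem]
    simp only [neg_neg, Metric.mem_closedBall, dist_zero_right]
    have hg' : ‖(g : E)‖ ≤ r := by simpa using hg
    calc ‖(g : E) + x‖ ≤ ‖(g:E)‖ + ‖x‖ := norm_add_le _ _
      _ ≤ _ := add_le_add hg' (hd x hx)
  have h4 := ENNReal.toReal_mono (measure_closedBall_lt_top).ne h3
  simpa [Measure.real] using h4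

theorem lattice_sum (μ : Measure E) [μ.IsAddHaarMeasure] (b : Basis ι ℝ E) {F : E → ℝ} {L R t₀ : ℝ}
    (hL : 0 ≤ L) (hLip : ∀ x y, |F x - F y| ≤ L * ‖x - y‖) (hR0 : 0 ≤ R) (hR : ∀ x, R ≤ ‖x‖ → F x = 0)
    (ht₀ : 0 < t₀) :
    ∃ C, ∀ t, t₀ ≤ t → |∑' g : span ℤ (Set.range b), F (t⁻¹ • (g : E)) -
      t ^ finrank ℝ E * ((∫ x, F x ∂μ) / μ.real (ZSpan.fundamentalDomain b))| ≤
      C * (t ^ finrank ℝ E / t) := by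
  have : Fintype ι := Fintype.ofFinite ι
  have : ProperSpace E := FiniteDimensional.proper ℝ E
  have : VAddInvariantMeasure (span ℤ (Set.range b)) E μ :=
    inferInstanceAs (VAddInvariantMeasure (span ℤ (Set.range b)).toAddSubgroup E μ)
  have hD := ZSpan.isAddFundamentalDomain b μ
  set D := ZSpan.fundamentalDomain b with hDdef
  set n := finrank ℝ E
  obtain ⟨d, hd⟩ := (ZSpan.fundamentalDomain_isBounded b).exists_norm_le
  have hd0 : 0 ≤ d := le_trans (norm_nonneg _) (hd _ (ZSpan.fract_mem_fundamentalDomain b 0))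
  have hDfin : μ D ≠ ⊤ := (ZSpan.fundamentalDomain_isBounded b).measure_lt_top.ne
  have hDpos : 0 < μ.real D := ENNReal.toReal_pos (ZSpan.measure_fundamentalDomain_ne_zero b) hDfin
  have hFc : Continuous F := by
    have : LipschitzWith ⟨L, hL⟩ F := LipschitzWith.of_dist_le_mul fun x y => by
      rw [Real.dist_eq, dist_eq_norm]; exact hLip x y
    exact this.continuous
  refine ⟨(L * d) * ((R + 2 * d / t₀) ^ n * μ.real (Metric.ball 0 1) / μ.real D), fun t ht => ?_⟩
  have ht0 : 0 < t := lt_of_lt_of_le ht₀ ht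
  set H : E → ℝ := fun x => F (t⁻¹ • x) with hH
  have hHc : Continuous H := hFc.comp (continuous_const_smul _)
  have hH0 : ∀ x, R * t ≤ ‖x‖ → H x = 0 := fun x hx => hR _ (by
    rw [norm_smul, norm_inv, Real.norm_of_nonneg ht0.le, ← div_eq_inv_mul, le_div_iff₀ ht0]; exact hx)
  have hHL : ∀ x y, |H x - H y| ≤ L / t * ‖x - y‖ := fun x y => by
    refine (hLip _ _).trans_eq ?_
    rw [← smul_sub, norm_smul, norm_inv, Real.norm_of_nonneg ht0.le]; ring
  have hHs : HasCompactSupport H := HasCompactSupport.intro (isCompact_closedBall (0:E) (R * t)) fun x hx =>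
    hH0 x (by simpa using le_of_lt (by simpa using hx))
  have hHi : Integrable H μ := hHc.integrable_of_hasCompactSupport hHs
  have hintg : ∫ x, H x ∂μ = t ^ n * ∫ x, F x ∂μ := by
    rw [hH, Measure.integral_comp_inv_smul_of_nonneg μ _ ht0.le]; rfl
  have hsum := hD.integral_eq_tsum'' H hHi
  set S := (lattice_fin b (R * t + d)).toFinset with hS
  have hnS : ∀ g ∉ S, ∀ x, ‖x‖ ≤ d → H ((g : E) + x) = 0 := by
    intro g hg x hx
    have : R * t + d < ‖(g : E)‖ := by simpa [hS] using hg
    apply hH0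
    have := norm_sub_le ((g : E) + x) x
    rw [add_sub_cancel_right] at this
    linarith
  rw [tsum_eq_sum (s := S)] at hsum
  swap
  · intro g hg
    rw [setIntegral_congr_fun (g := fun _ => (0:ℝ)) (ZSpan.fundamentalDomain_measurableSet b)]
    · simp
    · intro x hx
      exact hnS g hg x (hd x hx)
  rw [tsum_eq_sum (s := S)]
  swap
  · intro g hg
    have := hnS g hg 0 (by simpa using hd0)
    simpa using this
  have hcount := lattice_count μ b (r := R * t + d) hd (by positivity)
  have key : |(∑ g ∈ S, H g) * μ.real D - ∫ x, H x ∂μ| ≤ S.card * (L / t * d * μ.real D) := by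
    rw [hsum, Finset.sum_mul, ← Finset.sum_sub_distrib]
    refine (Finset.abs_sum_le_sum_abs _ _).trans ?_
    rw [← nsmul_eq_mul]
    refine Finset.sum_le_card_nsmul _ _ _ fun g _ => ?_
    have e1 : H g * μ.real D = ∫ x in D, H g ∂μ := by simp [mul_comm]
    have hi2 : IntegrableOn (fun x => H (g +ᵥ x)) D μ := by
      have : Continuous fun x => H (g +ᵥ x) := hHc.comp (continuous_const_add (g : E))
      exact (this.locallyIntegrable.integrableOn_isCompact
        (isCompact_closedBall (0:E) d)).mono_set fun x hx => by simpa using hd x hx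
    have hi1 : IntegrableOn (fun _ : E => H g) D μ := integrableOn_const (hs := hDfin) (hC := by simp)
    rw [e1, ← integral_sub hi1 hi2, ← Real.norm_eq_abs]
    refine norm_setIntegral_le_of_norm_le_const hDfin.lt_top fun x hx => ?_
    rw [Real.norm_eq_abs]
    refine (hHL _ _).trans ?_
    have : ‖(g : E) - (g +ᵥ x)‖ = ‖x‖ := by
      change ‖(g : E) - ((g : E) + x)‖ = ‖x‖
      simp
    rw [this]
    have := hd x hx
    gcongr
  have e : (∑ g ∈ S, H g) - t ^ n * ((∫ x, F x ∂μ) / μ.real D)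
      = ((∑ g ∈ S, H g) * μ.real D - ∫ x, H x ∂μ) / μ.real D := by
    rw [hintg]; field_simp
  change |(∑ g ∈ S, H g) - t ^ n * ((∫ x, F x ∂μ) / μ.real D)| ≤ _
  rw [e, abs_div, abs_of_pos hDpos, div_le_iff₀ hDpos]
  refine key.trans ?_
  have h5 : (S.card : ℝ) * μ.real D ≤ t ^ n * ((R + 2 * d / t₀) ^ n * μ.real (Metric.ball 0 1)) := by
    refine hcount.trans ?_
    rw [← mul_assoc, ← mul_pow]
    gcongr
    have : d ≤ d / t₀ * t := by rw [div_mul_eq_mul_div, le_div_iff₀ ht₀]; gcongr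
    have e : t * (R + 2 * d / t₀) = R * t + 2 * (d / t₀ * t) := by ring
    rw [e]; linarith
  calc (S.card : ℝ) * (L / t * d * μ.real D) = (L * d / t) * (S.card * μ.real D) := by ring
    _ ≤ (L * d / t) * (t ^ n * ((R + 2 * d / t₀) ^ n * μ.real (Metric.ball 0 1))) := by gcongr
    _ = _ := by field_simp

end
end DZ


namespace DZ

noncomputable def hat (v : ℝ) : ℝ := max 0 (1 - |v|)

lemma hat_nonneg (v : ℝ) : 0 ≤ hat v := le_max_left _ _
lemma hat_le_one (v : ℝ) : hat v ≤ 1 := max_le zero_le_one (by linarith [abs_nonneg v])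
lemma hat_eq_zero {v : ℝ} (h : 1 ≤ |v|) : hat v = 0 := max_eq_left (by linarith)
lemma hat_lip (v w : ℝ) : |hat v - hat w| ≤ |v - w| := by
  unfold hat
  refine (abs_max_sub_max_le_max _ _ _ _).trans ?_
  have : |(1 - |v|) - (1 - |w|)| ≤ |v - w| := by
    rw [sub_sub_sub_cancel_left, abs_sub_comm v w]; exact abs_abs_sub_abs_le _ _
  simpa using this
lemma hat_zero : hat 0 = 1 := by simp [hat]
lemma hat_cont : Continuous hat := by unfold hat; fun_prop

lemma prod_lip {W : Type*} (s : Finset W) (f g : W → ℝ) (hf0 : ∀ w, 0 ≤ f w) (hf : ∀ w, f w ≤ 1)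
    (hg0 : ∀ w, 0 ≤ g w) (hg : ∀ w, g w ≤ 1) :
    |∏ w ∈ s, f w - ∏ w ∈ s, g w| ≤ ∑ w ∈ s, |f w - g w| := by
  classical
  induction s using Finset.induction_on with
  | empty => simp
  | insert a s ha ih =>
    rw [Finset.prod_insert ha, Finset.prod_insert ha, Finset.sum_insert ha]
    have e : f a * ∏ w ∈ s, f w - g a * ∏ w ∈ s, g w =
        (f a - g a) * ∏ w ∈ s, f w + g a * (∏ w ∈ s, f w - ∏ w ∈ s, g w) := by ring
    rw [e]
    refine (abs_add_le _ _).trans (add_le_add ?_ ?_)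
    · rw [abs_mul]
      refine mul_le_of_le_one_right (abs_nonneg _) ?_
      rw [abs_of_nonneg (Finset.prod_nonneg fun w _ => hf0 w)]
      exact Finset.prod_le_one (fun w _ => hf0 w) fun w _ => hf w
    · rw [abs_mul, abs_of_nonneg (hg0 a)]
      exact (mul_le_of_le_one_left (abs_nonneg _) (hg a)).trans ih

section
variable {W : Type*} [Fintype W]
/-- product of hats in linear coordinates -/
noncomputable def Ph (T : (W → ℝ) ≃ₗ[ℝ] (W → ℝ)) (c : W → ℝ) (l : W → ℝ) : ℝ := ∏ w, hat (c w * T l w)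

lemma Ph_nonneg (T : (W → ℝ) ≃ₗ[ℝ] (W → ℝ)) (c l) : 0 ≤ Ph T c l := Finset.prod_nonneg fun _ _ => hat_nonneg _
lemma Ph_le (T : (W → ℝ) ≃ₗ[ℝ] (W → ℝ)) (c l) : Ph T c l ≤ 1 :=
  Finset.prod_le_one (fun _ _ => hat_nonneg _) fun _ _ => hat_le_one _

lemma Ph_lip (T : (W → ℝ) ≃ₗ[ℝ] (W → ℝ)) (c : W → ℝ) :
    ∃ L, 0 ≤ L ∧ ∀ l l', |Ph T c l - Ph T c l'| ≤ L * ‖l - l'‖ := by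
  let A := T.toLinearMap.toContinuousLinearMap
  refine ⟨∑ w, |c w| * ‖A‖, by positivity, fun l l' => ?_⟩
  refine (prod_lip _ _ _ (fun _ => hat_nonneg _) (fun _ => hat_le_one _) (fun _ => hat_nonneg _)
    (fun _ => hat_le_one _)).trans ?_
  rw [Finset.sum_mul]
  refine Finset.sum_le_sum fun w _ => (hat_lip _ _).trans ?_
  rw [← mul_sub, abs_mul, mul_assoc]
  gcongr
  have h1 : T l w - T l' w = A (l - l') w := by simp [A]
  rw [h1, ← Real.norm_eq_abs]
  exact (norm_le_pi_norm _ w).trans (A.le_opNorm _)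

lemma Ph_supp (T : (W → ℝ) ≃ₗ[ℝ] (W → ℝ)) (c : W → ℝ) (hc : ∀ w, 1 ≤ c w) :
    ∃ B, 0 ≤ B ∧ ∀ l, B < ‖l‖ → Ph T c l = 0 := by
  let A := T.symm.toLinearMap.toContinuousLinearMap
  refine ⟨‖A‖, norm_nonneg _, fun l hl => ?_⟩
  by_contra h
  have h2 : ‖T l‖ ≤ 1 := by
    rw [pi_norm_le_iff_of_nonneg zero_le_one]
    intro w
    by_contra hw
    push Not at hw
    apply h
    refine Finset.prod_eq_zero (Finset.mem_univ w) (hat_eq_zero ?_)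
    rw [abs_mul, ← Real.norm_eq_abs (T l w)]
    have := hc w
    rw [abs_of_nonneg (by linarith)]
    nlinarith
  have h3 : ‖l‖ ≤ ‖A‖ * ‖T l‖ := by
    have := A.le_opNorm (T l)
    simpa [A] using this
  nlinarith [norm_nonneg A]

lemma log_lip {a b m : ℝ} (hm : 0 < m) (ha : m ≤ a) (hb : m ≤ b) : |Real.log a - Real.log b| ≤ |a - b| / m := by
  have key : ∀ x y : ℝ, m ≤ x → m ≤ y → Real.log x - Real.log y ≤ |x - y| / m := by
    intro x y hx hy
    have hx0 : 0 < x := by linarith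
    have hy0 : 0 < y := by linarith
    rw [← Real.log_div hx0.ne' hy0.ne']
    refine (Real.log_le_sub_one_of_pos (by positivity)).trans ?_
    have : x / y - 1 = (x - y) / y := by field_simp
    rw [this]
    refine (div_le_div_of_nonneg_right (le_abs_self _) hy0.le).trans ?_
    gcongr
  rw [abs_le]
  have := key b a hb ha
  rw [abs_sub_comm] at this
  exact ⟨by linarith, key a b ha hb⟩

open scoped Classical in
/-- composite with logs -/
noncomputable def PF {E : Type*} (T : (W → ℝ) ≃ₗ[ℝ] (W → ℝ)) (c : W → ℝ) (N : E → W → ℝ) (x : E) : ℝ :=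
  if ∀ w, N x w ≠ 0 then Ph T c (fun w => Real.log (N x w)) else 0

lemma PF_lip {E : Type*} [NormedAddCommGroup E] (T : (W → ℝ) ≃ₗ[ℝ] (W → ℝ)) (c : W → ℝ) (hc : ∀ w, 1 ≤ c w)
    (N : E → W → ℝ) (hN0 : ∀ x w, 0 ≤ N x w) (hN : ∀ x y w, |N x w - N y w| ≤ ‖x - y‖)
    (hE : ∀ x (r : ℝ), 0 ≤ r → (∀ w, N x w ≤ r) → ‖x‖ ≤ r) :
    ∃ L R, 0 ≤ L ∧ 0 ≤ R ∧ (∀ x y, |PF T c N x - PF T c N y| ≤ L * ‖x - y‖) ∧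
      ∀ x, R ≤ ‖x‖ → PF T c N x = 0 := by
  obtain ⟨L, hL0, hL⟩ := Ph_lip T c
  obtain ⟨B, hB0, hB⟩ := Ph_supp T c hc
  have h0 : ∀ x, 0 ≤ PF T c N x := fun x => by
    unfold PF; split_ifs; exacts [Ph_nonneg _ _ _, le_rfl]
  have h1 : ∀ x, PF T c N x ≤ 1 := fun x => by
    unfold PF; split_ifs; exacts [Ph_le _ _ _, zero_le_one]
  have hne : ∀ x, PF T c N x ≠ 0 → ∀ w, Real.exp (-B) ≤ N x w ∧ N x w ≤ Real.exp B := by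
    intro x hx w
    unfold PF at hx
    split_ifs at hx with h
    · have h2 : ‖fun w => Real.log (N x w)‖ ≤ B := by
        by_contra h3; exact hx (hB _ (not_le.1 h3))
      have h3 := (norm_le_pi_norm (fun w => Real.log (N x w)) w).trans h2
      rw [Real.norm_eq_abs, abs_le] at h3
      have hp : 0 < N x w := lt_of_le_of_ne (hN0 x w) (h w).symm
      exact ⟨(Real.le_log_iff_exp_le hp).1 h3.1, (Real.log_le_iff_le_exp hp).1 h3.2⟩
    · exact absurd rfl hx
  set m := Real.exp (-B) with hm
  have hmp : 0 < m := Real.exp_pos _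
  have key : ∀ x y, PF T c N x ≠ 0 → ‖x - y‖ ≤ m / 2 →
      |PF T c N x - PF T c N y| ≤ L * (2 / m) * ‖x - y‖ := by
    intro x y hx hxy
    have hxw := fun w => (hne x hx w).1
    have hyw : ∀ w, m / 2 ≤ N y w := fun w => by
      have := (hN x y w).trans hxy
      rw [abs_le] at this
      linarith [hxw w]
    have e1 : PF T c N x = Ph T c (fun w => Real.log (N x w)) := by
      unfold PF; rw [if_pos fun w => (lt_of_lt_of_le hmp (hxw w)).ne']
    have e2 : PF T c N y = Ph T c (fun w => Real.log (N y w)) := by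
      unfold PF; rw [if_pos fun w => (lt_of_lt_of_le (half_pos hmp) (hyw w)).ne']
    rw [e1, e2]
    refine (hL _ _).trans ?_
    rw [mul_assoc]
    gcongr
    rw [pi_norm_le_iff_of_nonneg (by positivity)]
    intro w
    rw [Real.norm_eq_abs]
    refine (log_lip (half_pos hmp) (by linarith [hxw w]) (hyw w)).trans ?_
    rw [div_le_iff₀ (by positivity)]
    refine (hN x y w).trans_eq ?_
    field_simp
  refine ⟨(1 + L) * (2 / m), Real.exp B + 1, by positivity, by positivity, fun x y => ?_, fun x hx => ?_⟩
  · rcases le_or_gt ‖x - y‖ (m / 2) with hxy | hxy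
    · have : L * (2 / m) * ‖x - y‖ ≤ (1 + L) * (2 / m) * ‖x - y‖ := by gcongr; linarith
      by_cases hx : PF T c N x = 0
      · by_cases hy : PF T c N y = 0
        · rw [hx, hy]; simp; positivity
        · rw [abs_sub_comm, norm_sub_rev]; rw [norm_sub_rev] at hxy this
          exact (key y x hy hxy).trans this
      · exact (key x y hx hxy).trans this
    · have : |PF T c N x - PF T c N y| ≤ 1 := by
        rw [abs_le]; constructor <;> linarith [h0 x, h0 y, h1 x, h1 y]
      have h2 : 1 ≤ 2 / m * ‖x - y‖ := by
        rw [div_mul_eq_mul_div, le_div_iff₀ hmp]; linarith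
      nlinarith
  · by_contra h
    have := hE x _ (Real.exp_pos B).le fun w => (hne x h w).2
    linarith
end
end DZ


namespace DZ
open NumberField NumberField.InfinitePlace NumberField.mixedEmbedding NumberField.Units
  NumberField.mixedEmbedding.fundamentalCone NumberField.Units.dirichletUnitTheorem Module

section
open scoped Classical
variable (K : Type*) [Field K] [NumberField K]

noncomputable def TK : (InfinitePlace K → ℝ) ≃ₗ[ℝ] (InfinitePlace K → ℝ) :=
  (LinearEquiv.piCongrRight fun w : InfinitePlace K =>
    LinearEquiv.smulOfNeZero ℝ ℝ (mult w : ℝ) mult_coe_ne_zero) ≪≫ₗ (completeBasis K).equivFun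

noncomputable def cK (w : InfinitePlace K) : ℝ := if w = w₀ then (finrank ℚ K : ℝ) else 1

variable {K}
noncomputable def nP (x : mixedSpace K) (w : InfinitePlace K) : ℝ := normAtPlace w x

noncomputable def XK (x : mixedSpace K) : InfinitePlace K → ℝ := TK K (fun w => Real.log (nP x w))

lemma XK_eq (x : mixedSpace K) : XK x = (completeBasis K).equivFun (expMap.symm (normAtAllPlaces x)) := by
  unfold XK TK
  rw [LinearEquiv.trans_apply]
  congr 1

lemma XK_mul {x y : mixedSpace K} (hx : ∀ w, nP x w ≠ 0) (hy : ∀ w, nP y w ≠ 0) : XK (x * y) = XK x + XK y := by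
  unfold XK
  rw [← map_add]
  congr 1
  ext w
  rw [Pi.add_apply, ← Real.log_mul (hx w) (hy w)]
  simp [nP]

lemma TK_const (s : ℝ) : TK K (fun _ => s) = Pi.single w₀ s := by
  unfold TK
  rw [LinearEquiv.trans_apply]
  have : (LinearEquiv.piCongrRight fun w : InfinitePlace K =>
    LinearEquiv.smulOfNeZero ℝ ℝ (mult w : ℝ) mult_coe_ne_zero) (fun _ => s) = s • completeBasis K w₀ := by
    rw [completeBasis_apply_of_eq]
    ext w; simp [mul_comm]
  rw [this, map_smul]
  ext w
  rw [Pi.smul_apply, Basis.equivFun_self]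
  by_cases h : w = w₀
  · subst h; simp
  · simp [h, Ne.symm h]

lemma XK_smul {x : mixedSpace K} (hx : ∀ w, nP x w ≠ 0) {s : ℝ} (hs : 0 < s) :
    XK (s • x) = XK x + Pi.single w₀ (Real.log s) := by
  rw [← TK_const, XK, XK, ← map_add]
  congr 1
  ext w
  have := hx w
  simp only [nP, normAtPlace_smul, Pi.add_apply] at this ⊢
  rw [Real.log_mul (by positivity) this, abs_of_pos hs, add_comm]

lemma nP_emb_ne {a : K} (ha : a ≠ 0) (w : InfinitePlace K) : nP (mixedEmbedding K a) w ≠ 0 := by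
  unfold nP; rw [normAtPlace_apply]; exact (_root_.map_ne_zero _).2 ha

lemma XK_fund (i : Fin (rank K)) :
    XK (mixedEmbedding K (fundSystem K i : K)) = Pi.single (equivFinRank i).1 1 := by
  rw [XK_eq]
  have := completeBasis_apply_of_ne K (equivFinRank i)
  rw [Equiv.symm_apply_apply] at this
  rw [← this]
  ext w
  rw [Basis.equivFun_self]
  simp [Pi.single_apply, Finsupp.single_apply, eq_comm]

lemma XK_tors {z : (𝓞 K)ˣ} (hz : z ∈ torsion K) : XK (mixedEmbedding K (z : K)) = 0 := by
  unfold XK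
  have : (fun w => Real.log (nP (mixedEmbedding K (z : K)) w)) = 0 := by
    ext w
    rw [nP, normAtPlace_apply, (mem_torsion K).1 hz w]; simp
  rw [this, map_zero]

lemma XK_w0 {a : K} (ha : a ≠ 0) :
    (finrank ℚ K : ℝ) * XK (mixedEmbedding K a) w₀ = Real.log (|Algebra.norm ℚ a| : ℚ) := by
  rw [← sum_expMap_symm_apply ha, XK_eq]
  generalize expMap.symm (normAtAllPlaces (mixedEmbedding K a)) = l
  conv_rhs => rw [← (completeBasis K).sum_equivFun l]
  simp only [Finset.sum_apply, Pi.smul_apply, smul_eq_mul]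
  rw [Finset.sum_comm]
  simp only [← Finset.mul_sum]
  rw [Finset.sum_eq_single w₀]
  · have : ∑ i, completeBasis K w₀ i = finrank ℚ K := by
      rw [completeBasis_apply_of_eq, ← Nat.cast_sum, sum_mult_eq]
    rw [this]; ring
  · intro w _ hw
    rw [completeBasis_apply_of_ne K ⟨w, hw⟩, sum_expMap_symm_apply (coe_ne_zero _)]
    simp [Units.norm]
  · simp

lemma XK_prod (f : Fin (rank K) → ℤ) :
    XK (mixedEmbedding K ((∏ i, fundSystem K i ^ f i : (𝓞 K)ˣ) : K)) =
      ∑ i, (f i : ℝ) • Pi.single (equivFinRank i).1 (1:ℝ) := by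
  let φ : (𝓞 K)ˣ →* Multiplicative (InfinitePlace K → ℝ) :=
    { toFun := fun u => Multiplicative.ofAdd (XK (mixedEmbedding K (u : K)))
      map_one' := by
        rw [XK_tors (one_mem _)]; rfl
      map_mul' := fun u v => by
        rw [← ofAdd_add, ← XK_mul (nP_emb_ne (coe_ne_zero _)) (nP_emb_ne (coe_ne_zero _)), ← map_mul]
        simp }
  have h := map_prod φ (fun i => fundSystem K i ^ f i) Finset.univ
  have h2 : XK (mixedEmbedding K ((∏ i, fundSystem K i ^ f i : (𝓞 K)ˣ) : K)) =
    Multiplicative.toAdd (φ (∏ i, fundSystem K i ^ f i)) := rfl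
  rw [h2, h, toAdd_prod]
  refine Finset.sum_congr rfl fun i _ => ?_
  rw [map_zpow, toAdd_zpow]
  change f i • XK (mixedEmbedding K (fundSystem K i : K)) = _
  rw [XK_fund]
  ext w; simp

/-- coordinates of translate by unit -/
lemma XK_unit {a : K} (ha : a ≠ 0) {s : ℝ} (hs : 0 < s) (z : torsion K) (f : Fin (rank K) → ℤ) :
    XK (s • mixedEmbedding K (((z.1 * ∏ i, fundSystem K i ^ f i : (𝓞 K)ˣ) : K) * a)) =
      XK (mixedEmbedding K a) + Pi.single w₀ (Real.log s) +
        ∑ i, (f i : ℝ) • Pi.single (equivFinRank i).1 (1:ℝ) := by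
  rw [XK_smul (nP_emb_ne (mul_ne_zero (coe_ne_zero _) ha)) hs, map_mul,
    XK_mul (nP_emb_ne (coe_ne_zero _)) (nP_emb_ne ha)]
  have : ((z.1 * ∏ i, fundSystem K i ^ f i : (𝓞 K)ˣ) : K) = (z.1 : K) * ((∏ i, fundSystem K i ^ f i : (𝓞 K)ˣ) : K) := by
    simp
  rw [this, map_mul, XK_mul (nP_emb_ne (coe_ne_zero _)) (nP_emb_ne (coe_ne_zero _)), XK_tors z.2, zero_add, XK_prod]
  abel

/-- the test function -/
noncomputable def FK (x : mixedSpace K) : ℝ := PF (TK K) (cK K) nP x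

lemma FK_eq {x : mixedSpace K} (hx : ∀ w, nP x w ≠ 0) : FK x = ∏ w, hat (cK K w * XK x w) := by
  unfold FK PF
  rw [if_pos hx]; rfl

lemma FK_zero : FK (0 : mixedSpace K) = 0 := by
  unfold FK PF
  rw [if_neg]
  intro h
  exact h w₀ (by simp [nP])

lemma FK_eq' {x : mixedSpace K} (hx : ∀ w, nP x w ≠ 0) :
    FK x = hat (finrank ℚ K * XK x w₀) * ∏ i : Fin (rank K), hat (XK x (equivFinRank i).1) := by
  rw [FK_eq hx, ← Finset.mul_prod_erase _ _ (Finset.mem_univ w₀)]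
  congr 1
  · simp [cK]
  · rw [equivFinRank.prod_comp fun w => hat (XK x w.1)]
    rw [← Finset.prod_subtype (Finset.univ.erase w₀) (by simp) (fun w => hat (XK x w))]
    refine Finset.prod_congr rfl fun w hw => ?_
    simp [cK, Finset.ne_of_mem_erase hw]

lemma hat_sum (s : ℝ) : hat (s + (-⌊s⌋ : ℤ)) + hat (s + (-⌊s⌋ - 1 : ℤ)) = 1 := by
  have h1 := Int.fract_nonneg s
  have h2 := Int.fract_lt_one s
  have e1 : s + (-⌊s⌋ : ℤ) = Int.fract s := by push_cast; rw [Int.fract]; ring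
  have e2 : s + (-⌊s⌋ - 1 : ℤ) = Int.fract s - 1 := by push_cast; rw [Int.fract]; ring
  rw [e1, e2, hat, hat, abs_of_nonneg h1, abs_of_nonpos (by linarith), max_eq_right (by linarith),
    max_eq_right (by linarith)]
  ring

lemma hat_supp (s : ℝ) (m : ℤ) (hm : m ∉ ({-⌊s⌋, -⌊s⌋ - 1} : Finset ℤ)) : hat (s + m) = 0 := by
  apply hat_eq_zero
  simp only [Finset.mem_insert, Finset.mem_singleton, not_or] at hm
  have h1 := Int.floor_le s
  have h2 := Int.lt_floor_add_one s
  rw [le_abs]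
  have : m ≥ -⌊s⌋ + 1 ∨ m ≤ -⌊s⌋ - 2 := by omega
  rcases this with h | h
  · left
    have : (m : ℝ) ≥ -⌊s⌋ + 1 := by exact_mod_cast h
    linarith
  · right
    have : (m : ℝ) ≤ -⌊s⌋ - 2 := by exact_mod_cast h
    linarith

lemma hat_pi_sum {r : ℕ} (s : Fin r → ℝ) : HasSum (fun f : Fin r → ℤ => ∏ i, hat (s i + f i)) 1 := by
  have h : ∑ f ∈ Fintype.piFinset (fun i => ({-⌊s i⌋, -⌊s i⌋ - 1} : Finset ℤ)), ∏ i, hat (s i + f i) = 1 := by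
    rw [← Finset.prod_univ_sum (fun i => ({-⌊s i⌋, -⌊s i⌋ - 1} : Finset ℤ)) (fun i (m : ℤ) => hat (s i + m))]
    refine Finset.prod_eq_one fun i _ => ?_
    rw [Finset.sum_pair (by omega)]
    exact hat_sum _
  rw [← h]
  refine hasSum_sum_of_ne_finset_zero fun f hf => ?_
  rw [Fintype.mem_piFinset] at hf
  push Not at hf
  obtain ⟨i, hi⟩ := hf
  exact Finset.prod_eq_zero (Finset.mem_univ i) (hat_supp _ _ hi)

variable (K) in
noncomputable def unitEquiv : (torsion K × (Fin (rank K) → ℤ)) ≃ (𝓞 K)ˣ :=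
  Equiv.ofBijective (fun p => p.1.1 * ∏ i, fundSystem K i ^ p.2 i) (by
    rw [Function.bijective_iff_existsUnique]
    intro u
    obtain ⟨p, hp, h2⟩ := exist_unique_eq_mul_prod K u
    exact ⟨p, hp.symm, fun q hq => h2 q hq.symm⟩)

lemma FK_unit {a : K} (ha : a ≠ 0) {s : ℝ} (hs : 0 < s) (p : torsion K × (Fin (rank K) → ℤ)) :
    FK (s • mixedEmbedding K (((unitEquiv K p : (𝓞 K)ˣ) : K) * a)) =
      hat (Real.log (|Algebra.norm ℚ a| : ℚ) + finrank ℚ K * Real.log s) *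
        ∏ i, hat (XK (mixedEmbedding K a) (equivFinRank i).1 + p.2 i) := by
  have hne : ∀ w, nP (s • mixedEmbedding K (((unitEquiv K p : (𝓞 K)ˣ) : K) * a)) w ≠ 0 := fun w => by
    unfold nP
    rw [normAtPlace_smul]
    exact mul_ne_zero (abs_pos_of_pos hs).ne' (nP_emb_ne (mul_ne_zero (coe_ne_zero _) ha) w)
  rw [FK_eq' hne]
  have h := XK_unit ha hs p.1 p.2
  change XK (s • mixedEmbedding K (((unitEquiv K p : (𝓞 K)ˣ) : K) * a)) = _ at h
  rw [h]
  congr 1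
  · congr 1
    have : ∀ i : Fin (rank K), (Pi.single (equivFinRank i).1 (1:ℝ) : InfinitePlace K → ℝ) w₀ = 0 := fun i =>
      Pi.single_eq_of_ne (equivFinRank i).2.symm _
    simp only [Pi.add_apply, Finset.sum_apply, Pi.smul_apply, this, Pi.single_eq_same]
    rw [← XK_w0 ha]; simp; ring
  · refine Finset.prod_congr rfl fun i _ => ?_
    congr 1
    simp only [Pi.add_apply, Finset.sum_apply, Pi.smul_apply]
    rw [Pi.single_eq_of_ne (equivFinRank i).2, add_zero, Finset.sum_eq_single i]
    · simp
    · intro j _ hj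
      rw [Pi.single_eq_of_ne]
      · simp
      · intro h; exact hj (equivFinRank.injective (Subtype.ext h.symm))
    · simp

lemma hat_pi_sum2 (T : Type*) [Finite T] {r : ℕ} (A : ℝ) (hA : 0 ≤ A) (s : Fin r → ℝ) :
    HasSum (fun p : T × (Fin r → ℤ) => A * ∏ i, hat (s i + p.2 i)) (Nat.card T * A) := by
  have h1 := (hat_pi_sum s).mul_left A
  have : Fintype T := Fintype.ofFinite _
  have h0 : HasSum (fun _ : T => (1:ℝ)) (∑ _ : T, (1:ℝ)) := hasSum_fintype _
  have h2 := h0.mul h1 (h0.summable.mul_of_nonneg h1.summable (fun _ => zero_le_one)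
    (fun f => mul_nonneg hA (Finset.prod_nonneg fun _ _ => hat_nonneg _)))
  simpa using h2

lemma unit_sum {a : K} (ha : a ≠ 0) {s : ℝ} (hs : 0 < s) :
    HasSum (fun u : (𝓞 K)ˣ => FK (s • mixedEmbedding K ((u : K) * a)))
      (torsionOrder K * hat (Real.log (|Algebra.norm ℚ a| : ℚ) + finrank ℚ K * Real.log s)) := by
  have h2 := hat_pi_sum2 (torsion K) (hat (Real.log (|Algebra.norm ℚ a| : ℚ) + finrank ℚ K * Real.log s))
    (hat_nonneg _) (fun i : Fin (rank K) => XK (mixedEmbedding K a) (equivFinRank i).1)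
  refine (unitEquiv K).hasSum_iff.1 ?_
  have h4 : ((fun u : (𝓞 K)ˣ => FK (s • mixedEmbedding K ((u : K) * a))) ∘ unitEquiv K) =
    fun p => (hat (Real.log (|Algebra.norm ℚ a| : ℚ) + finrank ℚ K * Real.log s) *
        ∏ i, hat (XK (mixedEmbedding K a) (equivFinRank i).1 + p.2 i)) :=
    funext fun p => FK_unit ha hs p
  rw [h4]
  exact h2

end
end DZ


namespace DZ
open NumberField NumberField.InfinitePlace NumberField.mixedEmbedding NumberField.Units Module nonZeroDivisors

section
open scoped Classical
variable {K : Type*} [Field K] [NumberField K]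

variable (K) in
lemma FK_lip : ∃ L R, 0 ≤ L ∧ 0 ≤ R ∧ (∀ x y : mixedSpace K, |FK x - FK y| ≤ L * ‖x - y‖) ∧
    ∀ x : mixedSpace K, R ≤ ‖x‖ → FK x = 0 := by
  refine PF_lip (TK K) (cK K) (fun w => ?_) nP (fun x w => normAtPlace_nonneg w x) (fun x y w => ?_) (fun x r hr h => ?_)
  · unfold cK
    split_ifs
    · exact_mod_cast (finrank_pos : 0 < finrank ℚ K)
    · exact le_rfl
  · have hle : ∀ z : mixedSpace K, nP z w ≤ ‖z‖ := fun z => by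
      rw [norm_eq_sup'_normAtPlace]
      exact Finset.le_sup' (fun w => normAtPlace w z) (Finset.mem_univ w)
    have key : ∀ a b : mixedSpace K, nP a w - nP b w ≤ ‖a - b‖ := fun a b => by
      have := normAtPlace_add_le w (a - b) b
      rw [sub_add_cancel] at this
      have h2 := hle (a - b)
      unfold nP at *
      linarith
    rw [abs_le]
    have := key y x
    rw [norm_sub_rev] at this
    exact ⟨by linarith, key x y⟩
  · rw [norm_eq_sup'_normAtPlace]
    exact Finset.sup'_le _ _ fun w _ => h w

/-- nonzero ideals `I` with `I * J` principal -/
def IdJ (J : Ideal (𝓞 K)) : Type _ := {I : Ideal (𝓞 K) // I ≠ ⊥ ∧ (I * J).IsPrincipal}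

noncomputable def gen {J : Ideal (𝓞 K)} (I : IdJ J) : 𝓞 K := Classical.choose I.2.2.1

lemma span_gen {J : Ideal (𝓞 K)} (I : IdJ J) : Ideal.span {gen I} = I.1 * J :=
  (Classical.choose_spec I.2.2.1).symm

lemma gen_ne {J : Ideal (𝓞 K)} (hJ : J ≠ ⊥) (I : IdJ J) : gen I ≠ 0 := fun h => by
  have := span_gen I
  rw [h, Ideal.span_singleton_eq_bot.2 rfl] at this
  exact mul_ne_zero I.2.1 hJ this.symm

lemma log_gen {J : Ideal (𝓞 K)} (hJ : J ≠ ⊥) (I : IdJ J) :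
    Real.log (|Algebra.norm ℚ (gen I : K)| : ℚ) = Real.log (Ideal.absNorm I.1) + Real.log (Ideal.absNorm J) := by
  have h1 : Ideal.absNorm (Ideal.span {gen I}) = Ideal.absNorm I.1 * Ideal.absNorm J := by
    rw [span_gen, map_mul]
  rw [Ideal.absNorm_span_singleton] at h1
  have h2 : |Algebra.norm ℚ (gen I : K)| = (((Algebra.norm ℤ (gen I)).natAbs : ℕ) : ℚ) := by
    rw [← Algebra.coe_norm_int, Nat.cast_natAbs]; simp
  rw [h2, h1]
  push_cast
  rw [Real.log_mul]
  · exact_mod_cast (Ideal.absNorm_eq_zero_iff.not.2 I.2.1)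
  · exact_mod_cast (Ideal.absNorm_eq_zero_iff.not.2 hJ)

variable (K) in
noncomputable def bJ (J : (Ideal (𝓞 K))⁰) := fractionalIdealLatticeBasis K (FractionalIdeal.mk0 K J)

lemma mem_bJ (J : (Ideal (𝓞 K))⁰) (x : mixedSpace K) :
    x ∈ Submodule.span ℤ (Set.range (bJ K J)) ↔ ∃ a : 𝓞 K, a ∈ (J : Ideal (𝓞 K)) ∧ mixedEmbedding K (a : K) = x := by
  unfold bJ
  rw [mem_span_fractionalIdealLatticeBasis]
  simp only [FractionalIdeal.coe_mk0, Set.mem_image, SetLike.mem_coe, FractionalIdeal.mem_coeIdeal]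
  constructor
  · rintro ⟨_, ⟨a, ha, rfl⟩, rfl⟩; exact ⟨a, ha, rfl⟩
  · rintro ⟨a, ha, rfl⟩; exact ⟨_, ⟨a, ha, rfl⟩, rfl⟩

lemma gen_mem {J : Ideal (𝓞 K)} (I : IdJ J) (u : 𝓞 K) : u * gen I ∈ J := by
  have h : gen I ∈ Ideal.span {gen I} := Ideal.mem_span_singleton_self _
  rw [span_gen] at h
  exact Ideal.mul_mem_left _ _ (Ideal.mul_le_right h)

lemma psi_mem {J : (Ideal (𝓞 K))⁰} (I : IdJ (J : Ideal (𝓞 K))) (u : (𝓞 K)ˣ) :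
    mixedEmbedding K ((u : K) * (gen I : K)) ∈ Submodule.span ℤ (Set.range (bJ K J)) := by
  have h := gen_mem I (u : 𝓞 K)
  rw [← map_mul]
  generalize (u : 𝓞 K) * gen I = a at h ⊢
  exact (mem_bJ J _).2 ⟨a, h, rfl⟩

noncomputable def psi (J : (Ideal (𝓞 K))⁰) (p : IdJ (J : Ideal (𝓞 K)) × (𝓞 K)ˣ) :
    Submodule.span ℤ (Set.range (bJ K J)) := ⟨_, psi_mem p.1 p.2⟩

lemma psi_inj (J : (Ideal (𝓞 K))⁰) : Function.Injective (psi J) := by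
  have hJ : (J : Ideal (𝓞 K)) ≠ ⊥ := nonZeroDivisors.ne_zero J.2
  rintro ⟨I, u⟩ ⟨I', u'⟩ h
  have h1 : mixedEmbedding K ((u : K) * (gen I : K)) = mixedEmbedding K ((u' : K) * (gen I' : K)) :=
    congrArg Subtype.val h
  have h2 : (u : 𝓞 K) * gen I = u' * gen I' := by
    have := mixedEmbedding_injective K h1
    exact_mod_cast this
  have h3 : Ideal.span {gen I} = Ideal.span {gen I'} := by
    rw [Ideal.span_singleton_eq_span_singleton]
    refine ⟨u * u'⁻¹, ?_⟩
    rw [Units.val_mul, mul_comm, mul_assoc, mul_comm _ (gen I), ← mul_assoc, h2, mul_right_comm]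
    simp
  rw [span_gen, span_gen] at h3
  have h4 : I = I' := Subtype.ext (mul_right_cancel₀ (b := (J : Ideal (𝓞 K))) hJ h3)
  subst h4
  have := mul_right_cancel₀ (gen_ne hJ I) h2
  rw [Units.ext this]

lemma psi_range (J : (Ideal (𝓞 K))⁰) (g : Submodule.span ℤ (Set.range (bJ K J))) (hg : (g : mixedSpace K) ≠ 0) :
    g ∈ Set.range (psi J) := by
  have hJ : (J : Ideal (𝓞 K)) ≠ ⊥ := nonZeroDivisors.ne_zero J.2
  obtain ⟨a, ha, hag⟩ := (mem_bJ J g).1 g.2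
  have ha0 : a ≠ 0 := by
    rintro rfl
    apply hg; rw [← hag]; simp
  obtain ⟨I, hI⟩ : (J : Ideal (𝓞 K)) ∣ Ideal.span {a} := by
    rw [Ideal.dvd_iff_le, Ideal.span_singleton_le_iff_mem]; exact ha
  rw [mul_comm] at hI
  have hI0 : I ≠ ⊥ := by
    rintro rfl
    rw [Ideal.bot_mul, Ideal.span_singleton_eq_bot] at hI
    exact ha0 hI
  let I' : IdJ (J : Ideal (𝓞 K)) := ⟨I, hI0, ⟨a, hI.symm⟩⟩
  have h1 : Ideal.span {gen I'} = Ideal.span {a} := by rw [span_gen, hI]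
  rw [Ideal.span_singleton_eq_span_singleton] at h1
  obtain ⟨u, hu⟩ := h1
  refine ⟨(I', u), Subtype.ext ?_⟩
  rw [← hag, ← hu]
  simp [psi, mul_comm]

lemma class_sum (J : (Ideal (𝓞 K))⁰) {t : ℝ} (ht : 0 < t) :
    ∑' g : Submodule.span ℤ (Set.range (bJ K J)), FK (t⁻¹ • (g : mixedSpace K)) =
      torsionOrder K * ∑' I : IdJ (J : Ideal (𝓞 K)),
        hat (Real.log (Ideal.absNorm I.1) - (finrank ℚ K * Real.log t - Real.log (Ideal.absNorm (J : Ideal (𝓞 K))))) := by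
  have hJ : (J : Ideal (𝓞 K)) ≠ ⊥ := nonZeroDivisors.ne_zero J.2
  obtain ⟨L, R, -, -, -, hR⟩ := FK_lip K
  have hs : Summable fun g : Submodule.span ℤ (Set.range (bJ K J)) => FK (t⁻¹ • (g : mixedSpace K)) := by
    refine summable_of_hasFiniteSupport ((lattice_fin (bJ K J) (R * t)).subset fun g hg => ?_)
    by_contra h
    apply hg
    apply hR
    have h' : R * t < ‖(g : mixedSpace K)‖ := not_le.1 h
    rw [_root_.norm_smul, norm_inv, Real.norm_of_nonneg ht.le, ← div_eq_inv_mul, le_div_iff₀ ht]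
    exact h'.le
  rw [← (psi_inj J).tsum_eq]
  · have hs2 := hs.comp_injective (psi_inj J)
    have h3 := hs2.tsum_prod
    refine h3.trans ?_
    rw [← tsum_mul_left]
    refine tsum_congr fun I => ?_
    have h4 := (unit_sum (a := (gen I : K)) (by exact_mod_cast gen_ne hJ I) (inv_pos.2 ht)).tsum_eq
    refine h4.trans ?_
    rw [log_gen hJ, Real.log_inv]
    congr 2
    ring
  · intro g hg
    refine psi_range J g fun h => hg ?_
    simp [h, FK_zero]

end
end DZ


namespace DZ
open NumberField NumberField.InfinitePlace NumberField.mixedEmbedding NumberField.Units Module nonZeroDivisors MeasureTheory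

section
open scoped Classical
variable {K : Type*} [Field K] [NumberField K]

noncomputable def BJ (J : Ideal (𝓞 K)) (v : ℝ) : ℝ := ∑' I : IdJ J, hat (Real.log (Ideal.absNorm I.1) - v)

variable (K) in
lemma FK_int_pos : 0 < ∫ x : mixedSpace K, FK x := by
  obtain ⟨L, R, hL, hR0, hlip, hR⟩ := FK_lip K
  have hc : Continuous (FK (K := K)) := by
    have : LipschitzWith ⟨L, hL⟩ (FK (K := K)) := LipschitzWith.of_dist_le_mul fun x y => by
      rw [Real.dist_eq, dist_eq_norm]; exact hlip x y
    exact this.continuous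
  have hs : HasCompactSupport (FK (K := K)) :=
    HasCompactSupport.intro (isCompact_closedBall (0 : mixedSpace K) R) fun x hx =>
      hR x (by simpa using le_of_lt (by simpa using hx))
  refine hc.integral_pos_of_hasCompactSupport_nonneg_nonzero hs (fun x => ?_) (x := 1) ?_
  · change 0 ≤ FK x
    unfold FK PF; split_ifs
    · exact Ph_nonneg _ _ _
    · exact le_rfl
  · have h1 : ∀ w : InfinitePlace K, nP 1 w = 1 := fun w => by simp [nP]
    rw [FK_eq fun w => by simp [h1]]
    have h2 : XK (1 : mixedSpace K) = 0 := by
      unfold XK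
      simp only [h1, Real.log_one]
      exact map_zero _
    simp [h2, hat_zero]

lemma fd_pos {E : Type*} [NormedAddCommGroup E] [NormedSpace ℝ E] [FiniteDimensional ℝ E] [MeasurableSpace E] [BorelSpace E]
    (μ : Measure E) [μ.IsAddHaarMeasure] {ι : Type*} [Fintype ι] (b : Basis ι ℝ E) :
    0 < μ.real (ZSpan.fundamentalDomain b) :=
  ENNReal.toReal_pos (ZSpan.measure_fundamentalDomain_ne_zero b)
    (ZSpan.fundamentalDomain_isBounded b).measure_lt_top.ne

lemma BJ_asym (J : (Ideal (𝓞 K))⁰) : ∃ κ C, 0 < κ ∧ ∀ v, -1 ≤ v →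
    |BJ (J : Ideal (𝓞 K)) v - κ * Real.exp v| ≤ C * Real.exp (v - v / (finrank ℚ K : ℝ)) := by
  obtain ⟨L, R, hL, hR0, hlip, hR⟩ := FK_lip K
  set n : ℝ := (finrank ℚ K : ℝ) with hn
  have hn0 : 0 < n := by rw [hn]; exact_mod_cast (finrank_pos : 0 < finrank ℚ K)
  set a : ℝ := (Ideal.absNorm (J : Ideal (𝓞 K)) : ℝ) with ha
  have ha0 : 0 < a := by
    rw [ha]; exact_mod_cast Nat.pos_of_ne_zero (Ideal.absNorm_eq_zero_iff.not.2 (nonZeroDivisors.ne_zero J.2))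
  obtain ⟨C, hC⟩ := lattice_sum (volume : Measure (mixedSpace K)) (bJ K J) hL hlip hR0 hR
    (Real.exp_pos ((-1 + Real.log a) / n))
  set w : ℝ := (torsionOrder K : ℝ) with hw
  have hw0 : 0 < w := by rw [hw]; exact_mod_cast torsionOrder_pos K
  set q := (∫ x : mixedSpace K, FK x) / volume.real (ZSpan.fundamentalDomain (bJ K J)) with hq
  have hq0 : 0 < q := div_pos (FK_int_pos K) (fd_pos _ _)
  clear_value q a w n
  refine ⟨a * q / w, C * a * Real.exp (-Real.log a / n) / w, div_pos (mul_pos ha0 hq0) hw0, fun v hv => ?_⟩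
  have h1 := hC (Real.exp ((v + Real.log a) / n)) (by gcongr)
  have e1 : Real.exp ((v + Real.log a) / n) ^ finrank ℝ (mixedSpace K) = Real.exp v * a := by
    rw [← Real.exp_nat_mul, mixedEmbedding.finrank, ← hn, mul_div_cancel₀ _ hn0.ne', Real.exp_add, Real.exp_log ha0]
  rw [class_sum J (Real.exp_pos _), Real.log_exp, ← hn, mul_div_cancel₀ _ hn0.ne', ← ha, add_sub_cancel_right, e1, ← hw] at h1
  change |w * BJ (J : Ideal (𝓞 K)) v - _| ≤ _ at h1
  have e2 : BJ (J : Ideal (𝓞 K)) v - a * q / w * Real.exp v = (w * BJ (J : Ideal (𝓞 K)) v - Real.exp v * a * q) / w := by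
    field_simp
  rw [e2, abs_div, abs_of_pos hw0, div_le_iff₀ hw0]
  refine h1.trans_eq ?_
  have e3 : Real.exp (v - v / n) = Real.exp v / Real.exp (v / n) := Real.exp_sub _ _
  have e4 : Real.exp ((v + Real.log a) / n) = Real.exp (v / n) / Real.exp (-Real.log a / n) := by
    rw [← Real.exp_sub]; congr 1; ring
  rw [e3, e4]
  field_simp

noncomputable def Sid (K : Type*) [Field K] [NumberField K] (M : ℕ) : Finset (Ideal (𝓞 K)) :=
  (Finset.Icc 1 M).biUnion (idN K)

lemma mem_Sid {M : ℕ} {I : Ideal (𝓞 K)} : I ∈ Sid K M ↔ I ≠ ⊥ ∧ Ideal.absNorm I ≤ M := by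
  simp only [Sid, Finset.mem_biUnion, Finset.mem_Icc, mem_idN]
  constructor
  · rintro ⟨m, ⟨h1, h2⟩, h3⟩
    refine ⟨?_, by omega⟩
    rw [Ne, ← Ideal.absNorm_eq_zero_iff]; omega
  · rintro ⟨h1, h2⟩
    rw [Ne, ← Ideal.absNorm_eq_zero_iff] at h1
    exact ⟨_, ⟨by omega, h2⟩, rfl⟩

lemma sum_Sid (M : ℕ) (h : ℕ → ℝ) : ∑ m ∈ Finset.Icc 1 M, rK K m * h m = ∑ I ∈ Sid K M, h (Ideal.absNorm I) := by
  rw [Sid, Finset.sum_biUnion]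
  · refine Finset.sum_congr rfl fun m hm => ?_
    rw [Finset.mem_Icc] at hm
    rw [rK_apply (by omega), Finset.sum_congr rfl (g := fun _ => h m)]
    · simp
    · intro I hI
      rw [mem_idN.1 hI]
  · intro a _ b _ hab
    rw [Function.onFun, Finset.disjoint_left]
    intro I h1 h2
    exact hab ((mem_idN.1 h1).symm.trans (mem_idN.1 h2))

lemma BJ_eq (J : Ideal (𝓞 K)) {v : ℝ} {M : ℕ} (hM : Real.exp (v + 1) ≤ M) :
    BJ J v = ∑ I ∈ Sid K M, if (I * J).IsPrincipal then hat (Real.log (Ideal.absNorm I) - v) else 0 := by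
  unfold BJ IdJ
  refine (tsum_subtype {I : Ideal (𝓞 K) | I ≠ ⊥ ∧ (I * J).IsPrincipal} (fun I => hat (Real.log (Ideal.absNorm I) - v))).trans ?_
  rw [tsum_eq_sum (s := Sid K M)]
  · refine Finset.sum_congr rfl fun I hI => ?_
    rw [mem_Sid] at hI
    by_cases h : (I * J).IsPrincipal
    · rw [Set.indicator_of_mem (by exact ⟨hI.1, h⟩), if_pos h]
    · rw [Set.indicator_of_notMem (fun h' => h h'.2), if_neg h]
  · intro I hI
    rw [mem_Sid] at hI
    by_cases h : I ≠ ⊥ ∧ (I * J).IsPrincipal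
    · rw [Set.indicator_of_mem (by exact h)]
      apply hat_eq_zero
      have h2 : M < Ideal.absNorm I := by
        by_contra h3; exact hI ⟨h.1, not_lt.1 h3⟩
      have h3 : Real.exp (v + 1) ≤ Ideal.absNorm I := hM.trans (by exact_mod_cast h2.le)
      have h4 : v + 1 ≤ Real.log (Ideal.absNorm I) := (Real.le_log_iff_exp_le (lt_of_lt_of_le (Real.exp_pos _) h3)).2 h3
      rw [le_abs]; left; linarith
    · exact Set.indicator_of_notMem (s := {I : Ideal (𝓞 K) | I ≠ ⊥ ∧ (I * J).IsPrincipal}) h _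

variable (K) in
noncomputable def jc (c : ClassGroup (𝓞 K)) : (Ideal (𝓞 K))⁰ := Classical.choose (ClassGroup.mk0_surjective c)

lemma mk0_jc (c : ClassGroup (𝓞 K)) : ClassGroup.mk0 (jc K c) = c := Classical.choose_spec (ClassGroup.mk0_surjective c)

lemma principal_iff {I : Ideal (𝓞 K)} (hI : I ≠ ⊥) (c : ClassGroup (𝓞 K)) :
    (I * (jc K c : Ideal (𝓞 K))).IsPrincipal ↔ c = (ClassGroup.mk0 ⟨I, mem_nonZeroDivisors_of_ne_zero hI⟩)⁻¹ := by
  have h := ClassGroup.mk0_eq_one_iff (I := I * (jc K c : Ideal (𝓞 K)))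
    (mul_mem (mem_nonZeroDivisors_of_ne_zero hI) (jc K c).2)
  rw [← h]
  have : (⟨I * (jc K c : Ideal (𝓞 K)), mul_mem (mem_nonZeroDivisors_of_ne_zero hI) (jc K c).2⟩ : (Ideal (𝓞 K))⁰) =
    ⟨I, mem_nonZeroDivisors_of_ne_zero hI⟩ * jc K c := rfl
  rw [this, map_mul, mk0_jc, mul_comm, mul_eq_one_iff_eq_inv]

lemma B_eq {v : ℝ} {M : ℕ} (hM : Real.exp (v + 1) ≤ M) :
    ∑ m ∈ Finset.Icc 1 M, rK K m * hat (Real.log m - v) = ∑ c : ClassGroup (𝓞 K), BJ (jc K c : Ideal (𝓞 K)) v := by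
  rw [sum_Sid M (fun m => hat (Real.log m - v)), Finset.sum_congr rfl fun c _ => BJ_eq _ hM, Finset.sum_comm]
  refine Finset.sum_congr rfl fun I hI => ?_
  rw [mem_Sid] at hI
  simp only [principal_iff hI.1]
  simp

variable (K) in
lemma B_asym : ∃ κ C, 0 < κ ∧ ∀ v, -1 ≤ v → ∀ M : ℕ, Real.exp (v + 1) ≤ M →
    |∑ m ∈ Finset.Icc 1 M, rK K m * hat (Real.log m - v) - κ * Real.exp v| ≤ C * Real.exp (v - v / (finrank ℚ K : ℝ)) := by
  choose κ C hκ h using fun c => BJ_asym (jc K c)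
  refine ⟨∑ c, κ c, ∑ c, C c, Finset.sum_pos (fun c _ => hκ c) Finset.univ_nonempty, fun v hv M hM => ?_⟩
  rw [B_eq hM, Finset.sum_mul, ← Finset.sum_sub_distrib, Finset.sum_mul]
  exact (Finset.abs_sum_le_sum_abs _ _).trans (Finset.sum_le_sum fun c _ => h c v hv)

noncomputable def Gam (v : ℝ) : ℝ := max 0 (min v 1)

lemma Gam_hat (w : ℝ) : hat w = Gam (w + 1) - Gam w := by
  unfold hat Gam
  rcases le_total 0 w with h | h
  · rw [abs_of_nonneg h]
    rcases le_total w 1 with h1 | h1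
    · rw [min_eq_left h1, min_eq_right (by linarith), max_eq_right h, max_eq_right (by linarith), max_eq_right (by linarith)]
    · rw [min_eq_right h1, min_eq_right (by linarith), max_eq_left (by linarith)]; simp
  · rw [abs_of_nonpos h]
    rcases le_total (w + 1) 0 with h1 | h1
    · rw [min_eq_left (by linarith), min_eq_left (by linarith), max_eq_left (by linarith), max_eq_left h1, max_eq_left h]; simp
    · rw [min_eq_left (by linarith), min_eq_left (by linarith), max_eq_right (by linarith), max_eq_right h1, max_eq_left h]; ring

lemma hat_neg (w : ℝ) : hat (-w) = hat w := by simp [hat]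

lemma Gam_zero {v : ℝ} (h : v ≤ 0) : Gam v = 0 := max_eq_left (min_le_of_left_le h)

lemma Gam_sum (w : ℝ) (N : ℕ) (h : w ≤ N) : ∑ j ∈ Finset.range N, hat (w - 1 - j) = Gam w := by
  have : ∀ N : ℕ, ∑ j ∈ Finset.range N, hat (w - 1 - j) = Gam w - Gam (w - N) := by
    intro N
    induction N with
    | zero => simp
    | succ N ih =>
      rw [Finset.sum_range_succ, ih, Gam_hat]
      push_cast
      rw [show w - 1 - N + 1 = w - N by ring, show w - (N + 1 : ℝ) = w - 1 - N by ring]; ring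
  rw [this, Gam_zero (v := w - N) (by linarith), sub_zero]

variable (K) in
theorem TT_K : ∃ κ C δ, 0 < κ ∧ 0 < δ ∧ ∀ u : ℝ, 0 ≤ u →
    |TT (rK K) (fun v => Gam v * Real.exp (-v)) u - κ| ≤ C * Real.exp (-δ * u) := by
  obtain ⟨κ, C, hκ, hB⟩ := B_asym K
  have hC : 0 ≤ C := by
    have := (abs_nonneg _).trans (hB 0 (by norm_num) ⌈Real.exp (0+1)⌉₊ (Nat.le_ceil _))
    simpa using this
  set n : ℝ := (finrank ℚ K : ℝ) with hn
  have hn1 : 1 ≤ n := by rw [hn]; exact_mod_cast (finrank_pos : 0 < finrank ℚ K)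
  set δ := 1 / (2 * n) with hδ
  have hδ0 : 0 < δ := by positivity
  have hδ1 : δ ≤ 1 / 2 := by rw [hδ, div_le_div_iff₀ (by positivity) (by norm_num)]; linarith
  have hnδ : ∀ v, v / n = 2 * δ * v := fun v => by rw [hδ]; field_simp
  set x := Real.exp (-1) with hx
  have hx0 : 0 < x := Real.exp_pos _
  have hx1 : x < 1 := by rw [hx]; exact Real.exp_lt_one_iff.2 (by norm_num)
  set y := Real.exp (-(1 - δ)) with hy
  have hy0 : 0 < y := Real.exp_pos _
  have hy1 : y < 1 := by rw [hy]; exact Real.exp_lt_one_iff.2 (by linarith)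
  have h1x : 0 < 1 - x := by linarith
  have h1y : 0 < 1 - y := by linarith
  refine ⟨κ * x / (1 - x), κ * x / (1 - x) + C * Real.exp δ / (1 - y), δ, by positivity, hδ0, fun u hu => ?_⟩
  set N := ⌊u⌋₊ + 1 with hN
  have hNu : u ≤ N := by rw [hN]; exact_mod_cast (Nat.lt_floor_add_one u).le
  have hNu' : (N : ℝ) ≤ u + 1 := by rw [hN]; push_cast; linarith [Nat.floor_le hu]
  set M := ⌈Real.exp u⌉₊ with hM
  have hTT : TT (rK K) (fun v => Gam v * Real.exp (-v)) u =
      Real.exp (-u) * ∑ j ∈ Finset.range N, ∑ m ∈ Finset.Icc 1 M, rK K m * hat (Real.log m - (u - 1 - j)) := by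
    unfold TT
    rw [Finset.sum_comm, Finset.mul_sum]
    refine Finset.sum_congr rfl fun m hm => ?_
    rw [Finset.mem_Icc] at hm
    have hm0 : (0:ℝ) < m := by exact_mod_cast hm.1
    have hl : 0 ≤ Real.log m := Real.log_natCast_nonneg m
    beta_reduce
    rw [← Finset.mul_sum, ← Gam_sum (u - Real.log m) N (by linarith)]
    have e : Real.exp (-(u - Real.log m)) = Real.exp (-u) * m := by
      rw [neg_sub, sub_eq_add_neg, Real.exp_add, Real.exp_log hm0, mul_comm]
    rw [e]
    have e2 : ∀ j : ℕ, hat (u - Real.log m - 1 - j) = hat (Real.log m - (u - 1 - j)) := fun j => by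
      rw [← hat_neg]; congr 1; ring
    simp only [e2]
    field_simp
  have hterm : ∀ j ∈ Finset.range N, |(∑ m ∈ Finset.Icc 1 M, rK K m * hat (Real.log m - (u - 1 - j))) -
      κ * Real.exp u * x * x ^ j| ≤ C * Real.exp δ * Real.exp ((1 - δ) * u) * y ^ j := by
    intro j hj
    have hj' : (j : ℝ) ≤ u := by
      rw [Finset.mem_range] at hj
      have : j ≤ ⌊u⌋₊ := by omega
      exact (Nat.le_floor_iff hu).1 this
    have h := hB (u - 1 - j) (by linarith) M ((Real.exp_le_exp.2 (by linarith [(Nat.cast_nonneg j : (0:ℝ) ≤ j)])).trans (Nat.le_ceil _))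
    have e1 : κ * Real.exp (u - 1 - j) = κ * Real.exp u * x * x ^ j := by
      rw [hx, ← Real.exp_nat_mul, mul_assoc, mul_assoc, ← Real.exp_add, ← Real.exp_add]
      congr 2; ring
    rw [e1] at h
    refine h.trans ?_
    rw [mul_assoc, mul_assoc, hy, ← Real.exp_nat_mul, ← Real.exp_add, ← Real.exp_add]
    refine mul_le_mul_of_nonneg_left (Real.exp_le_exp.2 ?_) hC
    rw [hnδ]
    nlinarith
  have hx' : ∑ j ∈ Finset.range N, x ^ j = (1 - x ^ N) / (1 - x) := by
    rw [geom_sum_eq hx1.ne, ← neg_div_neg_eq]; ring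
  have hy' : ∑ j ∈ Finset.range N, y ^ j ≤ 1 / (1 - y) := by
    rw [geom_sum_eq hy1.ne, ← neg_div_neg_eq, neg_sub, neg_sub]
    gcongr
    linarith [pow_pos hy0 N]
  have hxN : x ^ N ≤ Real.exp (-δ * u) := by
    rw [hx, ← Real.exp_nat_mul, Real.exp_le_exp]
    nlinarith
  have hsum : |∑ j ∈ Finset.range N, (∑ m ∈ Finset.Icc 1 M, rK K m * hat (Real.log m - (u - 1 - j))) -
      κ * Real.exp u * x * ((1 - x ^ N) / (1 - x))| ≤ C * Real.exp δ * Real.exp ((1 - δ) * u) * (1 / (1 - y)) := by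
    rw [← hx', Finset.mul_sum, ← Finset.sum_sub_distrib]
    refine (Finset.abs_sum_le_sum_abs _ _).trans ((Finset.sum_le_sum hterm).trans ?_)
    rw [← Finset.mul_sum]
    gcongr
  rw [hTT]
  set S0 := ∑ j ∈ Finset.range N, (∑ m ∈ Finset.Icc 1 M, rK K m * hat (Real.log m - (u - 1 - j)))
  have hee : Real.exp (-u) * Real.exp u = 1 := by rw [← Real.exp_add]; simp
  have e5 : Real.exp (-u) * S0 - κ * x / (1 - x) = Real.exp (-u) * (S0 - κ * Real.exp u * x * ((1 - x ^ N) / (1 - x))) -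
      κ * x / (1 - x) * x ^ N := by
    have : Real.exp (-u) * (κ * Real.exp u * x * ((1 - x ^ N) / (1 - x))) = κ * x * ((1 - x ^ N) / (1 - x)) := by
      linear_combination (κ * x * ((1 - x ^ N) / (1 - x))) * hee
    rw [mul_sub, this]
    field_simp
    ring
  rw [e5]
  refine (abs_sub _ _).trans ?_
  rw [abs_mul, abs_of_pos (Real.exp_pos _), abs_mul, abs_of_pos (pow_pos hx0 N), abs_of_pos (by positivity : 0 < κ * x / (1 - x))]
  have h7 : Real.exp (-u) * |S0 - κ * Real.exp u * x * ((1 - x ^ N) / (1 - x))| ≤ C * Real.exp δ / (1 - y) * Real.exp (-δ * u) := by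
    refine (mul_le_mul_of_nonneg_left hsum (Real.exp_pos _).le).trans_eq ?_
    have : Real.exp (-δ * u) = Real.exp (-u) * Real.exp ((1 - δ) * u) := by rw [← Real.exp_add]; congr 1; ring
    rw [this]; ring
  have h8 : κ * x / (1 - x) * x ^ N ≤ κ * x / (1 - x) * Real.exp (-δ * u) := by gcongr
  linarith

variable (K) in
/-- uniform upper bound for degree one primes -/
theorem prime_bound : ∀ᶠ N : ℕ in atTop,
    ∑ p ∈ (Finset.Icc 1 N).filter Nat.Prime, rK K p ≤ 13 * (N / Real.log N) := by
  obtain ⟨M, hM⟩ := selbergData_K K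
  obtain ⟨κ, C, δ, hκ, hδ, h⟩ := TT_K K
  refine selberg_primes hM (Γ := Gam) (by unfold Gam; fun_prop) (fun v hv => Gam_zero hv) (fun v => le_max_left _ _)
    (fun v => max_le zero_le_one (min_le_right _ _)) (fun v hv => ?_) hκ hδ h
  rw [Gam, min_eq_right hv]; simp

end
end DZ


namespace DZ
open NumberField Module Pointwise

section
variable {K : Type*} [Field K] [NumberField K]

lemma frob_pow {Q : Ideal (𝓞 K)} {p : ℕ} {φ : K ≃ₐ[ℚ] K} (hφ : ∀ x : 𝓞 K, φ • x - x ^ p ∈ Q) (i : ℕ) (x : 𝓞 K) :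
    φ ^ i • x - x ^ (p ^ i) ∈ Q := by
  induction i generalizing x with
  | zero => simp
  | succ i ih =>
    have h1 := hφ (φ ^ i • x)
    have h2 : (φ ^ i • x) ^ p - (x ^ p ^ i) ^ p ∈ Q :=
      Ideal.mem_of_dvd _ (sub_dvd_pow_sub_pow _ _ _) (ih x)
    have h3 := Q.add_mem h1 h2
    rw [pow_succ' φ, mul_smul, pow_succ p, pow_mul]
    convert h3 using 1; ring

lemma stab_le {Q : Ideal (𝓞 K)} [hQ : Q.IsMaximal] {p : ℕ} [hp : Fact p.Prime] (hpQ : (p : 𝓞 K) ∈ Q) (hQ0 : Q ≠ ⊥)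
    {φ : K ≃ₐ[ℚ] K} (hφ : ∀ x : 𝓞 K, φ • x - x ^ p ∈ Q)
    (htriv : ∀ τ : K ≃ₐ[ℚ] K, (∀ x : 𝓞 K, τ • x - x ∈ Q) → τ = 1) (hφQ : φ • Q = Q)
    {σ : K ≃ₐ[ℚ] K} (hσ : σ • Q = Q) : σ ∈ Subgroup.zpowers φ := by
  let := Ideal.Quotient.field Q
  have : Finite (𝓞 K ⧸ Q) := Ideal.finiteQuotientOfFreeOfNeBot Q hQ0
  have : CharP (𝓞 K ⧸ Q) p := by
    refine (CharP.charP_iff_prime_eq_zero hp.out).2 ?_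
    rw [← map_natCast (Ideal.Quotient.mk Q)]
    exact Ideal.Quotient.eq_zero_iff_mem.2 hpQ
  let := ZMod.algebra (𝓞 K ⧸ Q) p
  let s : (𝓞 K ⧸ Q) →+* (𝓞 K ⧸ Q) := Ideal.quotientMap Q (MulSemiringAction.toRingHom (K ≃ₐ[ℚ] K) (𝓞 K) σ) (by
    intro x hx
    rw [Ideal.mem_comap]
    change σ • x ∈ Q
    have := Ideal.smul_mem_pointwise_smul σ x Q hx
    rwa [hσ] at this)
  have hs : ∀ r : ZMod p, s (algebraMap _ _ r) = algebraMap _ _ r := fun r => by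
    rw [← RingHom.comp_apply]
    congr 1
    exact Subsingleton.elim _ _
  let s' : (𝓞 K ⧸ Q) →ₐ[ZMod p] (𝓞 K ⧸ Q) := { s with commutes' := hs }
  obtain ⟨i, hi⟩ := (FiniteField.bijective_frobeniusAlgHom_pow (ZMod p) (𝓞 K ⧸ Q)).2 s'
  have key : ∀ x : 𝓞 K, σ • x - x ^ (p ^ i.1) ∈ Q := by
    intro x
    have h1 : s' (Ideal.Quotient.mk Q x) = Ideal.Quotient.mk Q (σ • x) := rfl
    rw [← hi] at h1
    have h2 : ∀ (n : ℕ) (y : 𝓞 K ⧸ Q), (FiniteField.frobeniusAlgHom (ZMod p) (𝓞 K ⧸ Q) ^ n) y = y ^ p ^ n := by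
      intro n
      induction n with
      | zero => intro y; simp
      | succ n ih => intro y; rw [pow_succ, AlgHom.mul_apply, ih]; simp [pow_succ', pow_mul]
    beta_reduce at h1
    rw [h2, ← map_pow, eq_comm, Ideal.Quotient.eq] at h1
    exact h1
  have h4 : (φ ^ i.1)⁻¹ * σ = 1 := by
    apply htriv
    intro x
    have h5 : φ ^ i.1 • Q = Q := by
      have : φ ∈ MulAction.stabilizer (K ≃ₐ[ℚ] K) Q := hφQ
      exact pow_mem this i.1
    have h6 : σ • x - φ ^ i.1 • x ∈ φ ^ i.1 • Q := by
      rw [h5]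
      have := Q.sub_mem (key x) (frob_pow hφ i.1 x)
      convert this using 1; ring
    rw [Ideal.mem_pointwise_smul_iff_inv_smul_mem] at h6
    rw [mul_smul]
    convert h6 using 1
    rw [smul_sub, inv_smul_smul]
  rw [inv_mul_eq_one] at h4
  rw [← h4]
  exact ⟨i.1, by simp⟩

variable [IsGalois ℚ K]

lemma exists_frob {Q : Ideal (𝓞 K)} [hQ : Q.IsMaximal] {p : ℕ} [hp : Fact p.Prime] (hpQ : (p : 𝓞 K) ∈ Q) (hQ0 : Q ≠ ⊥) :
    ∃ φ : K ≃ₐ[ℚ] K, (∀ x : 𝓞 K, φ • x - x ^ p ∈ Q) ∧ φ • Q = Q := by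
  have : Finite (𝓞 K ⧸ Q) := Ideal.finiteQuotientOfFreeOfNeBot Q hQ0
  have : Q.IsPrime := hQ.isPrime
  obtain ⟨φ, hφ⟩ := IsArithFrobAt.exists_of_isInvariant ℤ (K ≃ₐ[ℚ] K) Q
  refine ⟨φ, fun x => ?_, hφ.mem_stabilizer⟩
  have h1 := hφ x
  have h2 : Q.under ℤ = Ideal.span {(p : ℤ)} := by
    symm
    refine Ideal.IsMaximal.eq_of_le ?_ ?_ ?_
    · exact PrincipalIdealRing.isMaximal_of_irreducible (Nat.prime_iff_prime_int.1 hp.out).irreducible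
    · exact Ideal.IsPrime.ne_top'
    · rw [Ideal.span_singleton_le_iff_mem, Ideal.under, Ideal.mem_comap]
      simpa using hpQ
  rw [h2] at h1
  have h3 : Nat.card (ℤ ⧸ Ideal.span {(p : ℤ)}) = p := by
    rw [Nat.card_congr (Int.quotientSpanNatEquivZMod p).toEquiv, Nat.card_zmod]
  rw [h3] at h1
  exact h1
end
end DZ


namespace DZ
open NumberField Module Pointwise

section
variable {K : Type*} [Field K] [NumberField K]

abbrev LF (g : K ≃ₐ[ℚ] K) : IntermediateField ℚ K := IntermediateField.fixedField (Subgroup.zpowers g)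

lemma norm_under {L : IntermediateField ℚ K} {P : Ideal (𝓞 K)} [hP : P.IsPrime] {p : ℕ} [hp : Fact p.Prime]
    (hpP : (p : 𝓞 K) ∈ P) (h : ∀ x : 𝓞 L, (algebraMap (𝓞 L) (𝓞 K) x) ^ p - algebraMap (𝓞 L) (𝓞 K) x ∈ P) :
    Ideal.absNorm (P.under (𝓞 L)) = p := by
  set q := P.under (𝓞 L) with hq
  have hpq : (p : 𝓞 L) ∈ q := by rw [hq, Ideal.under, Ideal.mem_comap]; simpa using hpP
  have hq0 : q ≠ ⊥ := by
    intro h0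
    rw [h0, Ideal.mem_bot] at hpq
    exact hp.out.ne_zero (by exact_mod_cast hpq)
  have hqm : q.IsMaximal := Ideal.IsPrime.isMaximal inferInstance hq0
  let := Ideal.Quotient.field q
  have : Finite (𝓞 L ⧸ q) := Ideal.finiteQuotientOfFreeOfNeBot q hq0
  let := Fintype.ofFinite (𝓞 L ⧸ q)
  have : CharP (𝓞 L ⧸ q) p := by
    refine (CharP.charP_iff_prime_eq_zero hp.out).2 ?_
    rw [← map_natCast (Ideal.Quotient.mk q)]
    exact Ideal.Quotient.eq_zero_iff_mem.2 hpq
  have hfix : ∀ y : 𝓞 L ⧸ q, y ^ p = y := by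
    intro y
    obtain ⟨x, rfl⟩ := Ideal.Quotient.mk_surjective y
    rw [← map_pow, Ideal.Quotient.eq, hq, Ideal.under, Ideal.mem_comap]
    simpa using h x
  rw [Ideal.absNorm_apply, Submodule.cardQuot_apply, Nat.card_eq_fintype_card]
  apply le_antisymm
  · have hne : (X ^ p - X : (𝓞 L ⧸ q)[X]) ≠ 0 := FiniteField.X_pow_card_sub_X_ne_zero _ hp.out.one_lt
    have := Polynomial.card_le_degree_of_subset_roots (p := (X ^ p - X : (𝓞 L ⧸ q)[X])) (Z := Finset.univ) (by
      intro y _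
      rw [Polynomial.mem_roots hne]
      simp [hfix y])
    rwa [FiniteField.X_pow_card_sub_X_natDegree_eq _ hp.out.one_lt, Finset.card_univ] at this
  · obtain ⟨n, _, hn⟩ := FiniteField.card (𝓞 L ⧸ q) p
    rw [hn]
    exact Nat.le_self_pow n.pos.ne' p

lemma LF_fixed (g : K ≃ₐ[ℚ] K) (x : 𝓞 (LF g)) {τ : K ≃ₐ[ℚ] K} (hτ : τ ∈ Subgroup.zpowers g) :
    τ • algebraMap (𝓞 (LF g)) (𝓞 K) x = algebraMap (𝓞 (LF g)) (𝓞 K) x := by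
  ext
  exact x.1.2 ⟨τ, hτ⟩

lemma under_inj (g : K ≃ₐ[ℚ] K) {P P' : Ideal (𝓞 K)} [P.IsPrime] [P'.IsPrime]
    (h : P.under (𝓞 (LF g)) = P'.under (𝓞 (LF g))) : ∃ τ ∈ Subgroup.zpowers g, P' = τ • P := by
  have : SMulCommClass (Subgroup.zpowers g) (𝓞 (LF g)) (𝓞 K) := ⟨fun τ x y => by
    rw [Algebra.smul_def, Algebra.smul_def, smul_mul']
    congr 1
    exact LF_fixed g x τ.2⟩
  have : Algebra.IsInvariant (𝓞 (LF g)) (𝓞 K) (Subgroup.zpowers g) := ⟨fun b hb => by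
    have hb' : (b : K) ∈ LF g := by
      intro τ
      have := congrArg (fun z : 𝓞 K => (z : K)) (hb τ)
      exact this
    have hi : IsIntegral ℤ (⟨(b : K), hb'⟩ : LF g) := by
      refine (isIntegral_algHom_iff ((LF g).val.restrictScalars ℤ) (LF g).val.injective).1 ?_
      exact b.isIntegral_coe
    refine ⟨⟨⟨(b : K), hb'⟩, hi⟩, ?_⟩
    ext
    rfl⟩
  obtain ⟨τ, hτ⟩ := Algebra.IsInvariant.exists_smul_of_under_eq (𝓞 (LF g)) (𝓞 K) (Subgroup.zpowers g) P P' h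
  exact ⟨τ, τ.2, hτ⟩

end
end DZ


namespace DZ
open NumberField Module Pointwise

section
variable {K : Type*} [Field K] [NumberField K]

lemma conj_mem {G : Type*} [Group G] {D : Subgroup G} {g s τ : G} (hs : s ∈ Subgroup.zpowers g) (hg : τ⁻¹ * g * τ ∈ D) :
    τ⁻¹ * s * τ ∈ D := by
  obtain ⟨n, rfl⟩ := hs
  have : τ⁻¹ * g ^ n * τ = (τ⁻¹ * g * τ) ^ n := by
    have := conj_zpow (i := n) (a := τ⁻¹) (b := g)
    rw [inv_inv] at this
    exact this.symm
  beta_reduce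
  rw [this]
  exact D.zpow_mem hg n

open scoped Classical in
lemma gen_card {G : Type*} [Group G] [Fintype G] (hG : IsPGroup 2 G) (φ : G) :
    Nat.card (Subgroup.zpowers φ) ≤ 2 * (Finset.univ.filter fun g => Subgroup.zpowers g = Subgroup.zpowers φ).card := by
  set S := Finset.univ.filter fun g : G => Subgroup.zpowers g = Subgroup.zpowers φ
  have hodd : ∀ i : ℕ, Odd i → φ ^ i ∈ S := by
    intro i hi
    simp only [S, Finset.mem_filter, Finset.mem_univ, true_and]
    obtain ⟨j, hj⟩ := IsPGroup.iff_orderOf.1 hG φ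
    have hc : i.Coprime (orderOf φ) := by
      rw [hj]
      exact Nat.Coprime.pow_right _ (Nat.coprime_two_right.2 hi)
    obtain ⟨m, hm⟩ := exists_pow_eq_self_of_coprime hc
    apply le_antisymm
    · rw [Subgroup.zpowers_le]; exact Subgroup.npow_mem_zpowers φ i
    · rw [Subgroup.zpowers_le]; exact ⟨m, by simpa using hm⟩
  have hsub : (Finset.univ.filter fun g => g ∈ Subgroup.zpowers φ) ⊆ S ∪ S.image (fun g => g * φ⁻¹) := by
    intro g hg
    simp only [Finset.mem_filter, Finset.mem_univ, true_and] at hg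
    rw [mem_zpowers_iff_mem_range_orderOf, Finset.mem_image] at hg
    obtain ⟨i, _, rfl⟩ := hg
    rw [Finset.mem_union]
    rcases Nat.even_or_odd i with h | h
    · right
      rw [Finset.mem_image]
      exact ⟨φ ^ (i + 1), hodd _ h.add_one, by rw [pow_succ, mul_inv_cancel_right]⟩
    · exact Or.inl (hodd i h)
  have h1 := Finset.card_le_card hsub
  have h2 := h1.trans (Finset.card_union_le _ _)
  have h3 : (S.image (fun g => g * φ⁻¹)).card ≤ S.card := Finset.card_image_le
  have h4 : Nat.card (Subgroup.zpowers φ) = (Finset.univ.filter fun g => g ∈ Subgroup.zpowers φ).card := by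
    rw [Nat.card_eq_fintype_card, Fintype.card_subtype]
  omega

open scoped Classical in
theorem frob_count (hG : IsPGroup 2 (K ≃ₐ[ℚ] K)) {Q : Ideal (𝓞 K)} [hQ : Q.IsMaximal] {p : ℕ} [hp : Fact p.Prime]
    (hpQ : (p : 𝓞 K) ∈ Q) (hQ0 : Q ≠ ⊥)
    {φ : K ≃ₐ[ℚ] K} (hφ : ∀ x : 𝓞 K, φ • x - x ^ p ∈ Q)
    (htriv : ∀ τ : K ≃ₐ[ℚ] K, (∀ x : 𝓞 K, τ • x - x ∈ Q) → τ = 1) (hφQ : φ • Q = Q)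
    (A : Finset (K ≃ₐ[ℚ] K)) (hA : ∀ τ g : K ≃ₐ[ℚ] K, g ∈ Subgroup.zpowers φ → τ * g * τ⁻¹ ∈ A) :
    (Fintype.card (K ≃ₐ[ℚ] K) : ℝ) ≤ 2 * ∑ g ∈ A, rK (LF g) p := by
  set D := Subgroup.zpowers φ with hD
  set Gen := Finset.univ.filter fun g : K ≃ₐ[ℚ] K => Subgroup.zpowers g = D with hGen
  have hGD : ∀ g ∈ Gen, g ∈ D := fun g hg => by
    rw [hGen, Finset.mem_filter] at hg
    rw [← hg.2]; exact Subgroup.mem_zpowers g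
  have hDQ : ∀ d ∈ D, d • Q = Q := by
    intro d hd
    have : φ ∈ MulAction.stabilizer (K ≃ₐ[ℚ] K) Q := hφQ
    have h2 : D ≤ MulAction.stabilizer (K ≃ₐ[ℚ] K) Q := by rw [hD, Subgroup.zpowers_le]; exact this
    exact h2 hd
  let S : (K ≃ₐ[ℚ] K) → Finset (Ideal (𝓞 K)) := fun g =>
    (Finset.univ.filter fun τ : K ≃ₐ[ℚ] K => τ⁻¹ * g * τ ∈ Gen).image (fun τ => τ • Q)
  have hSmem : ∀ g P, P ∈ S g ↔ ∃ τ, τ⁻¹ * g * τ ∈ Gen ∧ τ • Q = P := fun g P => by simp [S]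
  have hprime : ∀ τ : K ≃ₐ[ℚ] K, (τ • Q).IsPrime := fun τ => hQ.isPrime.smul τ
  -- each fibre
  have hS : ∀ g, ((S g).card : ℝ) ≤ rK (LF g) p := by
    intro g
    rw [rK_apply hp.out.ne_zero, Nat.cast_le]
    refine Finset.card_le_card_of_injOn (fun P => P.under (𝓞 (LF g))) ?_ ?_
    · intro P hP
      obtain ⟨τ, hτ, rfl⟩ := (hSmem g P).1 hP
      have := hprime τ
      refine Finset.mem_coe.2 (mem_idN.2 (norm_under ?_ fun x => ?_))
      · rw [Ideal.mem_pointwise_smul_iff_inv_smul_mem]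
        have : τ⁻¹ • (p : 𝓞 K) = p := map_natCast (MulSemiringAction.toRingHom (K ≃ₐ[ℚ] K) (𝓞 K) τ⁻¹) p
        rwa [this]
      · rw [Ideal.mem_pointwise_smul_iff_inv_smul_mem]
        set y := algebraMap (𝓞 (LF g)) (𝓞 K) x with hy
        have h1 : φ • τ⁻¹ • y = τ⁻¹ • y := by
          rw [hGen, Finset.mem_filter] at hτ
          have h2 : φ ∈ Subgroup.zpowers (τ⁻¹ * g * τ) := by rw [hτ.2]; exact Subgroup.mem_zpowers φ
          have h3 : τ * φ * τ⁻¹ ∈ Subgroup.zpowers g := by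
            have := conj_mem (D := Subgroup.zpowers g) (τ := τ⁻¹) h2 (by
              have : τ⁻¹⁻¹ * (τ⁻¹ * g * τ) * τ⁻¹ = g := by group
              rw [this]; exact Subgroup.mem_zpowers g)
            rwa [inv_inv] at this
          have h4 := LF_fixed g x h3
          rw [← hy] at h4
          rw [← mul_smul]
          conv_rhs => rw [← h4, ← mul_smul]
          congr 1
          group
        have h5 := hφ (τ⁻¹ • y)
        rw [h1] at h5
        rw [smul_sub, smul_pow', ← neg_sub]
        exact Q.neg_mem h5
    · intro P hP P' hP' h
      obtain ⟨τ, hτ, rfl⟩ := (hSmem g P).1 hP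
      obtain ⟨τ', hτ', rfl⟩ := (hSmem g P').1 hP'
      have := hprime τ
      have := hprime τ'
      obtain ⟨s, hs, hs2⟩ := under_inj g h
      beta_reduce
      rw [hs2]
      have h1 := conj_mem hs (hGD _ hτ)
      have h2 : s • τ • Q = τ • (τ⁻¹ * s * τ) • Q := by
        rw [← mul_smul, ← mul_smul]; congr 1; group
      rw [h2, hDQ _ h1]
  -- counting
  have hmain : (Finset.univ ×ˢ Gen : Finset ((K ≃ₐ[ℚ] K) × (K ≃ₐ[ℚ] K))).card ≤ Nat.card D * (A.sigma S).card := by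
    refine Finset.card_le_mul_card_image_of_maps_to (f := fun x => (⟨x.1 * x.2 * x.1⁻¹, x.1 • Q⟩ : (_ : K ≃ₐ[ℚ] K) × Ideal (𝓞 K))) ?_ _ ?_
    · rintro ⟨τ, g⟩ hx
      rw [Finset.mem_product] at hx
      rw [Finset.mem_sigma]
      refine ⟨hA _ _ (hGD _ hx.2), (hSmem _ _).2 ⟨τ, ?_, rfl⟩⟩
      have : τ⁻¹ * (τ * g * τ⁻¹) * τ = g := by group
      dsimp only
      rw [this]; exact hx.2
    · intro b _
      rcases Finset.eq_empty_or_nonempty ({a ∈ (Finset.univ ×ˢ Gen : Finset ((K ≃ₐ[ℚ] K) × (K ≃ₐ[ℚ] K))) |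
        (⟨a.1 * a.2 * a.1⁻¹, a.1 • Q⟩ : (_ : K ≃ₐ[ℚ] K) × Ideal (𝓞 K)) = b}) with he | ⟨⟨τ₁, g₁⟩, hb⟩
      · rw [he]; simp
      · rw [Finset.mem_filter] at hb
        have h4 : Nat.card D = (Finset.univ.filter fun g => g ∈ D).card := by
          rw [Nat.card_eq_fintype_card, Fintype.card_subtype]
        rw [h4]
        refine Finset.card_le_card_of_injOn (fun x => τ₁⁻¹ * x.1) ?_ ?_
        · rintro ⟨τ, g⟩ hx
          rw [Finset.mem_coe, Finset.mem_filter] at hx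
          have h5 := hx.2.trans hb.2.symm
          rw [Sigma.mk.inj_iff, heq_eq_eq] at h5
          simp only [Finset.coe_filter, Finset.mem_univ, true_and, Set.mem_setOf_eq]
          refine stab_le hpQ hQ0 hφ htriv hφQ ?_
          rw [mul_smul, h5.2, inv_smul_smul]
        · rintro ⟨τ, g⟩ hx ⟨τ', g'⟩ hx' h
          rw [Finset.mem_coe, Finset.mem_filter] at hx hx'
          have h5 := hx.2.trans hx'.2.symm
          rw [Sigma.mk.inj_iff, heq_eq_eq] at h5
          have h6 : τ = τ' := mul_left_cancel h
          subst h6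
          have h7 := h5.1
          simp at h7
          rw [h7]
  have hgc := gen_card hG φ
  rw [Finset.card_product, Finset.card_sigma, Finset.card_univ] at hmain
  have hD0 : 0 < Nat.card D := Nat.card_pos
  have hgc' : Nat.card D ≤ 2 * Gen.card := by convert hgc
  have hfin : Fintype.card (K ≃ₐ[ℚ] K) ≤ 2 * ∑ g ∈ A, (S g).card := by
    by_contra hcon
    push Not at hcon
    nlinarith
  have hfin' : (Fintype.card (K ≃ₐ[ℚ] K) : ℝ) ≤ 2 * ∑ g ∈ A, ((S g).card : ℝ) := by exact_mod_cast hfin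
  exact hfin'.trans (by gcongr with g _; exact hS g)

end
end DZ


namespace DZ
open NumberField Module Pointwise

section
variable {K : Type*} [Field K] [NumberField K]

lemma bad_bound (E : Finset (𝓞 K)) (hE : ∀ x ∈ E, x ≠ 0) : ∃ B : ℕ, B ≠ 0 ∧ ∀ p : ℕ, p.Prime → ¬ p ∣ B →
    ∀ Q : Ideal (𝓞 K), Q ≠ ⊤ → (p : 𝓞 K) ∈ Q → ∀ x ∈ E, x ∉ Q := by
  refine ⟨Ideal.absNorm (Ideal.span {∏ x ∈ E, x}), ?_, fun p hp hpB Q hQ hpQ x hx hxQ => ?_⟩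
  · rw [Ne, Ideal.absNorm_eq_zero_iff, Ideal.span_singleton_eq_bot, Finset.prod_eq_zero_iff]
    rintro ⟨x, hx, h0⟩
    exact hE x hx h0
  · set B := Ideal.absNorm (Ideal.span {∏ x ∈ E, x})
    have h1 : Ideal.span {∏ x ∈ E, x} ≤ Q := by
      rw [Ideal.span_singleton_le_iff_mem]
      exact Ideal.mem_of_dvd _ (Finset.dvd_prod_of_mem _ hx) hxQ
    have h2 : (B : 𝓞 K) ∈ Q := h1 (Ideal.absNorm_mem _)
    have h3 : IsCoprime (p : ℤ) (B : ℤ) := Nat.isCoprime_iff_coprime.2 ((Nat.Prime.coprime_iff_not_dvd hp).2 hpB)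
    obtain ⟨a, b, hab⟩ := h3
    apply hQ
    rw [Ideal.eq_top_iff_one]
    have h4 : (1 : 𝓞 K) = a * p + b * B := by exact_mod_cast hab.symm
    rw [h4]
    exact Q.add_mem (Q.mul_mem_left _ hpQ) (Q.mul_mem_left _ h2)

lemma lift_ms (s : Multiset K) (h : ∀ x ∈ s, IsIntegral ℤ x) : ∃ t : Multiset (𝓞 K), t.map (fun x : 𝓞 K => (x : K)) = s := by
  induction s using Multiset.induction_on with
  | empty => exact ⟨0, rfl⟩
  | cons a s ih =>
    obtain ⟨t, ht⟩ := ih fun x hx => h x (Multiset.mem_cons_of_mem hx)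
    obtain ⟨b, hb⟩ : ∃ b : 𝓞 K, (b : K) = a := ⟨⟨a, h a (Multiset.mem_cons_self a s)⟩, rfl⟩
    exact ⟨b ::ₘ t, by rw [Multiset.map_cons, ht, hb]⟩

open scoped Classical in
theorem frob_main [IsGalois ℚ K] (hG : IsPGroup 2 (K ≃ₐ[ℚ] K)) (g : ℤ[X]) (hg : g.Monic)
    (hs : (g.map (algebraMap ℤ K)).Splits) (A : Finset (K ≃ₐ[ℚ] K))
    (hA : ∀ σ : K ≃ₐ[ℚ] K, ∀ β : K, aeval β g = 0 → σ β = β → σ ∈ A) :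
    ∃ B : ℕ, B ≠ 0 ∧ ∀ p : ℕ, p.Prime → ¬ p ∣ B → (∃ a : ℤ, (p : ℤ) ∣ g.eval a) →
      (Fintype.card (K ≃ₐ[ℚ] K) : ℝ) ≤ 2 * ∑ σ ∈ A, rK (LF σ) p := by
  have hgK : (g.map (algebraMap ℤ K)).Monic := hg.map _
  have hintg : ∀ β ∈ (g.map (algebraMap ℤ K)).roots, IsIntegral ℤ β := fun β hβ => by
    refine ⟨g, hg, ?_⟩
    rw [mem_roots hgK.ne_zero, IsRoot, eval_map] at hβ
    exact hβ
  obtain ⟨t, htK⟩ := lift_ms _ hintg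
  have htr : ∀ x ∈ t, aeval (x : K) g = 0 := by
    intro x hx
    have : (x : K) ∈ (g.map (algebraMap ℤ K)).roots := by rw [← htK]; exact Multiset.mem_map_of_mem (fun x : 𝓞 K => (x : K)) hx
    rw [mem_roots hgK.ne_zero, IsRoot, eval_map] at this
    exact this
  have htr' : ∀ x : 𝓞 K, aeval (x : K) g = 0 → x ∈ t := by
    intro x hx
    have : (x : K) ∈ (g.map (algebraMap ℤ K)).roots := by
      rw [mem_roots hgK.ne_zero, IsRoot, eval_map]; exact hx
    rw [← htK, Multiset.mem_map] at this
    obtain ⟨y, hy, hyx⟩ := this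
    rwa [← RingOfIntegers.ext hyx]
  have heval : ∀ a : ℤ, ((g.eval a : ℤ) : 𝓞 K) = (t.map fun x => (a : 𝓞 K) - x).prod := by
    intro a
    have h1 := hs.eval_eq_prod_roots_of_monic hgK (a : K)
    rw [← htK, Multiset.map_map] at h1
    have h2 : (g.map (algebraMap ℤ K)).eval (a : K) = ((g.eval a : ℤ) : K) := by
      have := eval_map_apply (p := g) (f := algebraMap ℤ K) a
      simpa using this
    rw [h2] at h1
    apply RingOfIntegers.ext
    have h3 : ((t.map fun x => (a : 𝓞 K) - x).prod : 𝓞 K) = (algebraMap (𝓞 K) K) (t.map fun x => (a : 𝓞 K) - x).prod := rfl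
    rw [h3, map_multiset_prod, Multiset.map_map]
    simpa using h1
  have hf : ∀ τ : K ≃ₐ[ℚ] K, τ ≠ 1 → ∃ x : 𝓞 K, τ • x - x ≠ 0 := by
    intro τ hτ
    by_contra! h
    apply hτ
    ext y
    obtain ⟨a, b, hb, rfl⟩ := IsFractionRing.div_surjective (A := 𝓞 K) y
    have h1 : ∀ x : 𝓞 K, τ (algebraMap (𝓞 K) K x) = algebraMap (𝓞 K) K x := fun x =>
      congrArg (algebraMap (𝓞 K) K) (sub_eq_zero.1 (h x))
    rw [map_div₀, h1, h1]; rfl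
  choose! xx hxx using hf
  set E : Finset (𝓞 K) := ((t.toFinset ×ˢ t.toFinset).image (fun y => y.1 - y.2) ∪
    Finset.univ.image (fun τ => τ • xx τ - xx τ)).filter (· ≠ 0) with hE
  obtain ⟨B, hB0, hB⟩ := bad_bound E (fun x hx => (Finset.mem_filter.1 hx).2)
  refine ⟨B, hB0, fun p hp hpB ⟨a, ha⟩ => ?_⟩
  have hpf : Fact p.Prime := ⟨hp⟩
  have hnt : Ideal.span {(p : 𝓞 K)} ≠ ⊤ := by
    intro h
    have h2 := congrArg Ideal.absNorm h
    rw [Ideal.absNorm_top, Ideal.absNorm_span_natCast] at h2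
    have h3 : 0 < Module.finrank ℤ (𝓞 K) := finrank_pos
    exact hp.one_lt.ne' (Nat.pow_eq_one.1 h2 |>.resolve_right h3.ne')
  obtain ⟨Q, hQm, hQ⟩ := Ideal.exists_le_maximal _ hnt
  rw [Ideal.span_singleton_le_iff_mem] at hQ
  have hQ0 : Q ≠ ⊥ := by
    rintro rfl
    rw [Ideal.mem_bot] at hQ
    exact hp.ne_zero (by exact_mod_cast hQ)
  have hEQ := hB p hp hpB Q hQm.ne_top hQ
  obtain ⟨φ, hφ, hφQ⟩ := exists_frob hQ hQ0
  have htriv : ∀ τ : K ≃ₐ[ℚ] K, (∀ x : 𝓞 K, τ • x - x ∈ Q) → τ = 1 := by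
    intro τ h
    by_contra hτ
    refine hEQ (τ • xx τ - xx τ) ?_ (h _)
    rw [hE, Finset.mem_filter, Finset.mem_union]
    exact ⟨Or.inr (Finset.mem_image_of_mem (fun τ => τ • xx τ - xx τ) (Finset.mem_univ τ)), hxx τ hτ⟩
  have hpr : (t.map fun x => (a : 𝓞 K) - x).prod ∈ Q := by
    rw [← heval]
    obtain ⟨c, hc⟩ := ha
    rw [hc]; push_cast
    exact Q.mul_mem_right _ hQ
  have hQp := hQm.isPrime
  rw [hQp.multiset_prod_mem_iff_exists_mem] at hpr
  obtain ⟨y, hy, hyQ⟩ := hpr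
  obtain ⟨β, hβ, rfl⟩ := Multiset.mem_map.1 hy
  have hfix : φ • β = β := by
    by_contra hne
    have h1 : φ • β - β ∈ Q := by
      have e1 := hφ β
      have e2 : (a : 𝓞 K) ^ p - β ^ p ∈ Q := Ideal.mem_of_dvd _ (sub_dvd_pow_sub_pow _ _ _) hyQ
      have e3 : (a : 𝓞 K) ^ p - a ∈ Q := by
        have : (p : ℤ) ∣ a ^ p - a := by
          rw [← ZMod.intCast_zmod_eq_zero_iff_dvd]
          push_cast
          rw [ZMod.pow_card, sub_self]
        obtain ⟨c, hc⟩ := this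
        have h2 : (a : 𝓞 K) ^ p - a = p * c := by exact_mod_cast hc
        rw [h2]; exact Q.mul_mem_right _ hQ
      have := Q.add_mem (Q.sub_mem e1 e2) (Q.add_mem e3 hyQ)
      convert this using 1; ring
    refine hEQ _ ?_ h1
    rw [hE, Finset.mem_filter, Finset.mem_union]
    refine ⟨Or.inl (Finset.mem_image.2 ⟨(φ • β, β), ?_, rfl⟩), sub_ne_zero.2 hne⟩
    rw [Finset.mem_product, Multiset.mem_toFinset, Multiset.mem_toFinset]
    refine ⟨htr' _ ?_, hβ⟩
    have h3 : ((φ • β : 𝓞 K) : K) = (φ.restrictScalars ℤ) (β : K) := rfl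
    rw [h3, aeval_algHom_apply (φ.restrictScalars ℤ), htr β hβ, map_zero]
  have hfK : φ (β : K) = β := congrArg (fun z : 𝓞 K => (z : K)) hfix
  refine frob_count hG hQ hQ0 hφ htriv hφQ A fun τ s hs => ?_
  refine hA _ (τ (β : K)) ?_ ?_
  · have := aeval_algHom_apply (τ.restrictScalars ℤ) (β : K) g
    rw [htr β hβ, map_zero] at this
    exact this
  · have h4 : s (β : K) = β := by
      have : Subgroup.zpowers φ ≤ MulAction.stabilizer (K ≃ₐ[ℚ] K) (β : K) := by
        rw [Subgroup.zpowers_le]; exact hfK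
      exact this hs
    have : (τ * s * τ⁻¹) (τ (β : K)) = τ (s (τ⁻¹ (τ (β : K)))) := rfl
    rw [this]
    have h5 : τ⁻¹ (τ (β : K)) = β := τ.symm_apply_apply _
    rw [h5, h4]

end
end DZ


namespace DZ

lemma pc_primes (N : ℕ) : primeCount {p | p.Prime} N = N.primeCounting := by
  unfold primeCount
  rw [Nat.primeCounting, Nat.primeCounting', Nat.count_eq_card_filter_range]
  congr

lemma pi_lower : ∀ᶠ N : ℕ in atTop, (N / Real.log N : ℝ) / 2 ≤ N.primeCounting := by
  have h1 : Tendsto (fun N : ℕ => Real.log ((N : ℝ) + 1) / ((N : ℝ) + 1)) atTop (nhds 0) := by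
    have h := Real.isLittleO_log_id_atTop.tendsto_div_nhds_zero
    have h2 : Tendsto (fun N : ℕ => ((N : ℝ) + 1)) atTop atTop :=
      tendsto_atTop_add_const_right _ _ tendsto_natCast_atTop_atTop
    exact h.comp h2
  filter_upwards [h1.eventually (gt_mem_nhds (show (0:ℝ) < 0.05 by norm_num)), eventually_ge_atTop 2] with N hN hN2
  refine le_trans ?_ (Chebyshev.pi_ge N)
  have hN' : (2:ℝ) ≤ N := by exact_mod_cast hN2
  have hl : 0 < Real.log N := Real.log_pos (by linarith)
  rw [div_div, mul_comm, ← div_div]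
  apply div_le_div_of_nonneg_right _ hl.le
  rw [div_lt_iff₀ (by positivity)] at hN
  have := Real.log_two_gt_d9
  nlinarith

lemma dens_of (S : Set ℕ) (h : ∀ ε : ℝ, 0 < ε → ∃ C : ℝ, ∀ᶠ N : ℕ in atTop,
    (primeCount S N : ℝ) ≤ C + ε * (N / Real.log N)) : HasPrimeDensityZero S := by
  unfold HasPrimeDensityZero
  simp_rw [pc_primes]
  rw [Metric.tendsto_nhds]
  intro ε hε
  obtain ⟨C, hC⟩ := h (ε / 8) (by positivity)
  have h1 : Tendsto (fun N : ℕ => Real.log (N : ℝ) / (N : ℝ)) atTop (nhds 0) := 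
    Real.isLittleO_log_id_atTop.tendsto_div_nhds_zero.comp tendsto_natCast_atTop_atTop
  have h2 : Tendsto (fun N : ℕ => C * (Real.log (N : ℝ) / (N : ℝ))) atTop (nhds 0) := by
    simpa using h1.const_mul C
  filter_upwards [hC, pi_lower, h2.eventually (gt_mem_nhds (show (0:ℝ) < ε / 8 by positivity)), eventually_ge_atTop 2] with N h3 h4 h5 h6
  have hN' : (2:ℝ) ≤ N := by exact_mod_cast h6
  have hl : 0 < Real.log N := Real.log_pos (by linarith)
  rw [dist_zero_right, Real.norm_of_nonneg (by positivity)]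
  set y : ℝ := (N : ℝ) / Real.log N with hy
  have hy0 : 0 < y := by positivity
  have h7 : C ≤ ε / 8 * y := by
    have : C = C * (Real.log N / N) * y := by rw [hy]; field_simp
    rw [this]
    exact mul_le_mul_of_nonneg_right h5.le hy0.le
  rw [div_lt_iff₀ (by linarith)]
  nlinarith

/-- our polynomial -/
noncomputable def fk (k : ℤ) : ℤ[X] := X ^ 2 - C k * X + C k

/-- the map -/
def F {R : Type*} [CommRing R] (k : ℤ) (x : R) : R := x ^ 2 - k * x + k

lemma fk_monic (k : ℤ) : (fk k).Monic := by
  unfold fk; monicity!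

lemma fk_natDegree (k : ℤ) : (fk k).natDegree = 2 := by
  unfold fk; compute_degree!

lemma pI_natDegree (k : ℤ) (n : ℕ) : (polyIter (fk k) n).natDegree = 2 ^ n := by
  induction n with
  | zero => simp [polyIter]
  | succ n ih => rw [polyIter, natDegree_comp, ih, fk_natDegree]; ring

lemma pI_monic (k : ℤ) (n : ℕ) : (polyIter (fk k) n).Monic := by
  induction n with
  | zero => simpa [polyIter] using monic_X
  | succ n ih =>
    rw [polyIter]
    exact (fk_monic k).comp ih (by rw [pI_natDegree]; positivity)

lemma pI_aeval {R : Type*} [CommRing R] (k : ℤ) (n : ℕ) (x : R) : aeval x (polyIter (fk k) n) = (F k)^[n] x := by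
  induction n with
  | zero => simp [polyIter]
  | succ n ih =>
    rw [polyIter, aeval_comp, ih, Function.iterate_succ_apply']
    simp [fk, F]

lemma eval_it (k : ℤ) : (fun x => Polynomial.eval x (X ^ 2 - C k * X + C k : ℤ[X])) = F k := by
  funext x; simp [F]

lemma dvd_F (k x y m : ℤ) (h : m ∣ x - y) (n : ℕ) : m ∣ (F k)^[n] x - (F k)^[n] y := by
  induction n generalizing x y with
  | zero => simpa using h
  | succ n ih =>
    rw [Function.iterate_succ_apply, Function.iterate_succ_apply]
    apply ih
    have : F k x - F k y = (x - y) * (x + y - k) := by simp only [F, Int.cast_id]; ring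
    rw [this]; exact Dvd.dvd.mul_right h _

/-- existence of a good field at level `M` with few fixed points -/
def GoodAt (k : ℤ) (ε : ℝ) (M : ℕ) : Prop :=
  ∃ (K : Type) (_ : Field K) (_ : NumberField K) (_ : IsGalois ℚ K), IsPGroup 2 (K ≃ₐ[ℚ] K) ∧
    ((polyIter (fk k) M).map (algebraMap ℤ K)).Splits ∧
    ∃ A : Finset (K ≃ₐ[ℚ] K), (∀ σ : K ≃ₐ[ℚ] K, ∀ β : K, (F k)^[M] β = 0 → σ β = β → σ ∈ A) ∧
      (A.card : ℝ) ≤ ε * Nat.card (K ≃ₐ[ℚ] K)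

open scoped Classical in
theorem density_of (k a₀ : ℤ) (h : ∀ ε : ℝ, 0 < ε → ∃ M, GoodAt k ε M) :
    HasPrimeDensityZero (orbitPrimes (X ^ 2 - C k * X + C k) a₀) := by
  apply dens_of
  intro ε hε
  obtain ⟨M, K, _, _, _, hG, hs, A, hA, hc⟩ := h (ε / 26) (by positivity)
  obtain ⟨B, hB0, hB⟩ := frob_main hG _ (pI_monic k M) hs A (by
    intro σ β h1 h2; rw [pI_aeval] at h1; exact hA σ β h1 h2)
  rw [Nat.card_eq_fintype_card] at hc
  set g : ℝ := (Fintype.card (K ≃ₐ[ℚ] K) : ℝ) with hg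
  have hg0 : 0 < g := by rw [hg]; exact_mod_cast Fintype.card_pos
  set it := fun n => (F k)^[n] a₀
  set D : ℕ := B * ∏ n ∈ (Finset.range M).filter (fun n => it n ≠ 0), (it n).natAbs with hD
  have hD0 : D ≠ 0 := by
    rw [hD, Ne, mul_eq_zero, Finset.prod_eq_zero_iff]
    rintro (h | ⟨n, hn, h⟩)
    · exact hB0 h
    · rw [Finset.mem_filter] at hn; exact hn.2 (Int.natAbs_eq_zero.1 h)
  refine ⟨(D.primeFactors.card : ℝ), ?_⟩
  have hall : ∀ᶠ N : ℕ in atTop, ∀ σ ∈ A, ∑ p ∈ (Finset.Icc 1 N).filter Nat.Prime, rK (LF σ) p ≤ 13 * (N / Real.log N) := by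
    rw [Filter.eventually_all_finset]
    intro σ _
    exact prime_bound (LF σ)
  filter_upwards [hall, eventually_ge_atTop 2] with N hN hN2
  have hN' : (2:ℝ) ≤ N := by exact_mod_cast hN2
  have hl : 0 < Real.log N := Real.log_pos (by linarith)
  have hy0 : 0 < (N : ℝ) / Real.log N := by positivity
  set T := ((Finset.Icc 1 N).filter Nat.Prime).filter (fun p => ¬ p ∣ D ∧ ∃ a : ℤ, (p:ℤ) ∣ (polyIter (fk k) M).eval a) with hT
  have hsub : primeCount (orbitPrimes (X ^ 2 - C k * X + C k) a₀) N ≤ D.primeFactors.card + T.card := by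
    unfold primeCount
    refine le_trans (Finset.card_le_card ?_) (Finset.card_union_le _ _)
    intro p hp
    rw [Finset.mem_filter, Finset.mem_range] at hp
    obtain ⟨hpN, hpp, n, hn0, hn⟩ := hp
    rw [eval_it] at hn hn0
    rw [Finset.mem_union]
    by_cases hpD : p ∣ D
    · left; exact Nat.mem_primeFactors.2 ⟨hpp, hpD, hD0⟩
    · right
      rw [hT, Finset.mem_filter, Finset.mem_filter, Finset.mem_Icc]
      refine ⟨⟨⟨hpp.one_le, by omega⟩, hpp⟩, hpD, ?_⟩
      have hnM : M ≤ n := by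
        by_contra hlt
        push Not at hlt
        apply hpD
        rw [hD]
        apply Dvd.dvd.mul_left
        refine dvd_trans (Int.natCast_dvd.1 hn) (Finset.dvd_prod_of_mem (fun n => (it n).natAbs) (a := n) ?_)
        rw [Finset.mem_filter, Finset.mem_range]
        exact ⟨hlt, hn0⟩
      refine ⟨(F k)^[n - M] a₀, ?_⟩
      rw [← coe_aeval_eq_eval, pI_aeval, ← Function.iterate_add_apply]
      rwa [show M + (n - M) = n by omega]
  have hT1 : g * T.card ≤ 2 * (A.card * (13 * (N / Real.log N))) := by
    calc g * T.card = ∑ p ∈ T, g := by rw [Finset.sum_const, nsmul_eq_mul, mul_comm]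
      _ ≤ ∑ p ∈ T, 2 * ∑ σ ∈ A, rK (LF σ) p := by
          apply Finset.sum_le_sum
          intro p hp
          rw [hT, Finset.mem_filter, Finset.mem_filter] at hp
          exact hB p hp.1.2 (fun h => hp.2.1 (Dvd.dvd.mul_right h _)) hp.2.2
      _ = 2 * ∑ σ ∈ A, ∑ p ∈ T, rK (LF σ) p := by
          rw [← Finset.mul_sum, Finset.sum_comm]
      _ ≤ 2 * ∑ σ ∈ A, (13 * (N / Real.log N)) := by
          apply mul_le_mul_of_nonneg_left _ (by norm_num)
          apply Finset.sum_le_sum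
          intro σ hσ
          refine le_trans ?_ (hN σ hσ)
          apply Finset.sum_le_sum_of_subset_of_nonneg (Finset.filter_subset _ _)
          intro p _ _
          simp only [rK, ArithmeticFunction.coe_mk]
          split_ifs <;> positivity
      _ = _ := by rw [Finset.sum_const, nsmul_eq_mul]
  have hT2 : (T.card : ℝ) ≤ ε * (N / Real.log N) := by
    have : g * T.card ≤ g * (ε * (N / Real.log N)) := by
      refine hT1.trans ?_
      nlinarith
    exact le_of_mul_le_mul_left this hg0
  have : (primeCount (orbitPrimes (X ^ 2 - C k * X + C k) a₀) N : ℝ) ≤ D.primeFactors.card + T.card := by exact_mod_cast hsub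
  linarith

end DZ


namespace DZ

section
variable {K : Type*} [Field K]

lemma F_sub (k : ℤ) (x y : K) : F k x - F k y = (x - y) * (x + y - k) := by simp only [F]; ring

lemma F_eq_iff (k : ℤ) (x y : K) : F k x = F k y ↔ x = y ∨ x = k - y := by
  rw [← sub_eq_zero, F_sub, mul_eq_zero, sub_eq_zero]
  constructor
  · rintro (h | h)
    · exact Or.inl h
    · right; linear_combination h
  · rintro (h | h)
    · exact Or.inl h
    · right; linear_combination h

lemma F_refl (k : ℤ) (x : K) : F k (k - x) = F k x := by simp only [F]; ring

lemma F_map {L : Type*} [Field L] (φ : K →+* L) (k : ℤ) (x : K) : φ (F k x) = F k (φ x) := by simp [F]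

lemma Fit_map {L : Type*} [Field L] (φ : K →+* L) (k : ℤ) (n : ℕ) (x : K) : φ ((F k)^[n] x) = (F k)^[n] (φ x) := by
  induction n generalizing x with
  | zero => rfl
  | succ n ih => rw [Function.iterate_succ_apply, Function.iterate_succ_apply, ih, F_map]

lemma pI_add (f : ℤ[X]) (i j : ℕ) : polyIter f (i + j) = (polyIter f i).comp (polyIter f j) := by
  induction i with
  | zero => simp [polyIter]
  | succ i ih => rw [show i + 1 + j = (i + j) + 1 by ring, polyIter, polyIter, ih, comp_assoc]

lemma exists_child {k : ℤ} {M j : ℕ} (hs : ((polyIter (fk k) M).map (algebraMap ℤ K)).Splits) (hj : j < M)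
    (α : K) (hα : (F k)^[j] α = 0) : ∃ β, F k β = α := by
  obtain ⟨i, rfl⟩ : ∃ i, M = j + (i + 1) := ⟨M - j - 1, by omega⟩
  set g := polyIter (fk k) (i + 1) with hg
  have h1 : (X - C α) ∣ (polyIter (fk k) j).map (algebraMap ℤ K) := by
    rw [dvd_iff_isRoot, IsRoot, eval_map_algebraMap, pI_aeval, hα]
  obtain ⟨q, hq⟩ := h1
  have h2 : (g.map (algebraMap ℤ K) - C α) ∣ (polyIter (fk k) (j + (i+1))).map (algebraMap ℤ K) := by
    rw [pI_add, Polynomial.map_comp, hq, mul_comp, ← hg, sub_comp, X_comp, C_comp]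
    exact dvd_mul_right _ _
  have hm := (pI_monic k (j + (i+1))).map (algebraMap ℤ K)
  have h3 := hs.of_dvd hm.ne_zero h2
  have hdeg : (g.map (algebraMap ℤ K) - C α).natDegree = 2 ^ (i+1) := by
    rw [natDegree_sub_C, (pI_monic k (i+1)).natDegree_map, pI_natDegree]
  obtain ⟨γ, hγ⟩ := h3.exists_eval_eq_zero (by
    intro h0
    have := natDegree_eq_of_degree_eq_some h0
    rw [hdeg] at this
    exact absurd this (by positivity))
  refine ⟨(F k)^[i] γ, ?_⟩
  rw [← Function.iterate_succ_apply' (F k), ← pI_aeval]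
  rw [eval_sub, eval_C, eval_map_algebraMap, sub_eq_zero] at hγ
  exact hγ

open scoped Classical in
/-- roots of the `n`-th iterate -/
noncomputable def R (K : Type*) [Field K] (k : ℤ) (n : ℕ) : Finset K :=
  ((polyIter (fk k) n).map (algebraMap ℤ K)).roots.toFinset

lemma mem_R {k : ℤ} {n : ℕ} {x : K} : x ∈ R K k n ↔ (F k)^[n] x = 0 := by
  classical
  rw [R, Multiset.mem_toFinset, mem_roots ((pI_monic k n).map _).ne_zero, IsRoot, eval_map_algebraMap, pI_aeval]

lemma mem_R_succ {k : ℤ} {n : ℕ} {x : K} : x ∈ R K k (n+1) ↔ F k x ∈ R K k n := by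
  rw [mem_R, mem_R, Function.iterate_succ_apply]

lemma R_zero (k : ℤ) : R K k 0 = {0} := by
  ext x; rw [mem_R]; simp

variable [Algebra ℚ K]

lemma σ_mem_R {k : ℤ} {n : ℕ} {x : K} (σ : K ≃ₐ[ℚ] K) (h : x ∈ R K k n) : σ x ∈ R K k n := by
  rw [mem_R] at h ⊢
  have := Fit_map (σ : K →+* K) k n x
  rw [h] at this
  simpa using this.symm

lemma σF (k : ℤ) (σ : K ≃ₐ[ℚ] K) (x : K) : σ (F k x) = F k (σ x) := F_map (σ : K →+* K) k x

lemma σ_or {k : ℤ} (σ : K ≃ₐ[ℚ] K) (x : K) (h : σ (F k x) = F k x) : σ x = x ∨ σ x = k - x := by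
  rw [σF, F_eq_iff] at h; exact h

lemma pow_fix {k : ℤ} (σ : K ≃ₐ[ℚ] K) (n : ℕ) : ∀ x ∈ R K k n, (σ ^ 2 ^ n) x = x := by
  induction n with
  | zero => intro x hx; rw [R_zero, Finset.mem_singleton] at hx; simp [hx]
  | succ n ih =>
    intro x hx
    have h1 := ih _ (mem_R_succ.1 hx)
    rw [pow_succ, pow_mul, sq, AlgEquiv.mul_apply]
    rcases σ_or _ _ h1 with h | h
    · rw [h, h]
    · rw [h, map_sub, h]; simp

lemma two_group {k : ℤ} {M : ℕ} (hgen : IntermediateField.adjoin ℚ (R K k M : Set K) = ⊤) : IsPGroup 2 (K ≃ₐ[ℚ] K) := by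
  intro σ
  refine ⟨M, ?_⟩
  ext x
  have hx : x ∈ IntermediateField.adjoin ℚ (R K k M : Set K) := by rw [hgen]; trivial
  have : ∀ y ∈ IntermediateField.adjoin ℚ (R K k M : Set K), (σ ^ 2 ^ M) y = y := by
    intro y hy
    have hle : IntermediateField.adjoin ℚ (R K k M : Set K) ≤ IntermediateField.fixedField (Subgroup.zpowers (σ ^ 2 ^ M)) := by
      rw [IntermediateField.adjoin_le_iff]
      intro y hy
      have h1 := pow_fix σ M y hy
      rw [SetLike.mem_coe, IntermediateField.mem_fixedField_iff]
      intro f hf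
      have : Subgroup.zpowers (σ ^ 2 ^ M) ≤ MulAction.stabilizer (K ≃ₐ[ℚ] K) y := by
        rw [Subgroup.zpowers_le]; exact h1
      exact this hf
    exact (IntermediateField.mem_fixedField_iff _ _).1 (hle hy) _ (Subgroup.mem_zpowers _)
  exact this x hx
end

/-- the splitting field -/
def KM (k : ℤ) (M : ℕ) : Type := ((polyIter (fk k) M).map (algebraMap ℤ ℚ)).SplittingField

noncomputable instance (k : ℤ) (M : ℕ) : Field (KM k M) :=
  inferInstanceAs (Field ((polyIter (fk k) M).map (algebraMap ℤ ℚ)).SplittingField)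

instance (k : ℤ) (M : ℕ) : CharZero (KM k M) :=
  inferInstanceAs (CharZero ((polyIter (fk k) M).map (algebraMap ℤ ℚ)).SplittingField)

lemma sf_any {L : Type} [Field L] (a a' : Algebra ℚ L) (g : ℚ[X]) (h : @IsSplittingField ℚ L _ _ a g) :
    @IsSplittingField ℚ L _ _ a' g := by
  obtain rfl : a = a' := Subsingleton.elim _ _
  exact h

lemma KM_isSF (k : ℤ) (M : ℕ) : IsSplittingField ℚ (KM k M) ((polyIter (fk k) M).map (algebraMap ℤ ℚ)) := by
  have h := IsSplittingField.splittingField ((polyIter (fk k) M).map (algebraMap ℤ ℚ))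
  exact sf_any _ _ _ h

instance (k : ℤ) (M : ℕ) : NumberField (KM k M) where
  to_finiteDimensional := by
    have := KM_isSF k M
    exact IsSplittingField.finiteDimensional _ ((polyIter (fk k) M).map (algebraMap ℤ ℚ))

instance (k : ℤ) (M : ℕ) : IsGalois ℚ (KM k M) where
  to_isSeparable := by infer_instance
  to_normal := by
    have := KM_isSF k M
    exact Normal.of_isSplittingField ((polyIter (fk k) M).map (algebraMap ℤ ℚ))

lemma KM_splits (k : ℤ) (M : ℕ) : ((polyIter (fk k) M).map (algebraMap ℤ (KM k M))).Splits := by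
  have := (KM_isSF k M).splits
  rw [Polynomial.map_map, ← IsScalarTower.algebraMap_eq] at this
  exact this

lemma KM_adjoin (k : ℤ) (M : ℕ) : IntermediateField.adjoin ℚ (R (KM k M) k M : Set (KM k M)) = ⊤ := by
  have h := (KM_isSF k M).adjoin_rootSet
  rw [← IntermediateField.toSubalgebra_injective.eq_iff, IntermediateField.adjoin_toSubalgebra, IntermediateField.top_toSubalgebra, ← h]
  congr 1
  ext x
  rw [Finset.mem_coe, mem_R, mem_rootSet', aeval_map_algebraMap, pI_aeval]
  constructor
  · intro h
    refine ⟨?_, h⟩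
    exact (((pI_monic k M).map _).map _).ne_zero
  · exact fun h => h.2

end DZ


namespace DZ

/-- critical orbit -/
def bs (k : ℤ) (n : ℕ) : ℚ := (F k)^[n] (k / 2 : ℚ)
/-- discriminant-like quantity -/
def dd (k : ℤ) (j : ℕ) : ℚ := (-1) ^ (2 ^ j) * bs k (j + 1)

lemma bs_ne {k : ℤ} {j : ℕ} (h : ¬ IsSquare (dd k j)) : bs k (j+1) ≠ 0 := by
  intro h0; apply h; rw [dd, h0]; simp

section
variable {K : Type*} [Field K] [NumberField K]

lemma bs_cast (k : ℤ) (n : ℕ) : ((bs k n : ℚ) : K) = (F k)^[n] ((k : K) / 2) := by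
  have := Fit_map (algebraMap ℚ K) k n (k / 2)
  simpa [bs] using this

lemma ne_refl {k : ℤ} {j : ℕ} (hb : bs k (j+1) ≠ 0) {β : K} (h : β ∈ R K k (j+1)) : β ≠ k - β := by
  intro he
  have : β = (k : K) / 2 := by
    rw [eq_div_iff two_ne_zero]; linear_combination he
  rw [mem_R, this, ← bs_cast] at h
  exact hb (by exact_mod_cast h)

open scoped Classical in
lemma fiber_eq {k : ℤ} {β : K} {j : ℕ} (h : β ∈ R K k (j+1)) : (R K k (j+1)).filter (fun x => F k x = F k β) = {β, k - β} := by
  ext x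
  rw [Finset.mem_filter, F_eq_iff, Finset.mem_insert, Finset.mem_singleton]
  constructor
  · exact fun h => h.2
  · intro hx
    refine ⟨?_, hx⟩
    rcases hx with rfl | rfl
    · exact h
    · rw [mem_R_succ] at h ⊢; rwa [F_refl]

variable {k : ℤ} {M : ℕ}

lemma prod_R (hs : ((polyIter (fk k) M).map (algebraMap ℤ K)).Splits)
    (hq : ∀ j < M, ¬ IsSquare (dd k j)) (j : ℕ) (hj : j ≤ M) (x : K) : ∏ α ∈ R K k j, (x - α) = (F k)^[j] x := by
  classical
  induction j generalizing x with
  | zero => rw [R_zero]; simp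
  | succ j ih =>
    rw [← Finset.prod_fiberwise_of_maps_to (g := F k) (t := R K k j) (fun x hx => mem_R_succ.1 hx)]
    rw [Function.iterate_succ_apply, ← ih (by omega)]
    apply Finset.prod_congr rfl
    intro α hα
    obtain ⟨β, rfl⟩ := exists_child hs (by omega) α (mem_R.1 hα)
    have hβ := mem_R_succ.2 hα
    rw [fiber_eq hβ, Finset.prod_pair (ne_refl (bs_ne (hq j (by omega))) hβ)]
    simp only [F]; ring

lemma card_R (hs : ((polyIter (fk k) M).map (algebraMap ℤ K)).Splits)
    (hq : ∀ j < M, ¬ IsSquare (dd k j)) (j : ℕ) (hj : j ≤ M) : (R K k j).card = 2 ^ j := by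
  classical
  induction j with
  | zero => rw [R_zero]; simp
  | succ j ih =>
    rw [Finset.card_eq_sum_card_fiberwise (f := F k) (t := R K k j) (fun x hx => mem_R_succ.1 hx), pow_succ, ← ih (by omega)]
    rw [← smul_eq_mul, ← Finset.sum_const]
    apply Finset.sum_congr rfl
    intro α hα
    obtain ⟨β, rfl⟩ := exists_child hs (by omega) α (mem_R.1 hα)
    have hβ := mem_R_succ.2 hα
    rw [fiber_eq hβ, Finset.card_pair (ne_refl (bs_ne (hq j (by omega))) hβ)]

lemma prod_sq (hs : ((polyIter (fk k) M).map (algebraMap ℤ K)).Splits)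
    (hq : ∀ j < M, ¬ IsSquare (dd k j)) (j : ℕ) (hj : j < M) (β : K → K) (hβ : ∀ α ∈ R K k j, F k (β α) = α) :
    (∏ α ∈ R K k j, (β α - (k:K)/2)) ^ 2 = ((dd k j : ℚ) : K) := by
  rw [← Finset.prod_pow]
  have h1 : ∀ α ∈ R K k j, (β α - (k:K)/2) ^ 2 = (-1) * (F k ((k:K)/2) - α) := by
    intro α hα
    conv_rhs => rw [← hβ α hα]
    simp only [F]; ring
  rw [Finset.prod_congr rfl h1, Finset.prod_mul_distrib, prod_R hs hq j hj.le, Finset.prod_const, card_R hs hq j hj.le, dd]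
  push_cast
  rw [bs_cast, Function.iterate_succ_apply]

variable [IsGalois ℚ K]

lemma trans_R (hs : ((polyIter (fk k) M).map (algebraMap ℤ K)).Splits)
    (hq : ∀ j < M, ¬ IsSquare (dd k j)) (j : ℕ) (hj : j ≤ M) : ∀ x ∈ R K k j, ∀ y ∈ R K k j, ∃ σ : K ≃ₐ[ℚ] K, σ x = y := by
  induction j with
  | zero => intro x hx y hy; rw [R_zero, Finset.mem_singleton] at hx hy; exact ⟨1, by rw [hx, hy]; rfl⟩
  | succ j ih =>
    have ih := ih (by omega)
    have key : ∀ β ∈ R K k (j+1), ∃ σ : K ≃ₐ[ℚ] K, σ β = k - β := by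
      intro β hβ
      by_contra hno
      push Not at hno
      choose! s hs' using ih (F k β) (mem_R_succ.1 hβ)
      have hF : ∀ α ∈ R K k j, F k (s α β) = α := fun α hα => by rw [← σF, hs' α hα]
      have hτ : ∀ τ : K ≃ₐ[ℚ] K, ∀ α ∈ R K k j, τ (s α β) = s (τ α) β := by
        intro τ α hα
        have h1 : F k (τ (s α β)) = F k (s (τ α) β) := by
          rw [hF _ (σ_mem_R τ hα), ← σF, hF _ hα]
        rcases (F_eq_iff _ _ _).1 h1 with h | h
        · exact h
        · exfalso
          apply hno ((s (τ α))⁻¹ * τ * s α)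
          rw [AlgEquiv.mul_apply, AlgEquiv.mul_apply, h, map_sub]
          change _ - (s (τ α)).symm (s (τ α) β) = _
          rw [AlgEquiv.symm_apply_apply]; simp
      set r := ∏ α ∈ R K k j, (s α β - (k:K)/2) with hr
      have hr2 := prod_sq hs hq j (by omega) (fun α => s α β) hF
      have hfix : ∀ τ : K ≃ₐ[ℚ] K, τ r = r := by
        intro τ
        rw [hr, map_prod]
        refine Finset.prod_bij (fun α _ => τ α) (fun α hα => σ_mem_R τ hα) (fun a _ b _ h => τ.injective h) ?_ ?_
        · intro b hb
          exact ⟨τ⁻¹ b, σ_mem_R _ hb, τ.apply_symm_apply b⟩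
        · intro α hα
          rw [map_sub, hτ τ α hα, map_div₀, map_intCast, map_ofNat]
      obtain ⟨q, hq'⟩ := (IsGalois.mem_range_algebraMap_iff_fixed r).2 hfix
      apply hq j (by omega)
      refine ⟨q, ?_⟩
      rw [← hr, ← hq'] at hr2
      have : ((q ^ 2 : ℚ) : K) = ((dd k j : ℚ) : K) := by
        push_cast; exact hr2
      have := Rat.cast_injective this
      rw [← this]; ring
    intro x hx y hy
    obtain ⟨σ, hσ⟩ := ih _ (mem_R_succ.1 hx) _ (mem_R_succ.1 hy)
    rw [σF, F_eq_iff] at hσ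
    rcases hσ with h | h
    · exact ⟨σ, h⟩
    · obtain ⟨τ, hτ⟩ := key y hy
      exact ⟨τ * σ, by rw [AlgEquiv.mul_apply, h, map_sub, hτ]; simp⟩
end
end DZ


namespace DZ

/-- annihilator -/
def ann {X : Type*} [Fintype X] (V : Submodule (ZMod 2) (X → ZMod 2)) : Submodule (ZMod 2) (X → ZMod 2) where
  carrier := {w | ∀ v ∈ V, ∑ x, w x * v x = 0}
  zero_mem' := by intro v _; simp
  add_mem' := by
    intro a b ha hb v hv
    have h1 := ha v hv
    have h2 := hb v hv
    simp only [Pi.add_apply, add_mul, Finset.sum_add_distrib, h1, h2, add_zero]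
  smul_mem' := by
    intro c a ha v hv
    have h1 := ha v hv
    simp only [Pi.smul_apply, smul_eq_mul, mul_assoc, ← Finset.mul_sum, h1, mul_zero]

/-- the action on the annihilator -/
@[reducible] def annAct {G : Type*} [Group G] {X : Type*} [Fintype X] [MulAction G X]
    (V : Submodule (ZMod 2) (X → ZMod 2)) (hV : ∀ g : G, ∀ v ∈ V, (fun x => v (g⁻¹ • x)) ∈ V) : MulAction G (ann V) where
  smul g w := ⟨fun x => w.1 (g⁻¹ • x), by
    intro v hv
    have := w.2 _ (hV g⁻¹ v hv)
    rw [← this]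
    refine Fintype.sum_equiv (MulAction.toPerm g⁻¹) _ _ ?_
    intro x
    simp⟩
  one_smul w := by
    apply Subtype.ext
    funext x
    change w.1 ((1:G)⁻¹ • x) = w.1 x
    simp
  mul_smul g h w := by
    apply Subtype.ext
    funext x
    change w.1 ((g * h)⁻¹ • x) = w.1 (h⁻¹ • g⁻¹ • x)
    rw [mul_inv_rev, mul_smul]

theorem all_of {G : Type*} [Group G] (hG : IsPGroup 2 G) {X : Type*} [Fintype X] [MulAction G X]
    (htr : ∀ x y : X, ∃ g : G, g • x = y) (V : Submodule (ZMod 2) (X → ZMod 2))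
    (hV : ∀ g : G, ∀ v ∈ V, (fun x => v (g⁻¹ • x)) ∈ V) (v0 : X → ZMod 2) (hv0 : v0 ∈ V) (hs : ∑ x, v0 x ≠ 0) : V = ⊤ := by
  classical
  by_contra hne
  obtain ⟨f, hf0, hf⟩ := Submodule.exists_le_ker_of_lt_top V (lt_top_iff_ne_top.2 hne)
  have hfs : ∀ v, f v = ∑ x, f (Pi.single x 1) * v x := by
    intro v
    conv_lhs => rw [← Finset.univ_sum_single v, map_sum]
    apply Finset.sum_congr rfl
    intro x _
    rw [show Pi.single x (v x) = v x • (Pi.single x 1 : X → ZMod 2) by rw [← Pi.single_smul]; simp, map_smul, smul_eq_mul, mul_comm]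
  have hw : (fun x => f (Pi.single x 1)) ∈ ann V := by
    intro v hv
    rw [← hfs]; exact hf hv
  have hw0 : (⟨_, hw⟩ : ann V) ≠ 0 := by
    intro h
    apply hf0
    have h' := congrArg Subtype.val h
    apply LinearMap.ext
    intro v
    rw [hfs]
    apply Finset.sum_eq_zero
    intro x _
    have := congrFun h' x
    simp only [ZeroMemClass.coe_zero, Pi.zero_apply] at this
    rw [this, zero_mul]
  have : Nontrivial (ann V) := ⟨⟨_, _, hw0⟩⟩
  let _ : MulAction G (ann V) := annAct V hV
  have hcard : 2 ∣ Nat.card (ann V) := by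
    rw [Module.natCard_eq_pow_finrank (K := ZMod 2)]
    simp only [Nat.card_zmod]
    exact dvd_pow_self 2 (Module.finrank_pos).ne'
  have hz : (0 : ann V) ∈ MulAction.fixedPoints G (ann V) := by
    intro g; rfl
  obtain ⟨w, hwf, hwne⟩ := hG.exists_fixed_point_of_prime_dvd_card_of_fixed_point (ann V) hcard hz
  have hconst : ∀ x y, w.1 x = w.1 y := by
    intro x y
    obtain ⟨g, rfl⟩ := htr x y
    have h1 := hwf g⁻¹
    have h2 : (g⁻¹ • w).1 x = w.1 (g • x) := by
      change w.1 (g⁻¹⁻¹ • x) = _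
      rw [inv_inv]
    rw [← h2, h1]
  have hex : ∃ x, w.1 x ≠ 0 := by
    by_contra hno
    push Not at hno
    apply hwne
    apply Subtype.ext
    funext x
    exact (hno x).symm
  obtain ⟨x0, hx0⟩ := hex
  have h3 := w.2 v0 hv0
  have h4 : ∑ x, w.1 x * v0 x = w.1 x0 * ∑ x, v0 x := by
    rw [Finset.mul_sum]
    exact Finset.sum_congr rfl (fun x _ => by rw [hconst x x0])
  rw [h4] at h3
  exact (mul_ne_zero hx0 hs) h3

section
variable {K : Type*} [Field K] [NumberField K]

instance actR (k : ℤ) (j : ℕ) : MulAction (K ≃ₐ[ℚ] K) {x // x ∈ R K k j} where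
  smul σ x := ⟨σ x.1, σ_mem_R σ x.2⟩
  one_smul x := rfl
  mul_smul σ τ x := rfl

lemma actR_coe {k : ℤ} {j : ℕ} (σ : K ≃ₐ[ℚ] K) (x : {x // x ∈ R K k j}) : (σ • x).1 = σ x.1 := rfl

lemma σ_refl {k : ℤ} (σ : K ≃ₐ[ℚ] K) (x : K) : σ (k - x) = k - x ↔ σ x = x := by
  rw [map_sub, map_intCast]; simp

open scoped Classical in
/-- swap vector -/
noncomputable def sv {k : ℤ} {j : ℕ} (β : K → K) (σ : K ≃ₐ[ℚ] K) (x : {x // x ∈ R K k j}) : ZMod 2 := if σ (β x.1) = β x.1 then 0 else 1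

/-- fixing a level -/
def Fx (K : Type*) [Field K] [NumberField K] (k : ℤ) (j : ℕ) (σ : K ≃ₐ[ℚ] K) : Prop := ∀ x ∈ R K k j, σ x = x

lemma zmod2_cases (a : ZMod 2) : a = 0 ∨ a = 1 := by revert a; decide

theorem swap_all {k : ℤ} {M : ℕ} (hs : ((polyIter (fk k) M).map (algebraMap ℤ K)).Splits)
    (hq : ∀ j < M, ¬ IsSquare (dd k j)) [IsGalois ℚ K] (hG : IsPGroup 2 (K ≃ₐ[ℚ] K))
    {j : ℕ} (hj : j < M) (β : K → K) (hβ : ∀ α ∈ R K k j, F k (β α) = α)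
    (hgood : ∃ σ, Fx K k j σ ∧ σ (∏ α ∈ R K k j, (β α - (k:K)/2)) = - ∏ α ∈ R K k j, (β α - (k:K)/2)) 
    (S : Set K) : ∃ σ, Fx K k j σ ∧ ∀ α ∈ R K k j, ∀ x, F k x = α → ((α ∈ S → σ x = k - x) ∧ (α ∉ S → σ x = x)) := by
  classical
  have hmem : ∀ α ∈ R K k j, β α ∈ R K k (j+1) := fun α hα => mem_R_succ.2 (by rwa [hβ α hα])
  have hne : ∀ α ∈ R K k j, β α ≠ k - β α := fun α hα => ne_refl (bs_ne (hq j hj)) (hmem α hα)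
  have hor : ∀ σ, Fx K k j σ → ∀ α ∈ R K k j, σ (β α) = β α ∨ σ (β α) = k - β α := by
    intro σ hσ α hα
    apply σ_or
    rw [hβ α hα, hσ α hα]
  have hadd : ∀ σ τ, Fx K k j σ → Fx K k j τ → sv (k := k) (j := j) β (σ * τ) = sv β σ + sv β τ := by
    intro σ τ hσ hτ
    funext x
    simp only [sv, Pi.add_apply, AlgEquiv.mul_apply]
    have hnx := hne _ x.2
    rcases hor σ hσ _ x.2 with h1 | h1 <;> rcases hor τ hτ _ x.2 with h2 | h2
    · simp [h1, h2]
    · simp [h1, h2, hnx.symm]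
    · simp [h1, h2, hnx.symm]
    · have h3 : σ (τ (β x.1)) = β x.1 := by rw [h2, map_sub, map_intCast, h1]; ring
      simp [h3, h1, h2, hnx.symm]
      decide
  let V : Submodule (ZMod 2) ({x // x ∈ R K k j} → ZMod 2) :=
    { carrier := {v | ∃ σ, Fx K k j σ ∧ sv β σ = v}
      zero_mem' := ⟨1, fun x _ => rfl, by funext x; simp [sv]⟩
      add_mem' := by
        rintro a b ⟨σ, hσ, rfl⟩ ⟨τ, hτ, rfl⟩
        exact ⟨σ * τ, fun x hx => by rw [AlgEquiv.mul_apply, hτ x hx, hσ x hx], hadd σ τ hσ hτ⟩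
      smul_mem' := by
        rintro c a ⟨σ, hσ, rfl⟩
        rcases zmod2_cases c with rfl | rfl
        · exact ⟨1, fun x _ => rfl, by funext x; simp [sv]⟩
        · exact ⟨σ, hσ, by rw [one_smul]⟩ }
  obtain ⟨σ0, hσ0, hσr⟩ := hgood
  have hVtop : V = ⊤ := by
    refine all_of hG (fun x y => ?_) V ?_ (sv β σ0) ⟨σ0, hσ0, rfl⟩ ?_
    · obtain ⟨σ, h⟩ := trans_R hs hq j hj.le x.1 x.2 y.1 y.2
      exact ⟨σ, Subtype.ext h⟩
    · rintro g v ⟨σ, hσ, rfl⟩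
      refine ⟨g * σ * g⁻¹, ?_, ?_⟩
      · intro x hx
        rw [AlgEquiv.mul_apply, AlgEquiv.mul_apply, hσ _ (σ_mem_R _ hx)]
        exact g.apply_symm_apply x
      · funext x
        simp only [sv, actR_coe]
        have h1 : F k (g⁻¹ (β x.1)) = F k (β (g⁻¹ x.1)) := by
          rw [← σF, hβ _ x.2, hβ _ (σ_mem_R _ x.2)]
        have h2 : (g * σ * g⁻¹) (β x.1) = β x.1 ↔ σ (g⁻¹ (β x.1)) = g⁻¹ (β x.1) := by
          rw [AlgEquiv.mul_apply, AlgEquiv.mul_apply]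
          constructor
          · intro h
            have := congrArg (fun z => g.symm z) h
            simp only [AlgEquiv.symm_apply_apply] at this
            exact this
          · intro h
            rw [h]; exact g.apply_symm_apply _
        have h3 : σ (g⁻¹ (β x.1)) = g⁻¹ (β x.1) ↔ σ (β (g⁻¹ x.1)) = β (g⁻¹ x.1) := by
          rcases (F_eq_iff _ _ _).1 h1 with h | h
          · rw [h]
          · rw [h, σ_refl]
        simp only [h2, h3]
    · have hr0 : ∏ α ∈ R K k j, (β α - (k:K)/2) ≠ 0 := by
        rw [Finset.prod_ne_zero_iff]
        intro α hα h0
        apply hne α hα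
        linear_combination 2 * h0
      intro hsum
      have h1 : ∀ α ∈ R K k j, σ0 (β α - (k:K)/2) = (if σ0 (β α) = β α then 1 else -1) * (β α - (k:K)/2) := by
        intro α hα
        rw [map_sub, map_div₀, map_intCast, map_ofNat]
        rcases hor σ0 hσ0 α hα with h | h
        · rw [if_pos h, h]; ring
        · rw [if_neg (by rw [h]; exact (hne α hα).symm), h]; ring
      rw [map_prod, Finset.prod_congr rfl h1, Finset.prod_mul_distrib, neg_eq_neg_one_mul (∏ α ∈ R K k j, (β α - (k:K)/2))] at hσr
      have h2 := mul_right_cancel₀ hr0 hσr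
      have h3 : ∏ α ∈ R K k j, (if σ0 (β α) = β α then (1:K) else -1) = (-1) ^ ((R K k j).filter (fun α => ¬ σ0 (β α) = β α)).card := by
        rw [Finset.prod_ite]; simp
      have h4 : ∑ x : {x // x ∈ R K k j}, sv β σ0 x = (((R K k j).filter (fun α => ¬ σ0 (β α) = β α)).card : ZMod 2) := by
        simp only [sv]
        rw [Finset.sum_coe_sort (R K k j) (fun x => if σ0 (β x) = β x then (0 : ZMod 2) else 1), Finset.sum_ite]
        simp
      rw [h4, ZMod.natCast_eq_zero_iff_even] at hsum
      rw [h3, hsum.neg_one_pow] at h2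
      norm_num at h2
  have hS : (fun x : {x // x ∈ R K k j} => if x.1 ∈ S then (1 : ZMod 2) else 0) ∈ V := by rw [hVtop]; trivial
  obtain ⟨σ, hσ, hv⟩ := hS
  refine ⟨σ, hσ, ?_⟩
  rintro α hα x hx
  have h5 := congrFun hv ⟨α, hα⟩
  simp only [sv] at h5
  have h6 : F k x = F k (β α) := by rw [hx, hβ α hα]
  constructor
  · intro hαS
    rw [if_pos hαS] at h5
    have h7 : ¬ σ (β α) = β α := by intro h; rw [if_pos h] at h5; exact absurd h5 (by decide)
    rcases hor σ hσ α hα with h | h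
    · exact absurd h h7
    · rcases (F_eq_iff _ _ _).1 h6 with h8 | h8
      · rw [h8, h]
      · rw [h8, map_sub, map_intCast, h]
  · intro hαS
    rw [if_neg hαS] at h5
    have h7 : σ (β α) = β α := by by_contra h; rw [if_neg h] at h5; exact absurd h5 (by decide)
    rcases (F_eq_iff _ _ _).1 h6 with h8 | h8
    · rw [h8, h7]
    · rw [h8, σ_refl]; exact h7
end
end DZ


namespace DZ

section
variable {K : Type*} [Field K] [NumberField K]

/-- good levels -/
def GoodLev (K : Type*) [Field K] [NumberField K] (k : ℤ) (j : ℕ) : Prop :=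
  ∃ β : K → K, (∀ α ∈ R K k j, F k (β α) = α) ∧
    ∃ σ, Fx K k j σ ∧ σ (∏ α ∈ R K k j, (β α - (k:K)/2)) = - ∏ α ∈ R K k j, (β α - (k:K)/2)

open scoped Classical in
/-- fixed points of an automorphism on a level -/
noncomputable def Fs (k : ℤ) (j : ℕ) (σ : K ≃ₐ[ℚ] K) : Finset K := (R K k j).filter (fun x => σ x = x)

open scoped Classical in
/-- automorphisms with a fixed point on a level -/
noncomputable def Pn (K : Type*) [Field K] [NumberField K] (k : ℤ) (j : ℕ) : Finset (K ≃ₐ[ℚ] K) := Finset.univ.filter (fun σ => (Fs k j σ).Nonempty)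

lemma mem_Fs {k : ℤ} {j : ℕ} {σ : K ≃ₐ[ℚ] K} {x : K} : x ∈ Fs k j σ ↔ x ∈ R K k j ∧ σ x = x := by
  classical
  rw [Fs, Finset.mem_filter]

lemma Pn_anti (k : ℤ) (j : ℕ) : Pn K k (j+1) ⊆ Pn K k j := by
  classical
  intro σ hσ
  rw [Pn, Finset.mem_filter] at hσ ⊢
  obtain ⟨x, hx⟩ := hσ.2
  rw [mem_Fs] at hx
  refine ⟨Finset.mem_univ _, F k x, ?_⟩
  rw [mem_Fs, σF, hx.2]
  exact ⟨mem_R_succ.1 hx.1, rfl⟩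

variable {k : ℤ} {M : ℕ} [IsGalois ℚ K]

lemma burnside (hs : ((polyIter (fk k) M).map (algebraMap ℤ K)).Splits)
    (hq : ∀ j < M, ¬ IsSquare (dd k j)) (j : ℕ) (hj : j ≤ M) : ∑ σ : K ≃ₐ[ℚ] K, (Fs k j σ).card = Nat.card (K ≃ₐ[ℚ] K) := by
  classical
  have h := MulAction.sum_card_fixedBy_eq_card_orbits_mul_card_group (K ≃ₐ[ℚ] K) {x // x ∈ R K k j}
  have hne : (R K k j).Nonempty := by
    rw [← Finset.card_pos, card_R hs hq j hj]; positivity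
  obtain ⟨x0, hx0⟩ := hne
  have hsub : Subsingleton (Quotient (MulAction.orbitRel (K ≃ₐ[ℚ] K) {x // x ∈ R K k j})) := by
    constructor
    intro a b
    induction a using Quotient.inductionOn with | _ a => ?_
    induction b using Quotient.inductionOn with | _ b => ?_
    apply Quotient.sound
    obtain ⟨σ, h⟩ := trans_R hs hq j hj b.1 b.2 a.1 a.2
    exact ⟨σ, Subtype.ext h⟩
  have hcard : Fintype.card (Quotient (MulAction.orbitRel (K ≃ₐ[ℚ] K) {x // x ∈ R K k j})) = 1 := by
    rw [Fintype.card_eq_one_iff_nonempty_unique]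
    exact ⟨{ default := Quotient.mk _ ⟨x0, hx0⟩, uniq := fun a => Subsingleton.elim _ _ }⟩
  rw [hcard, one_mul] at h
  rw [Nat.card_eq_fintype_card, ← h]
  apply Finset.sum_congr rfl
  intro σ _
  rw [← Fintype.card_coe]
  refine Fintype.card_congr ⟨fun x => ⟨⟨x.1, (mem_Fs.1 x.2).1⟩, Subtype.ext (mem_Fs.1 x.2).2⟩,
    fun x => ⟨x.1.1, mem_Fs.2 ⟨x.1.2, congrArg Subtype.val x.2⟩⟩, fun x => rfl, fun x => rfl⟩

theorem step (hs : ((polyIter (fk k) M).map (algebraMap ℤ K)).Splits)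
    (hq : ∀ j < M, ¬ IsSquare (dd k j)) (hG : IsPGroup 2 (K ≃ₐ[ℚ] K)) (j : ℕ) (hj : j < M) (hg : GoodLev K k j) (C : ℕ) :
    C * (Pn K k j).card ≤ C * 2 ^ C * ((Pn K k j).card - (Pn K k (j+1)).card) + Nat.card (K ≃ₐ[ℚ] K) := by
  classical
  obtain ⟨β, hβ, hgood⟩ := hg
  choose ν hν1 hν2 using swap_all hs hq hG hj β hβ hgood
  set A := (Pn K k j).filter (fun σ => (Fs k j σ).card ≤ C) with hA
  set A' := (Pn K k j).filter (fun σ => ¬ (Fs k j σ).card ≤ C) with hA'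
  have h1 : (Pn K k j).card = A.card + A'.card := (Finset.card_filter_add_card_filter_not _).symm
  have h2 : C * A'.card ≤ Nat.card (K ≃ₐ[ℚ] K) := by
    rw [← burnside hs hq j hj.le, mul_comm, ← smul_eq_mul, ← Finset.sum_const]
    refine le_trans (Finset.sum_le_sum (f := fun _ => C) (g := fun σ => (Fs k j σ).card) (s := A') ?_) (Finset.sum_le_sum_of_subset (Finset.subset_univ _))
    intro σ hσ
    rw [hA', Finset.mem_filter] at hσ
    show C ≤ (Fs k j σ).card
    omega
  have h3 : A.card ≤ 2 ^ C * ((Pn K k j) \ (Pn K k (j+1))).card := by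
    let S : (K ≃ₐ[ℚ] K) → Finset K := fun σ => (Fs k j σ).filter (fun α => ∃ x, F k x = α ∧ σ x = x)
    let Φ : (K ≃ₐ[ℚ] K) → (K ≃ₐ[ℚ] K) := fun σ => σ * ν (S σ)
    have hΦR : ∀ σ, ∀ x ∈ R K k j, Φ σ x = σ x := by
      intro σ x hx
      change σ (ν (S σ) x) = σ x
      rw [hν1 _ x hx]
    have hFs : ∀ σ, Fs k j (Φ σ) = Fs k j σ := by
      intro σ
      ext x
      rw [mem_Fs, mem_Fs]
      constructor
      · rintro ⟨hx, h⟩; rw [hΦR σ x hx] at h; exact ⟨hx, h⟩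
      · rintro ⟨hx, h⟩; refine ⟨hx, ?_⟩; rw [hΦR σ x hx]; exact h
    have h4 : A.card ≤ 2 ^ C * (((Pn K k j) \ (Pn K k (j+1))).filter (fun σ => (Fs k j σ).card ≤ C)).card := by
      refine Finset.card_le_mul_card_image_of_maps_to (f := Φ) ?_ _ ?_
      · intro σ hσ
        rw [hA, Finset.mem_filter, Pn, Finset.mem_filter] at hσ
        rw [Finset.mem_filter, Finset.mem_sdiff, Pn, Pn, Finset.mem_filter, Finset.mem_filter, hFs]
        refine ⟨⟨⟨Finset.mem_univ _, hσ.1.2⟩, ?_⟩, hσ.2⟩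
        rintro ⟨-, x, hx⟩
        rw [mem_Fs] at hx
        obtain ⟨hx1, hx2⟩ := hx
        have hα := mem_R_succ.1 hx1
        have hα2 : σ (F k x) = F k x := by
          rw [← hΦR σ _ hα, σF, hx2]
        have hne := ne_refl (bs_ne (hq j hj)) hx1
        change σ (ν (S σ) x) = x at hx2
        have hν3 := hν2 (S σ) (F k x) hα x rfl
        by_cases hmem : F k x ∈ S σ
        · rw [hν3.1 (by exact_mod_cast hmem)] at hx2
          rw [Finset.mem_filter] at hmem
          obtain ⟨y, hy1, hy2⟩ := hmem.2
          have : σ x = x := by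
            rcases (F_eq_iff _ _ _).1 hy1 with h | h
            · rw [← h]; exact hy2
            · rw [h] at hy2; rwa [σ_refl] at hy2
          rw [map_sub, map_intCast, this] at hx2
          exact hne hx2.symm
        · rw [hν3.2 (by exact_mod_cast hmem)] at hx2
          apply hmem
          rw [Finset.mem_filter, mem_Fs]
          exact ⟨⟨hα, hα2⟩, x, rfl, hx2⟩
      · intro τ hτ
        rw [Finset.mem_filter] at hτ
        calc _ ≤ ((Fs k j τ).powerset.image (fun T : Finset K => τ * (ν (T : Set K))⁻¹)).card := by
              apply Finset.card_le_card
              intro σ hσ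
              rw [Finset.mem_filter] at hσ
              rw [Finset.mem_image]
              refine ⟨S σ, ?_, ?_⟩
              · rw [Finset.mem_powerset, ← hσ.2, hFs]; exact Finset.filter_subset _ _
              · rw [← hσ.2]; change σ * ν (S σ) * _ = σ; group
          _ ≤ (Fs k j τ).powerset.card := Finset.card_image_le
          _ = 2 ^ (Fs k j τ).card := Finset.card_powerset _
          _ ≤ 2 ^ C := Nat.pow_le_pow_right (by norm_num) hτ.2
    exact h4.trans (Nat.mul_le_mul_left _ (Finset.card_le_card (Finset.filter_subset _ _)))
  rw [Finset.card_sdiff_of_subset (Pn_anti k j)] at h3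
  rw [h1] at h3 ⊢
  rw [mul_add, mul_assoc]
  exact Nat.add_le_add (Nat.mul_le_mul_left _ h3) h2

open scoped Classical in
theorem many_good (hs : ((polyIter (fk k) M).map (algebraMap ℤ K)).Splits)
    (hq : ∀ j < M, ¬ IsSquare (dd k j)) (hG : IsPGroup 2 (K ≃ₐ[ℚ] K)) (C t : ℕ) (j : ℕ) (hj : j ≤ M) 
    (ht : t ≤ ((Finset.range j).filter (GoodLev K k)).card) (hbig : 2 * Nat.card (K ≃ₐ[ℚ] K) ≤ C * (Pn K k j).card) :
    t * Nat.card (K ≃ₐ[ℚ] K) + C * 2 ^ C * (Pn K k j).card ≤ C * 2 ^ C * Nat.card (K ≃ₐ[ℚ] K) := by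
  induction j generalizing t with
  | zero =>
    simp at ht
    subst ht
    rw [zero_mul, zero_add]
    apply Nat.mul_le_mul_left
    rw [Nat.card_eq_fintype_card]; exact Finset.card_le_univ _
  | succ j ih =>
    have hle : (Pn K k (j+1)).card ≤ (Pn K k j).card := Finset.card_le_card (Pn_anti k j)
    have hbig' : 2 * Nat.card (K ≃ₐ[ℚ] K) ≤ C * (Pn K k j).card := hbig.trans (Nat.mul_le_mul_left _ hle)
    by_cases hg : GoodLev K k j
    · rw [Finset.range_add_one, Finset.filter_insert, if_pos hg, Finset.card_insert_of_notMem (by simp)] at ht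
      have h1 := ih (t - 1) (by omega) (by omega) hbig'
      have h2 := step hs hq hG j (by omega) hg C
      set P := (Pn K k j).card
      set P' := (Pn K k (j+1)).card
      set g := Nat.card (K ≃ₐ[ℚ] K)
      set D := C * 2 ^ C
      obtain ⟨δ, hδ⟩ : ∃ δ, P = P' + δ := ⟨P - P', by omega⟩
      rw [hδ] at h1 h2 hbig'
      rw [show P' + δ - P' = δ by omega] at h2
      rcases Nat.eq_zero_or_pos t with rfl | ht0
      · nlinarith
      · obtain ⟨s, rfl⟩ : ∃ s, t = s + 1 := ⟨t - 1, by omega⟩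
        simp only [Nat.add_sub_cancel] at h1
        nlinarith
    · rw [Finset.range_add_one, Finset.filter_insert, if_neg hg] at ht
      have h1 := ih t (by omega) ht hbig'
      refine le_trans ?_ h1
      gcongr
end

theorem goodAt_of {k : ℤ} (hq : ∀ j, ¬ IsSquare (dd k j)) (S : Set ℕ) (hS : S.Infinite)
    (hgood : ∀ M, ∀ j < M, j ∈ S → GoodLev (KM k M) k j) (ε : ℝ) (hε : 0 < ε) : ∃ M, GoodAt k ε M := by
  classical
  obtain ⟨C, hC⟩ := exists_nat_gt (2 / ε)
  obtain ⟨T, hTS, hT⟩ := hS.exists_subset_card_eq (C * 2 ^ C + 1)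
  obtain ⟨M, hM⟩ : ∃ M, ∀ j ∈ T, j < M := ⟨T.sup id + 1, fun j hj => Nat.lt_succ_of_le (Finset.le_sup (f := id) hj)⟩
  refine ⟨M, KM k M, inferInstance, inferInstance, inferInstance, two_group (KM_adjoin k M), KM_splits k M, Pn (KM k M) k M, ?_, ?_⟩
  · intro σ β h1 h2
    rw [Pn, Finset.mem_filter]
    exact ⟨Finset.mem_univ _, β, mem_Fs.2 ⟨mem_R.2 h1, h2⟩⟩
  · by_contra hcon
    push Not at hcon
    set g := Nat.card (KM k M ≃ₐ[ℚ] KM k M) with hg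
    have hg0 : 0 < g := Nat.card_pos
    have hbig : 2 * g ≤ C * (Pn (KM k M) k M).card := by
      have h1 : (2 * g : ℝ) ≤ C * (Pn (KM k M) k M).card := by
        have : (2 : ℝ) < C * ε := by rwa [div_lt_iff₀ hε] at hC
        have h3 : (0:ℝ) < g := by exact_mod_cast hg0
        have h4 : (0:ℝ) < C := lt_trans (by positivity) hC
        nlinarith
      exact_mod_cast h1
    have := many_good (KM_splits k M) (fun j _ => hq j) (two_group (KM_adjoin k M)) C (C * 2 ^ C + 1) M le_rfl (by
      rw [← hT]
      apply Finset.card_le_card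
      intro j hj
      rw [Finset.mem_filter, Finset.mem_range]
      exact ⟨hM j hj, hgood M j (hM j hj) (hTS hj)⟩) hbig
    rw [← hg] at this
    nlinarith [Nat.zero_le (C * 2 ^ C * (Pn (KM k M) k M).card)]
end DZ


namespace DZ

section
variable {K : Type*} [Field K] [NumberField K] {Γ : Type*} [LinearOrderedCommGroupWithZero Γ] (v : Valuation K Γ)

lemma v_int_le (m : ℤ) : v (m : K) ≤ 1 := by
  induction m using Int.induction_on with
  | zero => simp
  | succ i ih => push_cast at ih ⊢; exact v.map_add_le ih (by simp)
  | pred i ih => push_cast at ih ⊢; exact v.map_sub_le ih (by simp)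

lemma v_unit {p : ℕ} (hp : p.Prime) (hv : v (p : K) < 1) (m : ℤ) (hm : ¬ (p : ℤ) ∣ m) : v (m : K) = 1 := by
  refine le_antisymm (v_int_le v m) ?_
  by_contra hlt
  push Not at hlt
  have hcop : IsCoprime (p : ℤ) m := (Prime.coprime_iff_not_dvd (Nat.prime_iff_prime_int.1 hp)).2 hm
  obtain ⟨a, b, hab⟩ := hcop
  have h1 : v ((a : K) * p + b * m) = 1 := by
    have : ((a * p + b * m : ℤ) : K) = 1 := by rw [hab]; simp
    push_cast at this
    rw [this]; simp
  have h2 : v ((a : K) * p + b * m) < 1 := by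
    apply v.map_add_lt
    · rw [map_mul]; exact lt_of_le_of_lt (mul_le_of_le_one_left' (v_int_le v a)) hv
    · rw [map_mul]; exact lt_of_le_of_lt (mul_le_of_le_one_left' (v_int_le v b)) hlt
  exact absurd h1 h2.ne

lemma v_int {p : ℕ} (hp : p.Prime) (hv : v (p : K) < 1) (m : ℤ) (hm : m ≠ 0) : v (m : K) = v (p : K) ^ (padicValInt p m) := by
  have : Fact p.Prime := ⟨hp⟩
  obtain ⟨c, hc⟩ := (padicValInt_dvd_iff (p := p) (padicValInt p m) m).2 (Or.inr le_rfl)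
  have hnd : ¬ (p : ℤ) ∣ c := by
    rintro ⟨d, rfl⟩
    have : ((p : ℤ) ^ (padicValInt p m + 1)) ∣ m := ⟨d, by rw [hc]; conv_lhs => rw [hc]
                                                           ring⟩
    rw [padicValInt_dvd_iff] at this
    rcases this with h | h
    · exact hm h
    · omega
  conv_lhs => rw [hc]
  push_cast
  rw [map_mul, map_pow, v_unit v hp hv c hnd, mul_one]

lemma v_rat {p : ℕ} (hp : p.Prime) (hv : v (p : K) < 1) (q : ℚ) (hq : q ≠ 0) : v (q : K) = v (p : K) ^ (padicValRat p q) := by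
  have hp0 : v (p : K) ≠ 0 := by rw [Valuation.ne_zero_iff]; exact_mod_cast hp.ne_zero
  conv_lhs => rw [← Rat.num_div_den q]
  push_cast
  have h2 := v_int v hp hv (q.den : ℤ) (by exact_mod_cast q.den_nz)
  rw [Int.cast_natCast] at h2
  rw [map_div₀, v_int v hp hv q.num (Rat.num_ne_zero.2 hq), h2, padicValRat, zpow_sub₀ hp0, zpow_natCast, zpow_natCast]
  congr 2

/-- unramified -/
def Unr (p : ℕ) (U : IntermediateField ℚ K) : Prop := ∀ x ∈ U, x ≠ 0 → ∃ m : ℤ, v x = v (p : K) ^ m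

lemma unr_ext {p : ℕ} (hp : p.Prime) (hv : v (p : K) < 1) (hv2 : v (2 : K) = 1) (U : IntermediateField ℚ K) (hU : Unr v p U) 
    (w : K) (hw : w ^ 2 ∈ U) (hvw : v (w ^ 2) = 1) : ∃ U' : IntermediateField ℚ K, U ≤ U' ∧ w ∈ U' ∧ Unr v p U' := by
  have hp0 : v (p : K) ≠ 0 := by rw [Valuation.ne_zero_iff]; exact_mod_cast hp.ne_zero
  have hw1 : v w = 1 := by
    rw [map_pow] at hvw
    exact pow_eq_one_iff.1 hvw |>.resolve_right (by norm_num)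
  let S : Subalgebra ℚ K :=
    { carrier := {x | ∃ a ∈ U, ∃ b ∈ U, x = a + b * w}
      mul_mem' := by
        rintro _ _ ⟨a, ha, b, hb, rfl⟩ ⟨c, hc, d, hd, rfl⟩
        exact ⟨a * c + b * d * w ^ 2, U.add_mem (U.mul_mem ha hc) (U.mul_mem (U.mul_mem hb hd) hw), a * d + b * c, U.add_mem (U.mul_mem ha hd) (U.mul_mem hb hc), by ring⟩
      add_mem' := by
        rintro _ _ ⟨a, ha, b, hb, rfl⟩ ⟨c, hc, d, hd, rfl⟩
        exact ⟨a + c, U.add_mem ha hc, b + d, U.add_mem hb hd, by ring⟩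
      algebraMap_mem' := fun r => ⟨algebraMap ℚ K r, U.algebraMap_mem r, 0, U.zero_mem, by ring⟩ }
  refine ⟨subalgebraEquivIntermediateField S, ?_, ?_, ?_⟩
  · intro x hx
    rw [mem_subalgebraEquivIntermediateField]
    exact ⟨x, hx, 0, U.zero_mem, by ring⟩
  · rw [mem_subalgebraEquivIntermediateField]
    exact ⟨0, U.zero_mem, 1, U.one_mem, by ring⟩
  · intro x hx hx0
    rw [mem_subalgebraEquivIntermediateField] at hx
    obtain ⟨a, ha, b, hb, rfl⟩ := hx
    by_cases hb0 : b = 0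
    · subst hb0
      obtain ⟨m, hm⟩ := hU a ha (by rintro rfl; simp at hx0)
      exact ⟨m, by simpa using hm⟩
    by_cases ha0 : a = 0
    · subst ha0
      obtain ⟨m, hm⟩ := hU b hb hb0
      exact ⟨m, by simp [hm, hw1]⟩
    obtain ⟨m, hm⟩ := hU a ha ha0
    obtain ⟨l, hl⟩ := hU b hb hb0
    have hbw : v (b * w) = v b := by rw [map_mul, hw1, mul_one]
    rcases lt_trichotomy (v a) (v b) with h | h | h
    · exact ⟨l, by rw [v.map_add_eq_of_lt_right (by rwa [hbw]), hbw, hl]⟩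
    · have hle : v (a + b * w) ≤ v a := v.map_add_le le_rfl (by rw [hbw, h])
      rcases hle.eq_or_lt with h1 | h1
      · exact ⟨m, by rw [h1, hm]⟩
      · have h2a : v (2 * a) = v a := by rw [map_mul, hv2, one_mul]
        have h2 : v (a - b * w) = v a := by
          have : a - b * w = 2 * a - (a + b * w) := by ring
          rw [this, v.map_sub_eq_of_lt_left (by rwa [h2a]), h2a]
        have hva : v a ≠ 0 := (v.ne_zero_iff).2 ha0
        have hne : a - b * w ≠ 0 := by rw [← v.ne_zero_iff, h2]; exact hva
        have h3 : a ^ 2 - b ^ 2 * w ^ 2 = (a + b * w) * (a - b * w) := by ring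
        obtain ⟨i, hi⟩ := hU (a ^ 2 - b ^ 2 * w ^ 2) (U.sub_mem (pow_mem ha 2) (U.mul_mem (pow_mem hb 2) hw)) (by rw [h3]; exact mul_ne_zero hx0 hne)
        rw [h3, map_mul, h2, hm] at hi
        refine ⟨i - m, ?_⟩
        rw [zpow_sub₀ hp0, ← hi, mul_div_assoc, div_self (zpow_ne_zero _ hp0), mul_one]
    · exact ⟨m, by rw [v.map_add_eq_of_lt_left (by rwa [hbw]), hm]⟩

lemma exists_maxU {p : ℕ} (hp : p.Prime) (hv : v (p : K) < 1) (hv2 : v (2 : K) = 1) : 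
    ∃ U : IntermediateField ℚ K, Unr v p U ∧ ∀ w : K, w ^ 2 ∈ U → v (w ^ 2) = 1 → w ∈ U := by
  have hfin : Finite (IntermediateField ℚ K) := Field.finite_intermediateField_of_exists_primitive_element ℚ K (Field.exists_primitive_element ℚ K)
  have hne : {U : IntermediateField ℚ K | Unr v p U}.Nonempty := by
    refine ⟨⊥, ?_⟩
    intro x hx hx0
    obtain ⟨q, rfl⟩ := IntermediateField.mem_bot.1 hx
    refine ⟨padicValRat p q, ?_⟩
    have := v_rat v hp hv q (by rintro rfl; simp at hx0)
    exact this
  obtain ⟨U, hU⟩ := Set.Finite.exists_maximal (Set.toFinite _) hne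
  refine ⟨U, hU.1, fun w h1 h2 => ?_⟩
  obtain ⟨U', hle, hw, hU'⟩ := unr_ext v hp hv hv2 U hU.1 w h1 h2
  exact hU.2 hU' hle hw

lemma vF_big {k : ℤ} {x : K} (hx : 1 < v x) : 1 < v (F k x) := by
  have h1 : F k x = x ^ 2 - (k * x - k) := by simp only [F]; ring
  have hx2 : v x < v (x ^ 2) := by
    rw [map_pow, sq]; exact lt_mul_of_one_lt_left (zero_lt_one.trans hx) hx
  have h2 : v (k * x - k) < v (x ^ 2) := by
    apply v.map_sub_lt
    · rw [map_mul]; exact lt_of_le_of_lt (mul_le_of_le_one_left' (v_int_le v k)) hx2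
    · exact lt_of_le_of_lt (v_int_le v k) (hx.trans hx2)
  rw [h1, v.map_sub_eq_of_lt_left h2]
  exact hx.trans hx2

lemma v_R_le {k : ℤ} {i : ℕ} {x : K} (hx : x ∈ R K k i) : v x ≤ 1 := by
  by_contra h
  push Not at h
  rw [mem_R] at hx
  have : 1 < v ((F k)^[i] x) := by
    clear hx
    induction i generalizing x with
    | zero => exact h
    | succ i ih => rw [Function.iterate_succ_apply]; exact ih (vF_big v h)
  rw [hx] at this
  simp at this

lemma vF_le {k : ℤ} {x : K} (hx : v x ≤ 1) : v (F k x) ≤ 1 := by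
  simp only [F]
  refine v.map_add_le (v.map_sub_le ?_ ?_) (v_int_le v k)
  · rw [map_pow]; exact pow_le_one' hx 2
  · rw [map_mul]; exact mul_le_one' (v_int_le v k) hx

lemma vF_contr {k : ℤ} (i : ℕ) {x y : K} (hx : v x ≤ 1) (hy : v y ≤ 1) : v ((F k)^[i] x - (F k)^[i] y) ≤ v (x - y) := by
  induction i generalizing x y with
  | zero => exact le_rfl
  | succ i ih =>
    rw [Function.iterate_succ_apply, Function.iterate_succ_apply]
    refine (ih (vF_le v hx) (vF_le v hy)).trans ?_
    rw [F_sub, map_mul]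
    exact mul_le_of_le_one_right' (v.map_sub_le (v.map_add_le hx hy) (v_int_le v k))

theorem good_v {k : ℤ} {M : ℕ} (hs : ((polyIter (fk k) M).map (algebraMap ℤ K)).Splits)
    (hq : ∀ j < M, ¬ IsSquare (dd k j)) [IsGalois ℚ K] {j : ℕ} (hj : j < M) {p : ℕ} (hp : p.Prime) (hv : v (p : K) < 1)
    (hp2 : ¬ (p:ℤ) ∣ 2) (hpk : ¬ (p:ℤ) ∣ k) (hodd : Odd (padicValRat p (bs k (j+1)))) : GoodLev K k j := by
  have hp0 : v (p : K) ≠ 0 := by rw [Valuation.ne_zero_iff]; exact_mod_cast hp.ne_zero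
  have hv2 : v (2 : K) = 1 := by have := v_unit v hp hv 2 hp2; exact_mod_cast this
  have hvk : v (k : K) = 1 := v_unit v hp hv k hpk
  set c : K := (k:K)/2 with hc
  have hvc : v c ≤ 1 := by rw [hc, map_div₀, hv2, div_one, hvk]
  set b : ℕ → K := fun n => (F k)^[n] c with hb
  have hbn : v (b (j+1)) = v (p:K) ^ (padicValRat p (bs k (j+1))) := by
    rw [← v_rat v hp hv _ (bs_ne (hq j hj)), bs_cast]
  have hble : ∀ n, v (b n) ≤ 1 := by
    intro n
    induction n with
    | zero => exact hvc
    | succ n ih => rw [hb]; simp only [Function.iterate_succ_apply']; exact vF_le v ih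
  have hbu : ∀ i, 1 ≤ i → i ≤ j → v (b i) = 1 := by
    intro i hi hij
    by_contra hne
    have hlt := lt_of_le_of_ne (hble i) hne
    have h1 : ∀ m, v (b (i + 1 + m) - k) < 1 := by
      intro m
      induction m with
      | zero =>
        have : b (i + 1 + 0) - k = b i * (b i - k) := by
          simp only [hb, add_zero, Function.iterate_succ_apply']
          simp only [F]; ring
        rw [this, map_mul]
        exact lt_of_le_of_lt (mul_le_of_le_one_right' (v.map_sub_le (hble i) hvk.le)) hlt
      | succ m ih =>
        have : b (i + 1 + (m+1)) - k = b (i + 1 + m) * (b (i + 1 + m) - k) := by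
          simp only [hb, ← add_assoc, Function.iterate_succ_apply']
          simp only [F]; ring
        rw [this, map_mul]
        exact lt_of_le_of_lt (mul_le_of_le_one_left' (hble _)) ih
    have h2 := h1 (j - i)
    rw [show i + 1 + (j - i) = j + 1 by omega] at h2
    have h3 : v (b (j+1)) = 1 := by
      have : b (j+1) = k + (b (j+1) - k) := by ring
      rw [this, v.map_add_eq_of_lt_left (by rwa [hvk]), hvk]
    rw [hbn] at h3
    have h4 : padicValRat p (bs k (j+1)) = 0 := 
      zpow_right_injective₀ (zero_lt_iff.2 hp0) hv.ne (by simpa using h3)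
    rw [h4] at hodd
    exact absurd hodd (by decide)
  obtain ⟨U, hU, hUw⟩ := exists_maxU v hp hv hv2
  have hcU : c ∈ U := by
    rw [hc]; exact U.div_mem (by exact_mod_cast U.intCast_mem k) (by exact_mod_cast U.natCast_mem 2)
  have hRU : ∀ i ≤ j, ∀ x ∈ R K k i, x ∈ U := by
    intro i
    induction i with
    | zero => intro _ x hx; rw [R_zero, Finset.mem_singleton] at hx; rw [hx]; exact U.zero_mem
    | succ i ih =>
      intro hij x hx
      have hα := mem_R_succ.1 hx
      have hαU := ih (by omega) _ hα
      have h1 : (x - c) ^ 2 = F k x - F k c := by rw [hc]; simp only [F]; ring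
      have hb1U : F k c ∈ U := by
        simp only [F]
        have hkU : (k : K) ∈ U := U.intCast_mem k
        exact U.add_mem (U.sub_mem (pow_mem hcU 2) (U.mul_mem hkU hcU)) hkU
      have h2 : v (F k x - F k c) = 1 := by
        apply le_antisymm
        · exact v.map_sub_le (v_R_le v hα) (vF_le v hvc)
        · have h3 := vF_contr (k := k) v i (v_R_le v hα) (vF_le (k := k) v hvc)
          rw [mem_R.1 hα, ← Function.iterate_succ_apply (F k), zero_sub, Valuation.map_neg] at h3
          have h4 := hbu (i+1) (by omega) (by omega)
          simp only [hb] at h4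
          rwa [h4] at h3
      have h5 := hUw (x - c) (by rw [h1]; exact U.sub_mem hαU hb1U) (by rw [h1, h2])
      have : x = (x - c) + c := by ring
      rw [this]; exact U.add_mem h5 hcU
  have hch : ∀ α ∈ R K k j, ∃ β, F k β = α := fun α hα => exists_child hs hj α (mem_R.1 hα)
  choose! β hβ using hch
  refine ⟨β, hβ, ?_⟩
  set r := ∏ α ∈ R K k j, (β α - (k:K)/2) with hr
  have hr2 : r ^ 2 = ((dd k j : ℚ) : K) := prod_sq hs hq j hj β hβ
  have hrU : r ∉ U := by
    intro hrU
    have hr0 : r ≠ 0 := by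
      intro h0
      rw [h0] at hr2
      apply hq j hj
      have : dd k j = 0 := by
        have h : ((dd k j : ℚ) : K) = 0 := by rw [← hr2]; ring
        exact_mod_cast h
      rw [this]; simp
    obtain ⟨m, hm⟩ := hU r hrU hr0
    have h1 : v (r ^ 2) = v (b (j+1)) := by
      rw [hr2, dd]
      push_cast
      rw [map_mul, map_pow, Valuation.map_neg, map_one, one_pow, one_mul, bs_cast]
    rw [map_pow, hm, hbn, ← zpow_natCast, ← zpow_mul] at h1
    have h4 := zpow_right_injective₀ (zero_lt_iff.2 hp0) hv.ne h1
    rw [← h4] at hodd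
    exact absurd hodd (by simp)
  set E := IntermediateField.adjoin ℚ (R K k j : Set K) with hE
  have hEU : E ≤ U := by
    rw [hE, IntermediateField.adjoin_le_iff]
    exact fun x hx => hRU j le_rfl x hx
  have hrE : r ∉ IntermediateField.fixedField E.fixingSubgroup := by
    rw [IsGalois.fixedField_fixingSubgroup]; exact fun h => hrU (hEU h)
  rw [IntermediateField.mem_fixedField_iff] at hrE
  push Not at hrE
  obtain ⟨σ, hσ, hσr⟩ := hrE
  refine ⟨σ, ?_, ?_⟩
  · intro x hx
    rw [IntermediateField.mem_fixingSubgroup_iff] at hσ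
    exact hσ x (IntermediateField.subset_adjoin ℚ _ hx)
  · have h1 : (σ r) ^ 2 = r ^ 2 := by
      rw [← map_pow, hr2]; simp
    rcases sq_eq_sq_iff_eq_or_eq_neg.1 h1 with h | h
    · exact absurd h hσr
    · exact h
end

theorem good_lev {K : Type*} [Field K] [NumberField K] {k : ℤ} {M : ℕ} (hs : ((polyIter (fk k) M).map (algebraMap ℤ K)).Splits)
    (hq : ∀ j < M, ¬ IsSquare (dd k j)) [IsGalois ℚ K] {j : ℕ} (hj : j < M) {p : ℕ} (hp : p.Prime)
    (hp2 : ¬ (p:ℤ) ∣ 2) (hpk : ¬ (p:ℤ) ∣ k) (hodd : Odd (padicValRat p (bs k (j+1)))) : GoodLev K k j := by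
  obtain ⟨Q, hQm, hQ⟩ : ∃ Q : Ideal (NumberField.RingOfIntegers K), Q.IsMaximal ∧ (p : NumberField.RingOfIntegers K) ∈ Q := by
    have hnt : Ideal.span {(p : NumberField.RingOfIntegers K)} ≠ ⊤ := by
      intro h
      have h1 : Ideal.absNorm (Ideal.span {(p : NumberField.RingOfIntegers K)}) = 1 := by rw [h]; simp
      rw [Ideal.absNorm_span_natCast] at h1
      replace h1 := (Nat.pow_eq_one.1 h1).resolve_right Module.finrank_pos.ne'
      exact hp.one_lt.ne' h1
    obtain ⟨Q, h1, h2⟩ := Ideal.exists_le_maximal _ hnt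
    exact ⟨Q, h1, h2 (Ideal.mem_span_singleton_self _)⟩
  let w : IsDedekindDomain.HeightOneSpectrum (NumberField.RingOfIntegers K) :=
    ⟨Q, hQm.isPrime, by rintro rfl; rw [Ideal.mem_bot] at hQ; exact hp.ne_zero (by exact_mod_cast hQ)⟩
  refine good_v (w.valuation K) hs hq hj hp ?_ hp2 hpk hodd
  have := (w.valuation_lt_one_iff_mem (K := K) (p : NumberField.RingOfIntegers K)).2 hQ
  simpa using this

theorem main_generic (k a₀ : ℤ) (hq : ∀ j, ¬ IsSquare (dd k j))
    (hgood : ∀ N, ∃ n ≥ N, ∃ p : ℕ, p.Prime ∧ ¬ (p:ℤ) ∣ 2 ∧ ¬ (p:ℤ) ∣ k ∧ Odd (padicValRat p (bs k (n+1)))) :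
    HasPrimeDensityZero (orbitPrimes (X ^ 2 - C k * X + C k) a₀) := by
  apply density_of
  intro ε hε
  refine goodAt_of hq {n | ∃ p : ℕ, p.Prime ∧ ¬ (p:ℤ) ∣ 2 ∧ ¬ (p:ℤ) ∣ k ∧ Odd (padicValRat p (bs k (n+1)))} ?_ ?_ ε hε
  · rw [Set.infinite_iff_exists_gt]
    intro N
    obtain ⟨n, hn, h⟩ := hgood (N+1)
    exact ⟨n, h, by omega⟩
  · rintro M j hj ⟨p, hp, h2, hk, ho⟩
    exact good_lev (KM_splits k M) (fun j _ => hq j) hj hp h2 hk ho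
end DZ


namespace DZ

lemma dens_k0 (a₀ : ℤ) : HasPrimeDensityZero (orbitPrimes (X ^ 2 - C (0:ℤ) * X + C (0:ℤ)) a₀) := by
  apply dens_of
  intro ε hε
  have hit : ∀ n, (F (0:ℤ))^[n] a₀ = a₀ ^ (2 ^ n) := by
    intro n
    induction n with
    | zero => simp
    | succ n ih => rw [Function.iterate_succ_apply', ih]; simp only [F]; push_cast; ring
  refine ⟨a₀.natAbs + 1, ?_⟩
  filter_upwards [eventually_ge_atTop 2] with N hN
  have h1 : primeCount (orbitPrimes (X ^ 2 - C (0:ℤ) * X + C (0:ℤ)) a₀) N ≤ a₀.natAbs + 1 := by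
    classical
    rw [primeCount]
    calc _ ≤ (Finset.range (a₀.natAbs + 1)).card := by
          apply Finset.card_le_card
          intro p hp
          rw [Finset.mem_filter] at hp
          obtain ⟨_, hpp, n, hn0, hn⟩ := hp
          rw [eval_it, hit] at hn0 hn
          have ha : a₀ ≠ 0 := by
            rintro rfl
            exact hn0 (by simp)
          have hd := (Nat.prime_iff_prime_int.1 hpp).dvd_of_dvd_pow hn
          have := Nat.le_of_dvd (Int.natAbs_pos.2 ha) (by simpa using Int.natAbs_dvd_natAbs.2 hd)
          rw [Finset.mem_range]; omega
      _ = _ := by simp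
  have h2 : (0:ℝ) ≤ ε * (N / Real.log N) := by
    have : 0 ≤ Real.log N := Real.log_nonneg (by exact_mod_cast (by omega : 1 ≤ N))
    positivity
  have h3 : ((primeCount (orbitPrimes (X ^ 2 - C (0:ℤ) * X + C (0:ℤ)) a₀) N : ℕ) : ℝ) ≤ a₀.natAbs + 1 := by exact_mod_cast h1
  linarith

lemma pI_mod2 {k : ℤ} (hk : Even k) (n : ℕ) : (polyIter (fk k) n).map (Int.castRingHom (ZMod 2)) = X ^ (2 ^ n) := by
  have hk' : (Int.castRingHom (ZMod 2)) k = 0 := by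
    rw [eq_intCast, ZMod.intCast_zmod_eq_zero_iff_dvd]; exact hk.two_dvd
  induction n with
  | zero => simp [polyIter]
  | succ n ih =>
    rw [polyIter, Polynomial.map_comp, ih, fk]
    simp only [Polynomial.map_add, Polynomial.map_sub, Polynomial.map_mul, Polynomial.map_pow, map_X, map_C, hk']
    simp
    ring

lemma F_it_zero (k : ℤ) (m : ℕ) : (F k)^[m+1] (0:ℤ) = k := by
  induction m with
  | zero => simp [F]
  | succ m ih => rw [Function.iterate_succ_apply', ih]; simp only [F]; push_cast; ring

lemma irr_iter {k c : ℤ} (hk : Even k) (hc : Even c) (m : ℕ) (h4 : ¬ (4:ℤ) ∣ k - c) :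
    Irreducible (polyIter (fk k) (m+1) - C c) := by
  have hdeg : (C c : ℤ[X]).degree < (polyIter (fk k) (m+1)).degree := by
    refine lt_of_le_of_lt degree_C_le ?_
    rw [← natDegree_pos_iff_degree_pos, pI_natDegree]; positivity
  have hmon : (polyIter (fk k) (m+1) - C c).Monic := (pI_monic k (m+1)).sub_of_left hdeg
  have hnd : (polyIter (fk k) (m+1) - C c).natDegree = 2 ^ (m+1) := by
    rw [natDegree_sub_C, pI_natDegree]
  have hP : (Ideal.span {(2:ℤ)}).IsPrime := (Ideal.span_singleton_prime (by norm_num)).2 Int.prime_two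
  refine IsEisensteinAt.irreducible ⟨?_, ?_, ?_⟩ hP hmon.isPrimitive (by rw [hnd]; positivity)
  · rw [hmon.leadingCoeff]; exact fun h => hP.ne_top ((Ideal.eq_top_iff_one _).2 h)
  · intro i hi
    rw [hnd] at hi
    have h1 : ((polyIter (fk k) (m+1) - C c).map (Int.castRingHom (ZMod 2))).coeff i = 0 := by
      rw [Polynomial.map_sub, pI_mod2 hk, map_C, eq_intCast, (ZMod.intCast_zmod_eq_zero_iff_dvd c 2).2 hc.two_dvd]
      simp [coeff_X_pow, hi.ne]
    rw [coeff_map, eq_intCast, ZMod.intCast_zmod_eq_zero_iff_dvd] at h1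
    rw [Ideal.mem_span_singleton]; exact h1
  · rw [Ideal.span_singleton_pow, Ideal.mem_span_singleton]
    have : (polyIter (fk k) (m+1) - C c).coeff 0 = k - c := by
      rw [coeff_sub, coeff_C_zero]
      congr 1
      rw [coeff_zero_eq_eval_zero, ← coe_aeval_eq_eval, pI_aeval, F_it_zero]
    rw [this]; norm_num; exact h4

lemma card_lower {K : Type*} [Field K] [NumberField K] [IsGalois ℚ K] {k c : ℤ} (hk : Even k) (hc : Even c) (m : ℕ) (h4 : ¬ (4:ℤ) ∣ k - c)
    (β : K) (hβ : (F k)^[m+1] β = c) : 2 ^ (m+1) ≤ Nat.card (K ≃ₐ[ℚ] K) := by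
  rw [IsGalois.card_aut_eq_finrank]
  have hirr := irr_iter hk hc m h4
  have hdeg : (C c : ℤ[X]).degree < (polyIter (fk k) (m+1)).degree := by
    refine lt_of_le_of_lt degree_C_le ?_
    rw [← natDegree_pos_iff_degree_pos, pI_natDegree]; positivity
  have hmon : (polyIter (fk k) (m+1) - C c).Monic := (pI_monic k (m+1)).sub_of_left hdeg
  have hirrQ := (hmon.isPrimitive.irreducible_iff_irreducible_map_fraction_map (K := ℚ)).1 hirr
  have h0 : aeval β ((polyIter (fk k) (m+1) - C c).map (algebraMap ℤ ℚ)) = 0 := by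
    rw [aeval_map_algebraMap, map_sub, pI_aeval, hβ]; simp
  have h1 := minpoly.eq_of_irreducible_of_monic hirrQ h0 (hmon.map _)
  have h2 := minpoly.natDegree_le (A := ℚ) β
  rwa [← h1, hmon.natDegree_map, natDegree_sub_C, pI_natDegree] at h2

lemma goodAt_sp {k : ℤ} (m M : ℕ) (ε : ℝ) (hcard : 2 ^ m ≤ Nat.card (KM k M ≃ₐ[ℚ] KM k M)) (hε : (1/2:ℝ) ^ m ≤ ε)
    (hfix : ∀ (σ : KM k M ≃ₐ[ℚ] KM k M) (β γ : KM k M), (F k)^[M] β = 0 → (F k)^[M] γ = 0 → σ β = β → σ γ = γ) : GoodAt k ε M := by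
  refine ⟨KM k M, inferInstance, inferInstance, inferInstance, two_group (KM_adjoin k M), KM_splits k M, {1}, ?_, ?_⟩
  · intro σ β hβ hσ
    rw [Finset.mem_singleton]
    have hle : IntermediateField.adjoin ℚ (R (KM k M) k M : Set (KM k M)) ≤ IntermediateField.fixedField (Subgroup.zpowers σ) := by
      rw [IntermediateField.adjoin_le_iff]
      intro y hy
      have h1 := hfix σ β y hβ (mem_R.1 hy) hσ
      rw [SetLike.mem_coe, IntermediateField.mem_fixedField_iff]
      intro f hf
      have : Subgroup.zpowers σ ≤ MulAction.stabilizer (KM k M ≃ₐ[ℚ] KM k M) y := by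
        rw [Subgroup.zpowers_le]; exact h1
      exact this hf
    rw [KM_adjoin] at hle
    ext x
    exact (IntermediateField.mem_fixedField_iff _ _).1 (hle (by trivial : x ∈ ⊤)) _ (Subgroup.mem_zpowers _)
  · have h1 : ((2:ℝ) ^ m) ≤ (Nat.card (KM k M ≃ₐ[ℚ] KM k M) : ℝ) := by exact_mod_cast hcard
    have h2 : (1/2:ℝ) ^ m * 2 ^ m = 1 := by rw [← mul_pow]; norm_num
    simp only [Finset.card_singleton, Nat.cast_one]
    calc (1:ℝ) = (1/2:ℝ) ^ m * 2 ^ m := h2.symm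
      _ ≤ ε * _ := by
        apply mul_le_mul hε h1 (by positivity)
        exact le_trans (by positivity) hε

lemma exists_root {k : ℤ} (M : ℕ) : ∃ β : KM k M, (F k)^[M] β = 0 := by
  have hs := KM_splits k M
  have hd : ((polyIter (fk k) M).map (algebraMap ℤ (KM k M))).degree ≠ 0 := by
    have : 0 < ((polyIter (fk k) M).map (algebraMap ℤ (KM k M))).natDegree := by
      rw [(pI_monic k M).natDegree_map, pI_natDegree]; positivity
    exact (natDegree_pos_iff_degree_pos.1 this).ne'
  obtain ⟨β, hβ⟩ := hs.exists_eval_eq_zero hd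
  exact ⟨β, by rwa [eval_map_algebraMap, pI_aeval] at hβ⟩

/-- generic primitive root criterion -/
lemma prim_of {L : Type*} [Field L] [CharZero L] {z : L} {m : ℕ} (h : z ^ (2 ^ m) = -1) : IsPrimitiveRoot z (2 ^ (m+1)) := by
  rw [IsPrimitiveRoot.iff_orderOf]
  apply orderOf_eq_prime_pow
  · rw [h]; norm_num
  · rw [pow_succ, pow_mul, h]; norm_num

lemma prim_of3 {L : Type*} [Field L] [CharZero L] {z : L} {m : ℕ} (h : (z ^ (2 ^ m)) ^ 2 - z ^ (2 ^ m) + 1 = 0) : IsPrimitiveRoot z (3 * 2 ^ (m+1)) := by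
  rw [IsPrimitiveRoot.iff_orderOf]
  set w := z ^ (2 ^ m) with hw
  have h3 : w ^ 3 = -1 := by linear_combination (w + 1) * h
  have e1 : 3 * 2 ^ (m+1) = 2 ^ m * 6 := by ring
  apply orderOf_eq_of_pow_and_pow_div_prime (by positivity)
  · rw [e1, pow_mul, ← hw, show w ^ 6 = (w ^ 3) ^ 2 by ring, h3]; norm_num
  · intro p hp hd
    rcases (Nat.Prime.dvd_mul hp).1 hd with h | h
    · obtain rfl := (Nat.prime_dvd_prime_iff_eq hp Nat.prime_three).1 h
      rw [show 3 * 2 ^ (m+1) / 3 = 2 ^ m * 2 by rw [Nat.mul_div_cancel_left _ (by norm_num)]; ring, pow_mul, ← hw]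
      intro h1
      have h5 : w = 2 := by linear_combination (h1 - ‹w ^ 2 - w + 1 = 0›)
      rw [h5] at h1; norm_num at h1
    · obtain rfl := (Nat.prime_dvd_prime_iff_eq hp Nat.prime_two).1 (hp.dvd_of_dvd_pow h)
      rw [e1, show 2 ^ m * 6 / 2 = 2 ^ m * 3 by omega, pow_mul, ← hw, h3]
      norm_num

lemma fix_two {K : Type*} [Field K] [NumberField K] (M : ℕ) (σ : K ≃ₐ[ℚ] K) (β γ : K) (hβ : (F 2)^[M] β = 0) (hγ : (F 2)^[M] γ = 0) (h : σ β = β) : σ γ = γ := by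
  have hit : ∀ (n : ℕ) (x : K), (F 2)^[n] x - 1 = (x - 1) ^ (2 ^ n) := by
    intro n x
    induction n with
    | zero => simp
    | succ n ih => rw [Function.iterate_succ_apply', pow_succ, pow_mul, ← ih]; simp only [F]; push_cast; ring
  have h1 := hit M β
  have h2 := hit M γ
  rw [hβ, zero_sub] at h1
  rw [hγ, zero_sub] at h2
  have hp := prim_of h1.symm
  obtain ⟨i, -, hi⟩ := hp.eq_pow_of_pow_eq_one (ξ := γ - 1) (by rw [pow_succ, pow_mul, ← h2]; norm_num)
  have : γ = (β - 1) ^ i + 1 := by rw [hi]; ring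
  rw [this]; simp [h]

lemma exists_inv {L : Type*} [Field L] [IsAlgClosed L] (y : L) : ∃ z : L, z ≠ 0 ∧ y = z + z⁻¹ := by
  obtain ⟨z, hz⟩ := IsAlgClosed.exists_root (X ^ 2 - C y * X + C 1 : L[X]) (by
    have : (X ^ 2 - C y * X + C 1 : L[X]).degree = 2 := by compute_degree!
    rw [this]; norm_num)
  simp [IsRoot] at hz
  have h0 : z ≠ 0 := by rintro rfl; simp at hz
  refine ⟨z, h0, ?_⟩
  field_simp
  linear_combination -hz

lemma inv_it {L : Type*} [Field L] {z : L} (hz : z ≠ 0) (n : ℕ) : (fun x : L => x ^ 2 - 2)^[n] (z + z⁻¹) = z ^ (2 ^ n) + (z ^ (2 ^ n))⁻¹ := by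
  induction n with
  | zero => simp
  | succ n ih =>
    rw [Function.iterate_succ_apply', ih, pow_succ 2, pow_mul]
    have : z ^ 2 ^ n ≠ 0 := pow_ne_zero _ hz
    field_simp
    ring

/-- fixed points of Chebyshev type preimages -/
lemma fix_cheb {K : Type*} [Field K] [NumberField K] (M N : ℕ) (hN : 0 < N) (t : ℤ) 
    (ht : ∀ z : AlgebraicClosure K, z ≠ 0 → z ^ (2 ^ M) + (z ^ (2 ^ M))⁻¹ = t → IsPrimitiveRoot z N)
    (σ : K ≃ₐ[ℚ] K) (β γ : K) (hβ : (fun x : K => x ^ 2 - 2)^[M] β = t) (hγ : (fun x : K => x ^ 2 - 2)^[M] γ = t) (h : σ β = β) : σ γ = γ := by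
  have hmap : ∀ (n : ℕ) (x : K), algebraMap K (AlgebraicClosure K) ((fun x : K => x ^ 2 - 2)^[n] x) = (fun x => x ^ 2 - 2)^[n] (algebraMap K (AlgebraicClosure K) x) := by
    intro n x
    induction n generalizing x with
    | zero => rfl
    | succ n ih => rw [Function.iterate_succ_apply, Function.iterate_succ_apply, ih]; simp [map_ofNat]
  obtain ⟨z, hz0, hz⟩ := exists_inv (algebraMap K (AlgebraicClosure K) β)
  obtain ⟨y, hy0, hy⟩ := exists_inv (algebraMap K (AlgebraicClosure K) γ)
  have h1 := ht z hz0 (by rw [← inv_it hz0, ← hz, ← hmap, hβ]; simp)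
  have h2 := ht y hy0 (by rw [← inv_it hy0, ← hy, ← hmap, hγ]; simp)
  have : NeZero N := ⟨hN.ne'⟩
  obtain ⟨i, -, hi⟩ := h1.eq_pow_of_pow_eq_one h2.pow_eq_one
  have h3 : γ = aeval β (dickson 1 (1:ℤ) i) := by
    apply (algebraMap K (AlgebraicClosure K)).injective
    rw [← aeval_algebraMap_apply, hz, hy, ← eval_map_algebraMap, map_dickson]
    simp only [eq_intCast, Int.cast_one]
    rw [dickson_one_one_eval_add_inv _ _ (mul_inv_cancel₀ hz0), inv_pow, hi]
  have h4 : σ (aeval β (dickson 1 (1:ℤ) i)) = aeval (σ β) (dickson 1 (1:ℤ) i) := by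
    exact (aeval_algHom_apply ((σ : K →ₐ[ℚ] K).restrictScalars ℤ) β _).symm
  rw [h3, h4, h]

lemma shift_it {K : Type*} [Field K] (k s : ℤ) (hk : k = 2 * s) (hs : s ^ 2 - s = 2) (n : ℕ) (x : K) :
    (fun x : K => x ^ 2 - 2)^[n] (x - s) = (F k)^[n] x - s := by
  have hs' : (s:K) ^ 2 - s = 2 := by exact_mod_cast congrArg (Int.cast : ℤ → K) hs
  induction n generalizing x with
  | zero => rfl
  | succ n ih =>
    rw [Function.iterate_succ_apply, Function.iterate_succ_apply, ← ih]
    congr 1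
    simp only [F]
    rw [hk]; push_cast
    linear_combination hs'

lemma prim_neg2 {L : Type*} [Field L] [CharZero L] {z : L} (hz : z ≠ 0) (M : ℕ) (h : z ^ (2 ^ M) + (z ^ (2 ^ M))⁻¹ = (-2:ℤ)) : IsPrimitiveRoot z (2 ^ (M+1)) := by
  have h0 : z ^ 2 ^ M ≠ 0 := pow_ne_zero _ hz
  apply prim_of
  field_simp at h
  push_cast at h
  have : (z ^ 2 ^ M + 1) ^ 2 = 0 := by linear_combination h
  have := pow_eq_zero_iff (by norm_num) |>.1 this
  linear_combination this

lemma prim_1 {L : Type*} [Field L] [CharZero L] {z : L} (hz : z ≠ 0) (M : ℕ) (h : z ^ (2 ^ M) + (z ^ (2 ^ M))⁻¹ = (1:ℤ)) : IsPrimitiveRoot z (3 * 2 ^ (M+1)) := by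
  have h0 : z ^ 2 ^ M ≠ 0 := pow_ne_zero _ hz
  apply prim_of3
  field_simp at h
  push_cast at h
  linear_combination h

theorem main_special (k a₀ : ℤ) (hk : k = 0 ∨ k = 2 ∨ k = -2 ∨ k = 4) :
    HasPrimeDensityZero (orbitPrimes (X ^ 2 - C k * X + C k) a₀) := by
  rcases hk with rfl | hk
  · exact dens_k0 a₀
  apply density_of
  intro ε hε
  obtain ⟨m, hm⟩ := exists_pow_lt_of_lt_one hε (by norm_num : (1/2:ℝ) < 1)
  have hm1 : (1/2:ℝ) ^ (m+1) ≤ ε := by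
    refine le_trans ?_ hm.le
    rw [pow_succ]
    have : (0:ℝ) < (1/2)^m := by positivity
    linarith
  refine ⟨m+2, goodAt_sp (m+1) (m+2) ε ?_ hm1 ?_⟩
  · obtain ⟨β, hβ⟩ := exists_root (k := k) (m+2)
    rcases hk with rfl | rfl | rfl
    · refine le_trans (Nat.pow_le_pow_right (by norm_num) (by omega)) (card_lower (k := 2) (c := 0) (by decide) (by decide) (m+1) (by decide) β (by simpa using hβ))
    · refine le_trans (Nat.pow_le_pow_right (by norm_num) (by omega)) (card_lower (k := -2) (c := 0) (by decide) (by decide) (m+1) (by decide) β (by simpa using hβ))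
    · refine card_lower (k := 4) (c := 2) (by decide) (by decide) m (by decide) β ?_
      rw [Function.iterate_succ_apply'] at hβ
      set y := (F 4)^[m+1] β
      have : (y - 2) ^ 2 = 0 := by simp only [F] at hβ; push_cast at hβ; linear_combination hβ
      have := pow_eq_zero_iff (by norm_num) |>.1 this
      push_cast
      linear_combination this
  · intro σ β γ hβ hγ h
    rcases hk with rfl | rfl | rfl
    · exact fix_two _ σ β γ hβ hγ h
    · have := fix_cheb (m+2) _ (by positivity) 1 (fun z hz h => prim_1 hz _ h) σ (β - (-1:ℤ)) (γ - (-1:ℤ))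
        (by rw [shift_it (-2) (-1) (by norm_num) (by norm_num), hβ]; simp) (by rw [shift_it (-2) (-1) (by norm_num) (by norm_num), hγ]; simp) (by simp [h])
      simpa using this
    · have := fix_cheb (m+2) _ (by positivity) (-2) (fun z hz h => prim_neg2 hz _ h) σ (β - (2:ℤ)) (γ - (2:ℤ))
        (by rw [shift_it 4 2 (by norm_num) (by norm_num), hβ]; simp) (by rw [shift_it 4 2 (by norm_num) (by norm_num), hγ]; simp) (by simp [h, map_ofNat])
      simpa [map_ofNat] using this
end DZ


namespace DZ

/-- scaled critical orbit -/
def U (k : ℤ) : ℕ → ℤ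
  | 0 => 0
  | n + 1 => U k n ^ 2 + (2 * k - k ^ 2) * 4 ^ (2 ^ n - 1)

/-- scaled critical values -/
def Bz (k : ℤ) (n : ℕ) : ℤ := U k n ^ 2 + (4 * k - k ^ 2) * 4 ^ (2 ^ n - 1)

lemma four_pow {K : Type*} [Field K] (n : ℕ) : (4:K) ^ (2 ^ n - 1) * 4 = 4 ^ (2 ^ n) := by
  rw [← pow_succ]; congr 1; have : 0 < 2 ^ n := by positivity
  omega

lemma U_cast {K : Type*} [Field K] (h2 : (2:K) ≠ 0) (k : ℤ) (n : ℕ) :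
    (U k n : K) = ((F k)^[n] ((k:K) / 2) - k / 2) * 2 ^ (2 ^ n) := by
  induction n with
  | zero => simp [U]
  | succ n ih =>
    rw [U, Function.iterate_succ_apply']
    push_cast
    rw [ih]
    have h := four_pow (K := K) n
    have h3 : (4:K) ^ (2 ^ n) = (2 ^ (2 ^ n)) ^ 2 := by rw [← pow_mul, mul_comm, pow_mul]; norm_num
    have h4 : (4:K) ≠ 0 := by rw [show (4:K) = 2 * 2 by norm_num]; exact mul_ne_zero h2 h2
    have h5 : (4:K) ^ (2 ^ n - 1) = (2 ^ (2 ^ n)) ^ 2 / 4 := by rw [← h3, ← h]; field_simp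
    rw [h5, show (2:ℕ) ^ (n+1) = 2 ^ n * 2 by ring, pow_mul (2:K)]
    simp only [F]
    field_simp
    ring

lemma B_cast {K : Type*} [Field K] (h2 : (2:K) ≠ 0) (k : ℤ) (n : ℕ) :
    (Bz k n : K) = ((F k)^[n+1] ((k:K) / 2)) * (2 ^ (2 ^ n)) ^ 2 := by
    rw [Bz, Function.iterate_succ_apply']
    push_cast
    rw [U_cast h2]
    have h := four_pow (K := K) n
    have h3 : (4:K) ^ (2 ^ n) = (2 ^ (2 ^ n)) ^ 2 := by rw [← pow_mul, mul_comm, pow_mul]; norm_num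
    have h4 : (4:K) ≠ 0 := by rw [show (4:K) = 2 * 2 by norm_num]; exact mul_ne_zero h2 h2
    have h5 : (4:K) ^ (2 ^ n - 1) = (2 ^ (2 ^ n)) ^ 2 / 4 := by rw [← h3, ← h]; field_simp
    rw [h5]
    simp only [F]
    field_simp
    ring

lemma bs_B (k : ℤ) (n : ℕ) : bs k (n+1) = (Bz k n : ℚ) / (2 ^ (2 ^ n)) ^ 2 := by
  rw [B_cast (by norm_num), bs]; field_simp

lemma dd_zero {k : ℤ} (h0 : k ≠ 0) (h4 : k ≠ 4) : ¬ IsSquare (dd k 0) := by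
  intro h
  have e : dd k 0 = (((k - 2) ^ 2 - 4 : ℤ) : ℚ) / 2 ^ 2 := by
    simp only [dd, bs, Function.iterate_succ_apply', Function.iterate_zero_apply, F]; push_cast; ring
  have h1 : IsSquare ((((k - 2) ^ 2 - 4 : ℤ) : ℚ)) := by
    have : (((k - 2) ^ 2 - 4 : ℤ) : ℚ) = dd k 0 * (2 * 2) := by rw [e]; field_simp
    rw [this]; exact h.mul ⟨2, rfl⟩
  rw [Rat.isSquare_intCast_iff] at h1
  obtain ⟨t, ht⟩ := h1
  wlog htp : 0 ≤ t generalizing t with H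
  · exact H (-t) (by linarith) (by linarith)
  obtain ⟨s, hs, hsk⟩ : ∃ s : ℤ, 0 ≤ s ∧ (k - 2) ^ 2 = s ^ 2 := ⟨|k - 2|, abs_nonneg _, (sq_abs _).symm⟩
  have hs2 : s ≠ 2 := by
    rintro rfl
    have : k * (k - 4) = 0 := by linarith
    rcases mul_eq_zero.1 this with h | h
    · exact h0 h
    · exact h4 (by linarith)
  rw [hsk] at ht
  have h3 : s - t > 0 := by nlinarith
  have h5 : s ≤ 4 := by nlinarith
  have h6 : t ≤ 4 := by nlinarith
  interval_cases s <;> interval_cases t <;> omega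

lemma dd_succ (k : ℤ) (j : ℕ) : dd k (j+1) = bs k (j+2) := by
  rw [dd]
  have : Even (2 ^ (j+1)) := by rw [pow_succ]; exact even_two.mul_left _
  rw [this.neg_one_pow, one_mul]

/-- integer critical orbit for even `k` -/
def V (c : ℤ) : ℕ → ℤ
  | 0 => 0
  | n + 1 => V c n ^ 2 + (c - c ^ 2)

lemma bs_V (c : ℤ) (n : ℕ) : bs (2 * c) n = V c n + c := by
  induction n with
  | zero => simp [bs, V]
  | succ n ih =>
    rw [bs, Function.iterate_succ_apply', ← bs, ih, V]
    simp only [F]; push_cast; ring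

lemma V_large {c : ℤ} (hc : 3 ≤ c ∨ c ≤ -2) (n : ℕ) : c ^ 2 - c ≤ |V c (n+1)| := by
  have hA : 6 ≤ c ^ 2 - c := by rcases hc with h | h <;> nlinarith
  induction n with
  | zero =>
    rw [V, V, le_abs]; right; linarith
  | succ n ih =>
    rw [V, le_abs]; left
    have := sq_abs (V c (n+1))
    nlinarith

lemma nsq_gap {T W E : ℤ} (h : T ^ 2 = W ^ 2 + E) (hE : E ≠ 0) (hl : |E| < 2 * |W| - 1) : False := by
  have h1 := sq_abs T
  have h2 := sq_abs W
  have h3 := abs_nonneg T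
  have h4 := abs_nonneg W
  rw [abs_lt] at hl
  rcases lt_trichotomy |T| |W| with h5 | h5 | h5
  · nlinarith
  · apply hE; nlinarith
  · nlinarith

lemma dd_even {c : ℤ} (hc : 3 ≤ c ∨ c ≤ -2) (j : ℕ) : ¬ IsSquare (dd (2 * c) j) := by
  cases j with
  | zero => apply dd_zero <;> omega
  | succ j =>
    rw [dd_succ, bs_V]
    intro h
    have : ((V c (j+2) : ℚ) + c) = ((V c (j+2) + c : ℤ) : ℚ) := by push_cast; ring
    rw [this, Rat.isSquare_intCast_iff] at h
    obtain ⟨t, ht⟩ := h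
    have h1 := V_large hc j
    have hb : c * (c - 2) > 0 := by rcases hc with h | h <;> nlinarith
    refine nsq_gap (T := t) (W := V c (j+1)) (E := 2 * c - c ^ 2) ?_ (by nlinarith) ?_
    · rw [sq, ← ht, V]; ring
    · rw [abs_of_neg (by nlinarith)]
      rcases hc with h | h <;> nlinarith

lemma sq_B {k : ℤ} {j : ℕ} (h : IsSquare (bs k (j+1))) : IsSquare (Bz k j) := by
  rw [← Rat.isSquare_intCast_iff (z := Bz k j), B_cast (by norm_num)]
  exact h.mul ⟨2 ^ (2 ^ j), by ring⟩

lemma U_odd {k : ℤ} (hk : Odd k) (n : ℕ) : Odd (U k (n+1)) := by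
  induction n with
  | zero => simp [U]; exact (even_two_mul k).sub_odd hk.pow
  | succ n ih =>
    rw [U]
    have : Even ((4:ℤ) ^ (2 ^ (n+1) - 1)) := by
      apply Even.pow_of_ne_zero (by decide)
      rw [pow_succ]; have : 0 < 2 ^ n := by positivity
      omega
    exact ih.pow.add_even (this.mul_left _)

lemma dd_odd_one {k : ℤ} (hk : Odd k) : ¬ IsSquare (bs k 2) := by
  intro h
  obtain ⟨t, ht⟩ := sq_B h
  obtain ⟨m, rfl⟩ := hk
  simp [Bz, U] at ht
  have h1 : (t * t) % 8 = 5 := by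
    rw [← ht]
    have : (2 * (2 * m + 1) - (2 * m + 1) ^ 2) ^ 2 + (4 * (2 * m + 1) - (2 * m + 1) ^ 2) * 4 = 8 * (2*m^4 - 3 * m^2 + 2 * m + 1) + 5 := by ring
    omega
  have h2 : (t * t) % 8 = ((t % 8) * (t % 8)) % 8 := Int.mul_emod _ _ _
  have h3 : 0 ≤ t % 8 := by omega
  have h4 : t % 8 < 8 := by omega
  interval_cases (t % 8) <;> omega

lemma e_succ (n : ℕ) : (4:ℤ) ^ (2 ^ (n+1) - 1) = 4 * (4 ^ (2 ^ n - 1)) ^ 2 := by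
  rw [← pow_mul, ← pow_succ']; congr 1
  have : 0 < 2 ^ n := by positivity
  rw [pow_succ]; omega

lemma e_ge (n : ℕ) : (64:ℤ) ≤ 4 ^ (2 ^ (n+2) - 1) := by
  calc (64:ℤ) = 4 ^ 3 := by norm_num
    _ ≤ _ := by
      apply pow_le_pow_right₀ (by norm_num)
      have : 0 < 2 ^ n := by positivity
      rw [pow_add]; omega

lemma U_big {k : ℤ} (hk : 7 ≤ k ∨ k ≤ -7) (n : ℕ) : (k ^ 2 - 4 * k) * 4 ^ (2 ^ (n+2) - 1) + 1 < 2 * |U k (n+2)| := by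
  have hG : 21 ≤ k ^ 2 - 4 * k := by rcases hk with h | h <;> nlinarith
  have hA : k ^ 2 - 2 * k ≤ 2 * (k ^ 2 - 4 * k) := by rcases hk with h | h <;> nlinarith
  have hA2 : 0 < k ^ 2 - 2 * k := by rcases hk with h | h <;> nlinarith
  induction n with
  | zero =>
    have : U k 2 = (k ^ 2 - 2 * k) * (k ^ 2 - 2 * k - 4) := by simp [U]; ring
    have hA3 : 35 ≤ k ^ 2 - 2 * k := by rcases hk with h | h <;> nlinarith
    rw [zero_add, this, abs_of_pos (by nlinarith)]
    norm_num
    rcases hk with h | h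
    · rcases h.eq_or_lt with rfl | h
      · norm_num
      · have : 48 ≤ k ^ 2 - 2 * k := by nlinarith
        nlinarith
    · have h1 : -9 * k ≤ k ^ 2 - 2 * k := by nlinarith
      have h2 : 63 ≤ k ^ 2 - 2 * k := by nlinarith
      have h3 : 0 ≤ (k ^ 2 - 2 * k) * (k ^ 2 - 2 * k - 63) := mul_nonneg (by linarith) (by linarith)
      set A := k ^ 2 - 2 * k with hA'
      have h4 : k ^ 2 - 4 * k = A - 2 * k := by rw [hA']; ring
      rw [h4]
      nlinarith
  | succ n ih =>
    have he := e_ge n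
    set e := (4:ℤ) ^ (2 ^ (n+2) - 1) with hee
    rw [show n + 1 + 2 = (n + 2) + 1 by ring, e_succ, U, ← hee]
    set G := k ^ 2 - 4 * k with hGG
    have h1 := sq_abs (U k (n+2))
    have h2 : (G * e + 1) ^ 2 < 4 * U k (n+2) ^ 2 := by
      rw [← h1]; nlinarith [mul_pos (show 0 < G by omega) (show 0 < e by omega)]
    have h3 : G * (4 * e ^ 2) + 1 < 2 * (U k (n+2) ^ 2 + (2 * k - k ^ 2) * e) := by
      have h5 : (k ^ 2 - 2 * k) * e ≤ 2 * G * e := by nlinarith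
      have h6 : G * e * (G * e) ≥ G * e * (21 * e) := by
        apply mul_le_mul_of_nonneg_left _ (by nlinarith)
        nlinarith
      have h7 : G * e * e ≥ G * e * 64 := by
        apply mul_le_mul_of_nonneg_left he (by nlinarith)
      have h8 : G * e ≥ 21 * 64 := by nlinarith
      nlinarith
    exact lt_of_lt_of_le h3 (by linarith [le_abs_self (U k (n+2) ^ 2 + (2 * k - k ^ 2) * e)])

lemma dd_odd_big {k : ℤ} (hk : 7 ≤ k ∨ k ≤ -7) (n : ℕ) : ¬ IsSquare (bs k (n+3)) := by
  intro h
  obtain ⟨t, ht⟩ := sq_B (j := n+2) h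
  have hG : 21 ≤ k ^ 2 - 4 * k := by rcases hk with h | h <;> nlinarith
  have he := e_ge n
  have hU := U_big hk n
  rw [Bz] at ht
  set e := (4:ℤ) ^ (2 ^ (n+2) - 1) with hee
  have hpos : 0 < (k ^ 2 - 4 * k) * e := by positivity
  refine nsq_gap (T := t) (W := U k (n+2)) (E := (4 * k - k ^ 2) * e) (by rw [sq, ← ht]) (by nlinarith) ?_
  rw [abs_of_neg (by nlinarith)]
  nlinarith

lemma k_dvd_U (k : ℤ) (n : ℕ) : k ∣ U k n := by
  induction n with
  | zero => simp [U]
  | succ n ih =>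
    rw [U]
    exact dvd_add (dvd_pow ih (by norm_num)) (Dvd.dvd.mul_right ⟨2 - k, by ring⟩ _)

lemma dd_odd_p {k p : ℤ} (hp : Prime p) (hk : k ^ 2 = p ^ 2) (h2 : ¬ p ∣ 4) (n : ℕ) : ¬ IsSquare (bs k (n+1)) := by
  intro h
  obtain ⟨t, ht⟩ := sq_B (j := n) h
  obtain ⟨w, hw⟩ := k_dvd_U k n
  have hk0 : k ≠ 0 := by rintro rfl; exact hp.ne_zero (by simpa using hk.symm)
  have hpk : p ∣ k := by
    have : p ∣ k ^ 2 := by rw [hk]; exact dvd_pow_self _ (by norm_num)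
    exact hp.dvd_of_dvd_pow this
  have hB : Bz k n = k * (k * w ^ 2 + (4 - k) * 4 ^ (2 ^ n - 1)) := by rw [Bz, hw]; ring
  rw [hB] at ht
  have h1 : p ∣ t := by
    have : p ∣ t * t := by rw [← ht]; exact Dvd.dvd.mul_right hpk _
    exact (hp.dvd_mul.1 this).elim id id
  have h3 : k * k ∣ k * (k * w ^ 2 + (4 - k) * 4 ^ (2 ^ n - 1)) := by
    rw [ht, ← sq, hk, ← sq]; exact pow_dvd_pow_of_dvd h1 2
  have h4 := hpk.trans ((mul_dvd_mul_iff_left hk0).1 h3)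
  have h5 : p ∣ 4 * 4 ^ (2 ^ n - 1) := by
    have e : 4 * (4:ℤ) ^ (2 ^ n - 1) = (k * w ^ 2 + (4 - k) * 4 ^ (2 ^ n - 1)) - k * (w ^ 2 - 4 ^ (2 ^ n - 1)) := by ring
    rw [e]; exact dvd_sub h4 (Dvd.dvd.mul_right hpk _)
  rcases hp.dvd_mul.1 h5 with h | h
  · exact h2 h
  · exact h2 (hp.dvd_of_dvd_pow h)

lemma dd_neg1 (n : ℕ) : ¬ IsSquare (bs (-1) (n+1)) := by
  have key : ∀ n, |bs (-1) n + 1/2| ≤ 3/4 := by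
    intro n
    induction n with
    | zero => norm_num [bs]
    | succ n ih =>
      have : bs (-1) (n+1) + 1/2 = (bs (-1) n + 1/2) ^ 2 - 3/4 := by
        rw [bs, Function.iterate_succ_apply', ← bs]; simp only [F]; push_cast; ring
      rw [this]
      have h1 := sq_abs (bs (-1) n + 1/2)
      rw [abs_le]
      constructor <;> nlinarith [abs_nonneg (bs (-1) n + 1/2)]
  intro h
  have h0 := h.nonneg
  have : bs (-1) (n+1) + 1/2 = (bs (-1) n + 1/2) ^ 2 - 3/4 := by
    rw [bs, Function.iterate_succ_apply', ← bs]; simp only [F]; push_cast; ring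
  have h1 := sq_abs (bs (-1) n + 1/2)
  nlinarith [abs_nonneg (bs (-1) n + 1/2), key n]

lemma dd_pos1 (n : ℕ) : ¬ IsSquare (bs 1 (n+3)) := by
  have key : ∀ n, 0 ≤ U 1 n ∧ U 1 n ≤ 2 ^ (2 ^ n - 1) := by
    intro n
    induction n with
    | zero => norm_num [U]
    | succ n ih =>
      rw [U]
      have e1 : (4:ℤ) ^ (2 ^ n - 1) = (2 ^ (2 ^ n - 1)) ^ 2 := by rw [← pow_mul, mul_comm, pow_mul]; norm_num
      have e2 : (2:ℤ) ^ (2 ^ (n+1) - 1) = 2 * (2 ^ (2 ^ n - 1)) ^ 2 := by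
        rw [← pow_mul, ← pow_succ']; congr 1
        have : 0 < 2 ^ n := by positivity
        rw [pow_succ]; omega
      rw [e1, e2]
      constructor <;> nlinarith
  intro h
  obtain ⟨t, ht⟩ := sq_B (j := n+2) h
  rw [Bz] at ht
  have hodd := U_odd (k := 1) (by decide) (n+1)
  obtain ⟨hU0, hU1⟩ := key (n+2)
  have hm : 3 ≤ 2 ^ (n+2) - 1 := by
    have : 0 < 2 ^ n := by positivity
    rw [pow_add]; omega
  obtain ⟨m, hmm⟩ : ∃ m, 2 ^ (n+2) - 1 = m + 1 := ⟨2 ^ (n+2) - 2, by omega⟩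
  rw [hmm] at ht hU1 hm
  have hU2 : U 1 (n+2) = U 1 (n+1+1) := rfl
  rw [hU2] at ht hU0 hU1
  set W := U 1 (n+1+1)
  have hte : Odd t := by
    have h1 : Odd (t * t) := by
      rw [← ht]
      refine hodd.pow.add_even (Even.mul_left ?_ _)
      exact Even.pow_of_ne_zero (by decide) (by omega)
    exact (Int.odd_mul.1 h1).1
  wlog htp : 0 ≤ t generalizing t with H
  · exact H (-t) (by linarith) hte.neg (by linarith)
  obtain ⟨a, ha⟩ := hte.sub_odd hodd
  obtain ⟨b, hb⟩ := hte.add_odd hodd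
  have hab : a * b = 3 * 4 ^ m := by
    have : (t - W) * (t + W) = 3 * 4 ^ (m+1) := by linarith
    rw [ha, hb, pow_succ] at this
    linarith
  have hbpos : 0 ≤ b := by omega
  have hapos : 0 < a := by
    have : 0 < a * b := by rw [hab]; positivity
    by_contra hh
    push Not at hh
    nlinarith
  have hbpos : 0 < b := by
    have : 0 < a * b := by rw [hab]; positivity
    by_contra hh
    push Not at hh
    nlinarith
  have hW : W = b - a := by linarith
  have hsum : Odd (a + b) := by
    have : a + b = t := by linarith
    rwa [this]
  have fact : ∀ x y : ℤ, 0 < x → 0 < y → x * y = 3 * 4 ^ m → Odd x → x ≤ 3 ∧ (4:ℤ) ^ m ≤ y := by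
    intro x y hx hy hxy hxo
    have hc : IsCoprime x (4 ^ m) := by
      apply IsCoprime.pow_right
      have : IsCoprime x 2 := by
        obtain ⟨r, hr⟩ := hxo
        exact ⟨1, -r, by rw [hr]; ring⟩
      rw [show (4:ℤ) = 2 * 2 by norm_num]
      exact this.mul_right this
    have hd : x ∣ 3 := hc.dvd_of_dvd_mul_right ⟨y, hxy.symm⟩
    have h3 := Int.le_of_dvd (by norm_num) hd
    refine ⟨h3, ?_⟩
    have : (0:ℤ) < 4 ^ m := by positivity
    nlinarith
  have hbig : (2:ℤ) ^ (m+1) + 3 < 4 ^ m := by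
    obtain ⟨r, rfl⟩ : ∃ r, m = r + 2 := ⟨m - 2, by omega⟩
    have e : (4:ℤ) ^ (r+2) = (2 ^ r * 4) ^ 2 := by
      rw [mul_pow, ← pow_mul, mul_comm r, pow_mul, pow_add]; norm_num
    rw [e, show r + 2 + 1 = r + 3 by ring, pow_add]
    have : (1:ℤ) ≤ 2 ^ r := one_le_pow₀ (by norm_num)
    nlinarith
  rcases Int.even_or_odd a with hae | hao
  · have hbo : Odd b := by
      rcases Int.even_or_odd b with h | h
      · exact absurd hsum (by rw [Int.not_odd_iff_even]; exact hae.add h)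
      · exact h
    obtain ⟨h1, h2⟩ := fact b a hbpos hapos (by linarith) hbo
    linarith
  · obtain ⟨h1, h2⟩ := fact a b hapos hbpos hab hao
    linarith

theorem dd_all {k : ℤ} (h : k ≠ 0 ∧ k ≠ 2 ∧ k ≠ -2 ∧ k ≠ 4) (j : ℕ) : ¬ IsSquare (dd k j) := by
  rcases Int.even_or_odd k with he | ho
  · obtain ⟨c, rfl⟩ := he.two_dvd
    exact dd_even (by omega) j
  · cases j with
    | zero => exact dd_zero h.1 h.2.2.2
    | succ j =>
      rw [dd_succ]
      cases j with
      | zero => exact dd_odd_one ho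
      | succ j =>
        by_cases hb : 7 ≤ k ∨ k ≤ -7
        · exact dd_odd_big hb j
        · have : k = 1 ∨ k = -1 ∨ k ^ 2 = 3 ^ 2 ∨ k ^ 2 = 5 ^ 2 := by
            obtain ⟨m, rfl⟩ := ho
            have h1 : -4 ≤ m := by omega
            have h2 : m ≤ 3 := by omega
            interval_cases m <;> simp_all
          rcases this with rfl | rfl | h | h
          · exact dd_pos1 j
          · exact dd_neg1 (j+2)
          · exact dd_odd_p Int.prime_three h (by decide) (j+2)
          · exact dd_odd_p (p := 5) (by norm_num) h (by decide) (j+2)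
end DZ


namespace DZ

lemma nat_sq {n : ℕ} (hn : n ≠ 0) (h : ∀ p : ℕ, p.Prime → Even (padicValNat p n)) : IsSquare n := by
  refine ⟨n.factorization.prod fun p e => p ^ (e / 2), ?_⟩
  conv_lhs => rw [← Nat.prod_factorization_pow_eq_self hn]
  rw [← Finsupp.prod_mul]
  apply Finsupp.prod_congr
  intro p hp
  have hpp := Nat.prime_of_mem_primeFactors (Nat.support_factorization n ▸ hp)
  have := h p hpp
  rw [← Nat.factorization_def n hpp] at this
  obtain ⟨r, hr⟩ := this
  rw [← pow_add, hr]
  congr 1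
  omega

lemma int_sq {n : ℤ} (hn : n ≠ 0) (h : ∀ p : ℕ, p.Prime → Even (padicValInt p n)) : IsSquare n ∨ IsSquare (-n) := by
  have h1 : IsSquare n.natAbs := nat_sq (Int.natAbs_ne_zero.2 hn) h
  obtain ⟨r, hr⟩ := h1
  rcases Int.natAbs_eq n with h | h
  · left; exact ⟨r, by rw [h, hr]; push_cast; ring⟩
  · right; exact ⟨r, by rw [h, hr]; push_cast; ring⟩

def Bad (k : ℤ) (b : ℚ) : Prop := ∀ p : ℕ, p.Prime → ¬ (p:ℤ) ∣ 2 → ¬ (p:ℤ) ∣ k → ¬ Odd (padicValRat p b)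

lemma bad_sq {k κ Y d : ℤ} {b : ℚ} (hκ : κ ∣ 2 * k) (hκ0 : κ ≠ 0) (hY0 : Y ≠ 0) (hd0 : d ≠ 0) (hcop : IsCoprime Y (2 * k))
    (h : b = κ * Y / d ^ 2) (hbad : Bad k b) : IsSquare (κ * b) ∨ IsSquare (-(κ * b)) := by
  have hY : IsSquare Y ∨ IsSquare (-Y) := by
    apply int_sq hY0
    intro p hp
    have : Fact p.Prime := ⟨hp⟩
    have hpi := Nat.prime_iff_prime_int.1 hp
    by_cases hpk : (p:ℤ) ∣ 2 * k
    · have : ¬ (p:ℤ) ∣ Y := fun h => hpi.not_isUnit (hcop.isUnit_of_dvd' h hpk)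
      rw [padicValInt.eq_zero_of_not_dvd this]; exact Even.zero
    · have h1 := hbad p hp (fun h => hpk (h.mul_right _)) (fun h => hpk (h.mul_left _))
      have hκp : ¬ (p:ℤ) ∣ κ := fun h => hpk (h.trans hκ)
      have hκ' : (κ:ℚ) ≠ 0 := by exact_mod_cast hκ0
      have hY' : (Y:ℚ) ≠ 0 := by exact_mod_cast hY0
      have hd' : (d:ℚ) ≠ 0 := by exact_mod_cast hd0
      rw [h, padicValRat.div (mul_ne_zero hκ' hY') (pow_ne_zero _ hd'), padicValRat.mul hκ' hY', padicValRat.pow,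
        padicValRat.of_int, padicValRat.of_int, padicValInt.eq_zero_of_not_dvd hκp, Int.not_odd_iff_even] at h1
      push_cast at h1
      rw [zero_add, Int.even_sub] at h1
      have h2 := h1.2 (even_two_mul _)
      exact_mod_cast h2
  have hd' : (d:ℚ) ≠ 0 := by exact_mod_cast hd0
  rcases hY with ⟨r, hr⟩ | ⟨r, hr⟩
  · left
    refine ⟨κ * r / d, ?_⟩
    rw [h, hr]; push_cast; field_simp
  · right
    refine ⟨κ * r / d, ?_⟩
    have hY' : (Y:ℚ) = -(r * r) := by have := congrArg (Int.cast : ℤ → ℚ) hr; push_cast at this; linarith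
    rw [h, hY']; field_simp

lemma bad_odd {k : ℤ} (hk : Odd k) {n : ℕ} (hb : Bad k (bs k (n+2))) : IsSquare (k * bs k (n+2)) ∨ IsSquare (-(k * bs k (n+2))) := by
  have hk0 : k ≠ 0 := by rintro rfl; exact absurd hk (by decide)
  obtain ⟨w, hw⟩ := k_dvd_U k (n+1)
  have hB : Bz k (n+1) = k * (k * w ^ 2 + (4 - k) * 4 ^ (2 ^ (n+1) - 1)) := by rw [Bz, hw]; ring
  have hodd : Odd (Bz k (n+1)) := by
    rw [Bz]
    refine (U_odd hk n).pow.add_even (Even.mul_left ?_ _)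
    apply Even.pow_of_ne_zero (by decide)
    rw [pow_succ]; have : 0 < 2 ^ n := by positivity
    omega
  have hYo : Odd (k * w ^ 2 + (4 - k) * 4 ^ (2 ^ (n+1) - 1)) := by rw [hB] at hodd; exact (Int.odd_mul.1 hodd).2
  have hc2 : ∀ x : ℤ, Odd x → IsCoprime x 2 := by
    rintro x ⟨r, hr⟩
    exact ⟨1, -r, by rw [hr]; ring⟩
  refine bad_sq (k := k) (κ := k) (Y := k * w ^ 2 + (4 - k) * 4 ^ (2 ^ (n+1) - 1)) (d := 2 ^ (2 ^ (n+1))) (dvd_mul_left _ _) hk0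
    (by rintro h; rw [h] at hYo; exact absurd hYo (by decide)) (by positivity) ?_ ?_ hb
  · apply IsCoprime.mul_right (hc2 _ hYo)
    have : k * w ^ 2 + (4 - k) * 4 ^ (2 ^ (n+1) - 1) = 4 * 4 ^ (2 ^ (n+1) - 1) + (w ^ 2 - 4 ^ (2 ^ (n+1) - 1)) * k := by ring
    rw [this]
    refine IsCoprime.add_mul_right_left ?_ _
    have h4 : IsCoprime 4 k := by
      rw [show (4:ℤ) = 2 * 2 by norm_num]
      exact (hc2 k hk).symm.mul_left (hc2 k hk).symm
    exact h4.mul_left h4.pow_left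
  · rw [bs_B, hB]; push_cast; ring

lemma c_dvd_V (c : ℤ) (n : ℕ) : ∃ w, V c (n+1) = c * w ∧ (Even c → Odd w) ∧ (Odd c → Even w) := by
  induction n with
  | zero => 
    refine ⟨1 - c, by simp [V]; ring, fun h => ?_, fun h => ?_⟩
    · exact odd_one.sub_even h
    · exact odd_one.sub_odd h
  | succ n ih =>
    obtain ⟨w, hw, h1, h2⟩ := ih
    refine ⟨c * w ^ 2 + (1 - c), by rw [V, hw]; ring, fun h => ?_, fun h => ?_⟩
    · exact (h.mul_right _).add_odd (odd_one.sub_even h)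
    · exact (((h2 h).pow_of_ne_zero (by norm_num)).mul_left _).add (odd_one.sub_odd h)

lemma bad_even {c : ℤ} (hc0 : c ≠ 0) : ∃ κ : ℤ, κ ≠ 0 ∧ ∀ n, Bad (2 * c) (bs (2 * c) (n+2)) → IsSquare (κ * bs (2 * c) (n+2)) ∨ IsSquare (-(κ * bs (2 * c) (n+2))) := by
  have hc2 : ∀ x : ℤ, Odd x → IsCoprime x 2 := by
    rintro x ⟨r, hr⟩
    exact ⟨1, -r, by rw [hr]; ring⟩
  rcases Int.even_or_odd c with he | ho
  · refine ⟨2 * c, by omega, fun n hb => ?_⟩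
    obtain ⟨w, hw, h1, -⟩ := c_dvd_V c n
    obtain ⟨a, ha⟩ := he.two_dvd
    have hwo := h1 he
    obtain ⟨s, hs⟩ := hwo
    have hYo : Odd (a * (w ^ 2 - 1) + 1) := by
      rw [hs]; exact ⟨a * (2 * s ^ 2 + 2 * s), by ring⟩
    refine bad_sq (k := 2 * c) (κ := 2 * c) (Y := a * (w ^ 2 - 1) + 1) (d := 1) (dvd_mul_left _ _) (by omega)
      (by rintro h; rw [h] at hYo; exact absurd hYo (by decide)) (by norm_num) ?_ ?_ hb
    · refine (hc2 _ hYo).mul_right ((hc2 _ hYo).mul_right ?_)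
      rw [ha]
      refine (hc2 _ hYo).mul_right ?_
      exact ⟨1, -(w ^ 2 - 1), by ring⟩
    · rw [bs_V, V, hw]; push_cast; rw [ha]; push_cast; ring
  · refine ⟨c, hc0, fun n hb => ?_⟩
    obtain ⟨w, hw, -, h1⟩ := c_dvd_V c n
    have hwo := h1 ho
    have hYo : Odd (c * w ^ 2 + 2 - c) := by
      exact (((hwo.pow_of_ne_zero (by norm_num)).mul_left _).add even_two).sub_odd ho
    refine bad_sq (k := 2 * c) (κ := c) (Y := c * w ^ 2 + 2 - c) (d := 1) ⟨4, by ring⟩ hc0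
      (by rintro h; rw [h] at hYo; exact absurd hYo (by decide)) (by norm_num) ?_ ?_ hb
    · refine (hc2 _ hYo).mul_right ((hc2 _ hYo).mul_right ?_)
      have : c * w ^ 2 + 2 - c = 2 + (w ^ 2 - 1) * c := by ring
      rw [this]
      exact IsCoprime.add_mul_right_left (hc2 c ho).symm _
    · rw [bs_V, V, hw]; push_cast; ring

/-- certificates modulo a small prime -/
lemma cert {k : ℤ} (hk : Odd k) (p : ℕ) [Fact p.Prime] (hp2 : (2 : ZMod p) ≠ 0) (hm1 : IsSquare (-1 : ZMod p)) (n0 L : ℕ) (hL : 0 < L)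
    (hcyc : (F k)^[L] ((F k)^[n0] ((k : ZMod p) / 2)) = (F k)^[n0] ((k : ZMod p) / 2))
    (hns : ¬ IsSquare ((k : ZMod p) * (F k)^[n0] ((k : ZMod p) / 2))) (N : ℕ) :
    ∃ n ≥ N, ¬ Bad k (bs k (n+1)) := by
  obtain ⟨n, hn, hn1⟩ : ∃ n ≥ N + 1, (F k)^[n+1] ((k : ZMod p) / 2) = (F k)^[n0] ((k : ZMod p) / 2) := by
    refine ⟨L * (N + 2) + n0 - 1, ?_, ?_⟩
    · have : 1 * (N + 2) ≤ L * (N + 2) := Nat.mul_le_mul_right _ hL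
      omega
    · have : 1 * (N + 2) ≤ L * (N + 2) := Nat.mul_le_mul_right _ hL
      rw [show L * (N + 2) + n0 - 1 + 1 = L * (N+2) + n0 by omega, Function.iterate_add_apply, Function.iterate_mul]
      exact Function.iterate_fixed hcyc _
  refine ⟨n, by omega, fun hb => ?_⟩
  obtain ⟨m, rfl⟩ : ∃ m, n = m + 1 := ⟨n - 1, by omega⟩
  have h1 := bad_odd hk hb
  have hB : ((k * Bz k (m+1) : ℤ) : ℚ) = k * bs k (m+2) * (2 ^ (2 ^ (m+1)) * 2 ^ (2 ^ (m+1))) := by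
    push_cast; rw [B_cast (by norm_num), bs]; ring
  have h2 : IsSquare (k * Bz k (m+1)) ∨ IsSquare (-(k * Bz k (m+1))) := by
    rcases h1 with h | h
    · left
      rw [← Rat.isSquare_intCast_iff, hB]; exact h.mul ⟨_, rfl⟩
    · right
      rw [← Rat.isSquare_intCast_iff, Int.cast_neg, hB, ← neg_mul]; exact h.mul ⟨_, rfl⟩
  have h3 : IsSquare ((k * Bz k (m+1) : ℤ) : ZMod p) := by
    rcases h2 with h | h
    · exact h.map (Int.castRingHom (ZMod p))
    · have := (h.map (Int.castRingHom (ZMod p))).mul hm1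
      simpa using this
  apply hns
  push_cast at h3
  rw [B_cast hp2, hn1] at h3
  have h0 : (2:ZMod p) ^ (2 ^ (m+1)) ≠ 0 := pow_ne_zero _ hp2
  set y := (2:ZMod p) ^ (2 ^ (m+1))
  obtain ⟨r, hr⟩ := h3
  refine ⟨r / y, ?_⟩
  field_simp
  rw [mul_assoc, hr]; ring

lemma cert' {k : ℤ} (hk : Odd k) (p : ℕ) (hp : p.Prime) (h2 : ZMod p) (i : ZMod p) (hp2 : 2 * h2 = 1) (hm1 : i * i = -1) (n0 L : ℕ) (hL : 0 < L)
    (hcyc : (F k)^[L] ((F k)^[n0] ((k : ZMod p) * h2)) = (F k)^[n0] ((k : ZMod p) * h2))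
    (hns : ((k : ZMod p) * (F k)^[n0] ((k : ZMod p) * h2)) ^ (p / 2) ≠ 1 ∧ (k : ZMod p) * (F k)^[n0] ((k : ZMod p) * h2) ≠ 0) (N : ℕ) :
    ∃ n ≥ N, ¬ Bad k (bs k (n+1)) := by
  have : Fact p.Prime := ⟨hp⟩
  have h20 : (2 : ZMod p) ≠ 0 := left_ne_zero_of_mul_eq_one hp2
  have e : (k : ZMod p) / 2 = (k : ZMod p) * h2 := by
    rw [div_eq_iff h20, mul_assoc, mul_comm h2, hp2, mul_one]
  refine cert hk p h20 ⟨i, hm1.symm⟩ n0 L hL (by rw [e]; exact hcyc) ?_ N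
  rw [e, ZMod.euler_criterion p hns.2]
  exact hns.1

lemma good_small {k : ℤ} (hk : Odd k) (h1 : -16 ≤ k) (h2 : k ≤ 18) (N : ℕ) : ∃ n ≥ N, ¬ Bad k (bs k (n+1)) := by
  obtain ⟨m, rfl⟩ := hk
  have h3 : -8 ≤ m := by omega
  have h4 : m ≤ 8 := by omega
  interval_cases m
  · exact cert' (k := -15) (by decide) 13 (by norm_num) 7 5 (by decide) (by decide) 2 1 (by norm_num) (by decide) (by decide) N
  · exact cert' (k := -13) (by decide) 5 (by norm_num) 3 2 (by decide) (by decide) 0 1 (by norm_num) (by decide) (by decide) N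
  · exact cert' (k := -11) (by decide) 13 (by norm_num) 7 5 (by decide) (by decide) 0 1 (by norm_num) (by decide) (by decide) N
  · exact cert' (k := -9) (by decide) 5 (by norm_num) 3 2 (by decide) (by decide) 0 2 (by norm_num) (by decide) (by decide) N
  · exact cert' (k := -7) (by decide) 5 (by norm_num) 3 2 (by decide) (by decide) 2 1 (by norm_num) (by decide) (by decide) N
  · exact cert' (k := -5) (by decide) 13 (by norm_num) 7 5 (by decide) (by decide) 0 4 (by norm_num) (by decide) (by decide) N
  · exact cert' (k := -3) (by decide) 5 (by norm_num) 3 2 (by decide) (by decide) 0 1 (by norm_num) (by decide) (by decide) N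
  · exact cert' (k := -1) (by decide) 17 (by norm_num) 9 4 (by decide) (by decide) 3 3 (by norm_num) (by decide) (by decide) N
  · exact cert' (k := 1) (by decide) 5 (by norm_num) 3 2 (by decide) (by decide) 0 2 (by norm_num) (by decide) (by decide) N
  · exact cert' (k := 3) (by decide) 5 (by norm_num) 3 2 (by decide) (by decide) 2 1 (by norm_num) (by decide) (by decide) N
  · exact cert' (k := 5) (by decide) 17 (by norm_num) 9 4 (by decide) (by decide) 2 3 (by norm_num) (by decide) (by decide) N
  · exact cert' (k := 7) (by decide) 5 (by norm_num) 3 2 (by decide) (by decide) 0 1 (by norm_num) (by decide) (by decide) N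
  · exact cert' (k := 9) (by decide) 17 (by norm_num) 9 4 (by decide) (by decide) 4 2 (by norm_num) (by decide) (by decide) N
  · exact cert' (k := 11) (by decide) 5 (by norm_num) 3 2 (by decide) (by decide) 0 2 (by norm_num) (by decide) (by decide) N
  · exact cert' (k := 13) (by decide) 5 (by norm_num) 3 2 (by decide) (by decide) 2 1 (by norm_num) (by decide) (by decide) N
  · exact cert' (k := 15) (by decide) 13 (by norm_num) 7 5 (by decide) (by decide) 0 1 (by norm_num) (by decide) (by decide) N
  · exact cert' (k := 17) (by decide) 5 (by norm_num) 3 2 (by decide) (by decide) 0 1 (by norm_num) (by decide) (by decide) N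
end DZ


namespace DZ

lemma runge_core {α β γ b e u : ℚ} {d : ℤ} (hd : 1 ≤ d) (hα : α ≠ 0) 
    (hu : (3 + |α| + |β| + |γ| + |β| / |α|) * d ^ 3 < |u|) 
    (hαβ : ∀ u : ℚ, (u^2 + b) * ((u^2 + e)^2 + b) = (u^3 + γ * u)^2 + (α * u^2 + β))
    (hP : ∃ P : ℤ, 4 * (d:ℚ)^6 * ((u^2 + b) * ((u^2 + e)^2 + b)) = P)
    (hQ : ∃ Q : ℤ, 2 * (d:ℚ)^3 * (u^3 + γ * u) = Q) :
    ¬ IsSquare ((u^2 + b) * ((u^2 + e)^2 + b)) := by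
  intro hsq
  obtain ⟨P, hP⟩ := hP
  obtain ⟨Q, hQ⟩ := hQ
  have hP2 : IsSquare ((P:ℚ)) := by
    rw [← hP]
    exact IsSquare.mul ⟨2 * (d:ℚ)^3, by ring⟩ hsq
  rw [Rat.isSquare_intCast_iff] at hP2
  obtain ⟨T, hT⟩ := hP2
  have hd' : (1:ℚ) ≤ d := by exact_mod_cast hd
  have hd3 : (1:ℚ) ≤ (d:ℚ)^3 := one_le_pow₀ hd'
  set D := (d:ℚ)^3 with hD
  have hd6 : (d:ℚ)^6 = D ^ 2 := by rw [hD]; ring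
  have hαp : 0 < |α| := abs_pos.2 hα
  have hβ0 := abs_nonneg β
  have hγ0 := abs_nonneg γ
  have hr0 : 0 ≤ |β| / |α| := by positivity
  set C := 3 + |α| + |β| + |γ| + |β| / |α| with hC
  have hC3 : 3 ≤ C := by rw [hC]; linarith
  set a := |u| with ha
  have hu2 : u ^ 2 = a ^ 2 := (sq_abs u).symm
  have ha1 : C ≤ a := by nlinarith
  have ha3 : 3 ≤ a := by linarith
  have haa : a ≤ a ^ 2 := by nlinarith
  -- E ≠ 0
  have hE0 : α * u^2 + β ≠ 0 := by
    intro h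
    have h1 : |α| * a^2 = |β| := by
      rw [← abs_neg β, ← hu2, ← abs_of_nonneg (sq_nonneg u), ← abs_mul]
      congr 1; linarith
    have h2 : |β| / |α| = a ^ 2 := by rw [← h1]; field_simp
    have : a ^ 2 < C := by rw [hC, h2]; linarith
    linarith
  have hEq : 4 * D^2 * (α * u^2 + β) = ((T^2 - Q^2 : ℤ) : ℚ) := by
    have h1 : ((T * T : ℤ):ℚ) = P := by rw [hT]
    push_cast at h1 ⊢
    rw [sq (T:ℚ), h1, ← hP, ← hQ, hd6, hαβ u]; ring
  have hEabs : |4 * D^2 * (α * u^2 + β)| ≤ 4 * D^2 * (|α| * a^2 + |β|) := by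
    rw [abs_mul, abs_of_pos (by positivity : 0 < 4 * D^2)]
    gcongr
    refine (abs_add_le _ _).trans ?_
    rw [abs_mul, abs_of_nonneg (sq_nonneg u), hu2]
  have hQabs : 2 * D * (a^3 - |γ| * a) ≤ |(Q:ℚ)| := by
    rw [← hQ, abs_mul, abs_of_pos (by positivity : 0 < 2 * D)]
    gcongr
    have h1 : |u^3| = a^3 := by rw [abs_pow]
    have h2 : |γ * u| = |γ| * a := abs_mul _ _
    rw [← h1, ← h2]
    have h3 := abs_sub_abs_le_abs_sub (u^3) (-(γ * u))
    rwa [abs_neg, sub_neg_eq_add] at h3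
  have main : 4 * D^2 * (|α| * a^2 + |β|) < 2 * (2 * D * (a^3 - |γ| * a)) - 1 := by
    have h1 : D * a^2 * (C * D) ≤ D * a^2 * a := by
      apply mul_le_mul_of_nonneg_left hu.le; positivity
    have h2 : (|α| + |β| + |γ| + 3) ≤ C := by rw [hC]; linarith
    have h3 : D^2 * a^2 * (|α| + |β| + |γ| + 3) ≤ D^2 * a^2 * C := by
      apply mul_le_mul_of_nonneg_left h2; positivity
    have h4 : D^2 * |β| ≤ D^2 * |β| * a^2 := le_mul_of_one_le_right (by positivity) (by linarith)
    have h5 : D * (|γ| * a) ≤ D^2 * (|γ| * a^2) := by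
      apply mul_le_mul (by nlinarith) _ (by positivity) (by positivity)
      exact mul_le_mul_of_nonneg_left haa hγ0
    have h6 : 1 ≤ D^2 * a^2 := by
      have : 1 ≤ D^2 := one_le_pow₀ hd3
      nlinarith
    nlinarith
  refine nsq_gap (T := T) (W := Q) (E := T^2 - Q^2) (by ring) ?_ ?_
  · intro h0
    rw [h0] at hEq
    apply hE0
    have : 4 * D^2 ≠ 0 := by positivity
    simpa [this] using hEq
  · have : ((|T^2 - Q^2| : ℤ) : ℚ) < ((2 * |Q| - 1 : ℤ) : ℚ) := by
      push_cast
      have h1 : |(T:ℚ)^2 - (Q:ℚ)^2| ≤ 4 * D^2 * (|α| * a^2 + |β|) := by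
        rw [hEq] at hEabs; push_cast at hEabs; exact hEabs
      linarith
    exact_mod_cast this

/-- shifted orbit -/
def us (k : ℤ) (n : ℕ) : ℚ := bs k n - k / 2

lemma bs_us (k : ℤ) (n : ℕ) : bs k (n+1) = us k n ^ 2 + (k - k^2/4) := by
  rw [us, bs, Function.iterate_succ_apply', ← bs]; simp only [F]; ring

lemma us_succ (k : ℤ) (n : ℕ) : us k (n+1) = us k n ^ 2 + (k/2 - k^2/4) := by
  rw [us, bs_us]; ring

lemma runge (k : ℤ) (h0 : k ≠ 0) (h4 : k ≠ 4) : ∃ C : ℚ, ∀ (n : ℕ) (d : ℤ), 1 ≤ d → C * d ^ 3 < |us k n| →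
    (∃ W : ℤ, us k n * d = W) → (∃ w : ℤ, (k/2 : ℚ) * d = w) → ¬ IsSquare (bs k (n+1) * bs k (n+2)) := by
  set b : ℚ := k - k^2/4 with hb
  set e : ℚ := k/2 - k^2/4 with he
  have hα : b * (1 + e - b/4) ≠ 0 := by
    apply mul_ne_zero
    · have : b = (k:ℚ) * (4 - k) / 4 := by rw [hb]; ring
      rw [this]
      have h1 : (k:ℚ) ≠ 0 := by exact_mod_cast h0
      have h2 : (4 - k : ℚ) ≠ 0 := by
        intro h; apply h4
        have : (k:ℚ) = 4 := by linarith
        exact_mod_cast this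
      positivity
    · intro h
      have h1 : (3 * k^2 - 4 * k - 16 : ℚ) = 0 := by rw [hb, he] at h; linarith
      have h2 : 3 * k^2 - 4 * k - 16 = 0 := by exact_mod_cast h1
      have h3 : k ≤ 4 := by nlinarith
      have h5 : -4 ≤ k := by nlinarith
      interval_cases k <;> omega
  refine ⟨3 + |b * (1 + e - b/4)| + |b * (e^2 + b)| + |(2 * e + b)/2| + |b * (e^2 + b)| / |b * (1 + e - b/4)|, fun n d hd hC hW hw => ?_⟩
  · obtain ⟨W, hW⟩ := hW
    obtain ⟨w, hw⟩ := hw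
    have hd2 : ∃ x : ℤ, b * d^2 = x := ⟨2 * w * d - w^2, by push_cast; rw [← hw, hb]; ring⟩
    have he2 : ∃ x : ℤ, e * d^2 = x := ⟨w * d - w^2, by push_cast; rw [← hw, he]; ring⟩
    obtain ⟨x, hx⟩ := hd2
    obtain ⟨y, hy⟩ := he2
    rw [show n + 2 = (n+1) + 1 by ring, bs_us, bs_us, us_succ, ← hb, ← he]
    refine runge_core (α := b * (1 + e - b/4)) (β := b * (e^2 + b)) (γ := (2 * e + b)/2) hd hα hC (fun u => by ring) ?_ ?_
    · refine ⟨4 * ((W^2 + x) * ((W^2 + y)^2 + d^2 * x)), ?_⟩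
      push_cast
      rw [← hW, ← hx, ← hy]; ring
    · refine ⟨2 * W^3 + (2 * y + x) * W, ?_⟩
      push_cast
      rw [← hW, ← hx, ← hy]; ring

lemma growth {k : ℤ} (hu1 : 2 ≤ |us k 1|) (n : ℕ) : |us k 1| ≤ |us k (n+1)| ∧ (|us k 1| - 1) ^ (2 ^ n) ≤ |us k (n+1)| - 1 := by
  have hu : us k 1 = k/2 - k^2/4 := by rw [us_succ]; simp [us, bs]
  induction n with
  | zero => simp
  | succ n ih =>
    obtain ⟨h1, h2⟩ := ih
    have h3 : |us k (n+1)| ^ 2 - |us k 1| ≤ |us k (n+1+1)| := by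
      rw [us_succ k (n+1), ← hu, sq_abs]
      have := abs_sub_abs_le_abs_sub (us k (n+1) ^ 2) (-us k 1)
      rwa [abs_neg, sub_neg_eq_add, abs_of_nonneg (sq_nonneg _)] at this
    refine ⟨by nlinarith, ?_⟩
    rw [pow_succ, pow_mul]
    have h4 : ((|us k 1| - 1) ^ (2 ^ n)) ^ 2 ≤ (|us k (n+1)| - 1) ^ 2 :=
      pow_le_pow_left₀ (pow_nonneg (by linarith) _) h2 2
    nlinarith

theorem good_large {k : ℤ} (h0 : k ≠ 0) (h4 : k ≠ 4) (hu1 : 6 ≤ |us k 1|) (κ : ℤ) (hκ : κ ≠ 0)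
    (hbad : ∀ n, Bad k (bs k (n+2)) → IsSquare (κ * bs k (n+2)) ∨ IsSquare (-(κ * bs k (n+2))))
    (δ : ℤ) (hδ : 1 ≤ δ) (hδu : (δ:ℚ) ^ 6 < |us k 1| - 1) (hintg : ∀ n, ∃ W : ℤ, us k (n+1) * (δ:ℚ) ^ (2 ^ (n+1)) = W)
    (hint2 : ∃ w : ℤ, (k/2 : ℚ) * δ = w) (N : ℕ) : ∃ n ≥ N, ¬ Bad k (bs k (n+1)) := by
  by_contra hcon
  push Not at hcon
  obtain ⟨C, hC⟩ := runge k h0 h4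
  have hδ6 : (1:ℚ) ≤ (δ:ℚ) ^ 6 := one_le_pow₀ (by exact_mod_cast hδ)
  -- choose n
  set ρ := (|us k 1| - 1) / (δ:ℚ) ^ 6 with hρ
  have hρ1 : 1 < ρ := by rw [hρ, one_lt_div (by linarith)]; exact hδu
  obtain ⟨m, hm⟩ := pow_unbounded_of_one_lt C hρ1
  have hbig : ∃ n, N ≤ n ∧ C < ρ ^ (2 ^ n) := by
    refine ⟨max N m, le_max_left _ _, hm.trans_le (pow_le_pow_right₀ hρ1.le ?_)⟩
    exact (le_max_right N m).trans (Nat.lt_two_pow_self).le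
  obtain ⟨n, hNn, hn⟩ := hbig
  have hg := growth (by linarith) n
  have hg2 := growth (k := k) (by linarith) (n+1)
  have hu : us k 1 = k/2 - k^2/4 := by rw [us_succ]; simp [us, bs]
  have hd1 : 1 ≤ δ ^ (2 ^ (n+1)) := one_le_pow₀ hδ
  have hns := hC (n+1) (δ ^ (2 ^ (n+1))) hd1 ?_ (by push_cast; exact hintg n) ?_
  · have hpos : ∀ i, |us k 1| ≤ |us k i| → 0 < bs k (i+1) := by
      intro i hi
      rw [bs_us, ← sq_abs]
      have h1 : -(k - k^2/4 : ℚ) ≤ 2 * |us k 1| := by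
        rw [hu]
        have := neg_abs_le (k/2 - k^2/4 : ℚ)
        nlinarith [sq_nonneg (k:ℚ)]
      nlinarith
    have p1 := hpos (n+1) hg.1
    have p2 := hpos (n+2) hg2.1
    have b1 := hbad n (hcon (n+1) (by omega))
    have b2 := hbad (n+1) (hcon (n+2) (by omega))
    have hκ' : (κ:ℚ) ≠ 0 := by exact_mod_cast hκ
    apply hns
    have hprod : IsSquare (κ^2 * (bs k (n+2) * bs k (n+3))) := by
      have hp : 0 < κ^2 * (bs k (n+2) * bs k (n+3)) := by positivity
      rcases b1 with h1 | h1 <;> rcases b2 with h2 | h2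
      · have e : (κ:ℚ)^2 * (bs k (n+2) * bs k (n+3)) = κ * bs k (n+2) * (κ * bs k (n+3)) := by ring
        rw [e]; exact h1.mul h2
      · have := (h1.mul h2).nonneg
        exfalso; nlinarith
      · have := (h1.mul h2).nonneg
        exfalso; nlinarith
      · have e : (κ:ℚ)^2 * (bs k (n+2) * bs k (n+3)) = -(κ * bs k (n+2)) * (-(κ * bs k (n+3))) := by ring
        rw [e]; exact h1.mul h2
    obtain ⟨r, hr⟩ := hprod
    refine ⟨r / κ, ?_⟩
    show bs k (n+2) * bs k (n+3) = _
    field_simp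
    rw [← sq] at hr
    linarith
  · push_cast
    have h1 : ((δ:ℚ) ^ 2 ^ (n+1)) ^ 3 = ((δ:ℚ) ^ 6) ^ (2 ^ n) := by
      rw [← pow_mul, ← pow_mul]; congr 1; ring
    rw [h1]
    have h2 : C * ((δ:ℚ) ^ 6) ^ (2 ^ n) < ρ ^ (2^n) * ((δ:ℚ) ^ 6) ^ (2 ^ n) := by
      apply mul_lt_mul_of_pos_right hn; positivity
    have h3 : ρ ^ (2^n) * ((δ:ℚ) ^ 6) ^ (2 ^ n) = (|us k 1| - 1) ^ (2^n) := by
      rw [← mul_pow, hρ, div_mul_cancel₀]; positivity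
    linarith [hg.2]
  · obtain ⟨w, hw⟩ := hint2
    refine ⟨w * δ ^ (2 ^ (n+1) - 1), ?_⟩
    push_cast
    rw [← hw, mul_assoc, ← pow_succ']
    congr 2
    have : 0 < 2 ^ (n+1) := by positivity
    omega

theorem good_all {k : ℤ} (h : k ≠ 0 ∧ k ≠ 2 ∧ k ≠ -2 ∧ k ≠ 4) (N : ℕ) : ∃ n ≥ N, ¬ Bad k (bs k (n+1)) := by
  have hu : us k 1 = k/2 - k^2/4 := by rw [us_succ]; simp [us, bs]
  rcases Int.even_or_odd k with he | ho
  · obtain ⟨c, rfl⟩ := he.two_dvd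
    have hc : 3 ≤ c ∨ c ≤ -2 := by omega
    obtain ⟨κ, hκ, hbad⟩ := bad_even (c := c) (by omega)
    have hV : ∀ n, us (2 * c) n = V c n := by
      intro n; rw [us, bs_V]; push_cast; ring
    have h6 : (6:ℚ) ≤ |us (2 * c) 1| := by
      have h1 := V_large hc 0
      have : 6 ≤ |V c 1| := by rcases hc with h | h <;> nlinarith
      rw [hV]; exact_mod_cast this
    refine good_large h.1 h.2.2.2 h6 κ hκ hbad 1 le_rfl ?_ ?_ ?_ N
    · push_cast; linarith
    · intro n; exact ⟨V c (n+1), by rw [hV]; simp⟩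
    · exact ⟨c, by push_cast; ring⟩
  · by_cases hs : -16 ≤ k ∧ k ≤ 18
    · exact good_small ho hs.1 hs.2 N
    · have hb : 19 ≤ k ∨ k ≤ -17 := by
        obtain ⟨m, rfl⟩ := ho; omega
      have hA : (323:ℚ) ≤ k^2 - 2 * k := by
        have : 323 ≤ k^2 - 2 * k := by rcases hb with h | h <;> nlinarith
        exact_mod_cast this
      have habs : |us k 1| = (k^2 - 2 * k : ℚ)/4 := by
        rw [hu, abs_of_neg (by linarith)]; ring
      refine good_large h.1 h.2.2.2 (by rw [habs]; linarith) k h.1 (fun n => bad_odd ho) 2 (by norm_num) ?_ ?_ ?_ N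
      · rw [habs]; push_cast; norm_num; linarith
      · intro n; exact ⟨U k (n+1), by rw [U_cast (by norm_num), us, bs]; push_cast; ring⟩
      · exact ⟨k, by push_cast; ring⟩

end DZ

theorem density_zero_of_X_sq_sub_kX_add_k (k : ℤ) (a₀ : ℤ) : HasPrimeDensityZero (orbitPrimes (X ^ 2 - C k * X + C k) a₀) := by
  by_cases h : k = 0 ∨ k = 2 ∨ k = -2 ∨ k = 4
  · exact DZ.main_special k a₀ h
  · push Not at h
    refine DZ.main_generic k a₀ (DZ.dd_all h) (fun N => ?_)
    obtain ⟨n, hn, hb⟩ := DZ.good_all h N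
    refine ⟨n, hn, ?_⟩
    unfold DZ.Bad at hb
    push Not at hb
    obtain ⟨p, h1, h2, h3, h4⟩ := hb
    exact ⟨p, h1, h2, h3, by simpa using h4⟩
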